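/- Fix ν ∈ (0,1). There exists a sequence (a_n)_{n≥1} of real numbers with 0 ≤ a_n ≤ 2 satisfying condition R(ν) such that for every integer k ≥ 1 one has limsup_{x→∞} T_k(x) > 1 and liminf_{x→∞} T_k(x) < 1. -/

import Mathlib

open Finset Filter

/-- The generalized von Mangoldt function `Λ_k(n) = ∑_{d ∣ n} μ(d) (log (n/d))^k`. -/
noncomputable def Lambdak (k : ℕ) (n : ℕ) : ℝ :=
  ∑ d ∈ n.divisors, (ArithmeticFunction.moebius d : ℝ) * (Real.log ((n : ℝ) / (d : ℝ))) ^ k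

/-- `S_k(x) = ∑_{n ≤ x} a_n Λ_k(n)`. -/
noncomputable def Ssum (a : ℕ → ℝ) (k : ℕ) (x : ℝ) : ℝ :=
  ∑ n ∈ Finset.Icc 1 ⌊x⌋₊, a n * Lambdak k n

/-- `T_k(x) = S_k(x)/(k x (log x)^{k−1})`. -/
noncomputable def Tquot (a : ℕ → ℝ) (k : ℕ) (x : ℝ) : ℝ :=
  Ssum a k x / (k * x * Real.log x ^ (k - 1))

/-- Condition `R(ν)`: for every `B > 0` there is `C_B` with
`∑_{d ≤ x^ν} |∑_{n ≤ x, d ∣ n} a_n − x/d| ≤ C_B · x (log x)^{−B}` for all `x ≥ 2`. -/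
noncomputable def Rcond (ν : ℝ) (a : ℕ → ℝ) : Prop :=
  ∀ B : ℝ, 0 < B → ∃ C : ℝ, ∀ x : ℝ, 2 ≤ x →
    ∑ d ∈ Finset.Icc 1 ⌊x ^ ν⌋₊,
      |(∑ n ∈ (Finset.Icc 1 ⌊x⌋₊).filter (fun n => d ∣ n), a n) - x / d|
      ≤ C * x * Real.log x ^ (-B)

section

noncomputable def zr (n : ℕ) (s : ℂ) : ℂ :=
  ((n+1:ℕ):ℂ)^(-s) - (((n+1:ℕ):ℂ)^(1-s) - (n:ℂ)^(1-s))/(1-s)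

lemma zr_norm {n : ℕ} (hn : 1 ≤ n) {s : ℂ} (hs : 0 ≤ s.re) (hs1 : s ≠ 1) :
    ‖zr n s‖ ≤ ‖s‖ * (n:ℝ)^(-s.re-1) := by
  have hn0 : (0:ℝ) < n := by exact_mod_cast hn
  have h1s : (1 - s) ≠ 0 := sub_ne_zero.mpr (Ne.symm hs1)
  have hconv : Convex ℝ (Set.Icc (n:ℝ) (n+1)) := convex_Icc _ _
  -- first: |u^{-s} - (n+1)^{-s}| ≤ ‖s‖ n^{-σ-1}
  have hd1 : ∀ u ∈ Set.Icc (n:ℝ) (n+1),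
      HasDerivWithinAt (fun u : ℝ => (u:ℂ)^(-s)) ((-s) * (u:ℂ)^(-s-1)) (Set.Icc (n:ℝ) (n+1)) u := by
    intro u hu
    have hu0 : 0 < u := lt_of_lt_of_le hn0 hu.1
    have := (hasDerivAt_id (u:ℂ)).cpow_const (c := -s) (Or.inl (by simpa using hu0))
    have h2 := this.comp_ofReal
    simpa using h2.hasDerivWithinAt
  have hb1 : ∀ u ∈ Set.Icc (n:ℝ) (n+1), ‖(-s) * (u:ℂ)^(-s-1)‖ ≤ ‖s‖ * (n:ℝ)^(-s.re-1) := by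
    intro u hu
    have hu0 : 0 < u := lt_of_lt_of_le hn0 hu.1
    rw [norm_mul, norm_neg, Complex.norm_cpow_eq_rpow_re_of_pos hu0]
    simp only [Complex.sub_re, Complex.neg_re, Complex.one_re]
    exact mul_le_mul_of_nonneg_left
      (Real.rpow_le_rpow_of_nonpos hn0 hu.1 (by linarith)) (norm_nonneg _)
  have hdiff : ∀ u ∈ Set.Icc (n:ℝ) (n+1),
      ‖((n+1:ℕ):ℂ)^(-s) - (u:ℂ)^(-s)‖ ≤ ‖s‖ * (n:ℝ)^(-s.re-1) := by
    intro u hu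
    have h := hconv.norm_image_sub_le_of_norm_hasDerivWithin_le hd1 hb1 hu
      (y := (n:ℝ)+1) ⟨by linarith, le_refl _⟩
    have h3 : ‖(n:ℝ)+1 - u‖ ≤ 1 := by
      rw [Real.norm_eq_abs, abs_of_nonneg (by linarith [hu.2])]; linarith [hu.1]
    have h4 : (0:ℝ) ≤ ‖s‖ * (n:ℝ)^(-s.re-1) := by positivity
    push_cast at h ⊢
    nlinarith
  have hd2 : ∀ u ∈ Set.Icc (n:ℝ) (n+1),
      HasDerivWithinAt (fun u : ℝ => (u:ℂ) * ((n+1:ℕ):ℂ)^(-s) - (u:ℂ)^(1-s)/(1-s))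
        (((n+1:ℕ):ℂ)^(-s) - (u:ℂ)^(-s)) (Set.Icc (n:ℝ) (n+1)) u := by
    intro u hu
    have hu0 : 0 < u := lt_of_lt_of_le hn0 hu.1
    have h1 := ((hasDerivAt_id (u:ℂ)).cpow_const (c := 1-s) (Or.inl (by simpa using hu0))).div_const (1-s)
    have h2 := (((hasDerivAt_id (u:ℂ)).mul_const (((n+1:ℕ):ℂ)^(-s))).sub h1).comp_ofReal
    have h3 : (1 - s - 1) = -s := by ring
    refine HasDerivWithinAt.congr_deriv h2.hasDerivWithinAt ?_
    rw [h3]; simp only [id, mul_one, one_mul]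
    rw [mul_div_cancel_left₀ _ h1s]
  have h := hconv.norm_image_sub_le_of_norm_hasDerivWithin_le hd2 hdiff
      (x := (n:ℝ)) (y := (n:ℝ)+1) ⟨le_refl _, by linarith⟩ ⟨by linarith, le_refl _⟩
  have e : zr n s = (((((n:ℝ)+1 : ℝ):ℂ) * ((n+1:ℕ):ℂ)^(-s) - (((n:ℝ)+1:ℝ):ℂ)^(1-s)/(1-s)) -
     (((n:ℝ):ℂ) * ((n+1:ℕ):ℂ)^(-s) - ((n:ℝ):ℂ)^(1-s)/(1-s))) := by
    unfold zr; push_cast; ring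
  rw [e]
  simpa using h

lemma zr_summable {s : ℂ} (hs : 0 < s.re) (hs1 : s ≠ 1) (N : ℕ) (hN : 1 ≤ N) :
    Summable (fun n : ℕ => zr (n + N) s) := by
  have h : Summable (fun n : ℕ => ‖s‖ * (n:ℝ)^(-s.re-1)) :=
    (Real.summable_nat_rpow.mpr (by linarith)).mul_left _
  have h2 := (summable_nat_add_iff N).mpr h
  exact Summable.of_norm_bounded h2 (fun n => zr_norm (by omega) hs.le hs1)

lemma zeta_rep_one_lt {s : ℂ} (hs : 1 < s.re) :
    riemannZeta s = 1 + 1/(s-1) + ∑' n : ℕ, zr (n + 1) s := by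
  have hs1 : s ≠ 1 := by rintro rfl; simp at hs
  have h1s : (1 - s) ≠ 0 := sub_ne_zero.mpr (Ne.symm hs1)
  have hs0 : s ≠ 0 := by rintro rfl; norm_num at hs
  rw [zeta_eq_tsum_one_div_nat_add_one_cpow hs]
  have hsum : Summable (fun n : ℕ => 1/((n:ℂ)+1)^s) := by
    have := (Complex.summable_one_div_nat_cpow (p := s)).mpr hs
    simpa using (summable_nat_add_iff 1).mpr this
  have hH : HasSum (fun n : ℕ => zr (n+1) s) ((∑' n : ℕ, 1/((n:ℂ)+1)^s) - 1 - 1/(s-1)) := by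
    have hS := (zr_summable (s := s) (by linarith) hs1 1 le_rfl)
    rw [hS.hasSum_iff_tendsto_nat]
    have hpart : ∀ M : ℕ, ∑ n ∈ range M, zr (n+1) s =
        (∑ n ∈ range (M+1), 1/((n:ℂ)+1)^s) - 1 - (((M+1:ℕ):ℂ)^(1-s) - 1)/(1-s) := by
      intro M
      induction M with
      | zero => simp
      | succ M ih =>
        rw [Finset.sum_range_succ, ih, Finset.sum_range_succ _ (M+1)]
        unfold zr
        rw [Complex.cpow_neg]
        push_cast
        field_simp
        ring
    simp_rw [hpart]
    have t1 := (hsum.hasSum.tendsto_sum_nat).comp (tendsto_add_atTop_nat 1)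
    have t2 : Tendsto (fun M : ℕ => ((M+1:ℕ):ℂ)^(1-s)) atTop (nhds 0) := by
      rw [tendsto_zero_iff_norm_tendsto_zero]
      have : ∀ M : ℕ, ‖((M+1:ℕ):ℂ)^(1-s)‖ = ((M+1:ℕ):ℝ)^(-(s.re-1)) := by
        intro M
        rw [Complex.norm_natCast_cpow_of_pos (by omega)]; congr 1; simp
      simp_rw [this]
      exact (tendsto_rpow_neg_atTop (by linarith)).comp
        (tendsto_natCast_atTop_atTop.comp (tendsto_add_atTop_nat 1))
    have t3 := (t1.sub_const 1).sub ((t2.sub_const 1).div_const (1-s))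
    have e : (0 - 1 : ℂ)/(1-s) = 1/(s-1) := by
      rw [← neg_sub s 1]; rw [zero_sub, neg_div_neg_eq]
    rw [e] at t3
    exact t3
  rw [hH.tsum_eq]; ring

lemma zr_diff (n : ℕ) : DifferentiableOn ℂ (zr (n+1)) {s | s ≠ 1} := by
  intro s hs
  have h1s : (1 - s) ≠ 0 := sub_ne_zero.mpr (Ne.symm hs)
  unfold zr
  have h0 : (((n+1:ℕ)):ℂ) ≠ 0 := by exact_mod_cast Nat.succ_ne_zero n
  have h0' : (((n+1+1:ℕ)):ℂ) ≠ 0 := by exact_mod_cast Nat.succ_ne_zero (n+1)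
  apply DifferentiableAt.differentiableWithinAt
  apply DifferentiableAt.sub
  · exact (differentiableAt_id.neg).const_cpow (Or.inl h0')
  · apply DifferentiableAt.div
    · apply DifferentiableAt.sub
      · exact (differentiableAt_id.const_sub 1).const_cpow (Or.inl h0')
      · exact (differentiableAt_id.const_sub 1).const_cpow (Or.inl h0)
    · exact differentiableAt_id.const_sub 1
    · exact h1s

lemma zeta_rhs_diff {s0 : ℂ} (hs : 0 < s0.re) (hs1 : s0 ≠ 1) :
    DifferentiableAt ℂ (fun s => 1 + 1/(s-1) + ∑' n : ℕ, zr (n + 1) s) s0 := by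
  apply DifferentiableAt.add
  · apply DifferentiableAt.add (differentiableAt_const _)
    apply DifferentiableAt.div (differentiableAt_const _) (differentiableAt_id.sub_const 1)
    exact sub_ne_zero.mpr hs1
  · set U : Set ℂ := {s | s0.re/2 < s.re} ∩ {s | ‖s‖ < ‖s0‖+1} ∩ {s | s ≠ 1} with hU
    have hUo : IsOpen U := by
      apply IsOpen.inter (IsOpen.inter _ _) isOpen_ne
      · exact isOpen_lt continuous_const Complex.continuous_re
      · exact isOpen_lt continuous_norm continuous_const
    have hm : s0 ∈ U := ⟨⟨by simp; linarith, by simp⟩, hs1⟩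
    have hsum : Summable (fun n : ℕ => (‖s0‖+1) * ((n+1:ℕ):ℝ)^(-(s0.re/2)-1)) := by
      have h : Summable (fun n : ℕ => (‖s0‖+1) * (n:ℝ)^(-(s0.re/2)-1)) :=
        (Real.summable_nat_rpow.mpr (by linarith)).mul_left _
      exact (summable_nat_add_iff 1).mpr h
    have := Complex.differentiableOn_tsum_of_summable_norm (F := fun n s => zr (n+1) s) hsum
      (fun n => (zr_diff n).mono (fun s hs => hs.2)) hUo (by
        rintro n s ⟨⟨h1, h2⟩, h3⟩
        simp only [Set.mem_ofPred_eq] at h1 h2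
        refine (zr_norm (by omega) (by linarith) h3).trans ?_
        gcongr
        simp)
    exact (this s0 hm).differentiableAt (hUo.mem_nhds hm)

lemma zeta_rep {s : ℂ} (hs : 0 < s.re) (hs1 : s.im ≠ 0) :
    riemannZeta s = 1 + 1/(s-1) + ∑' n : ℕ, zr (n + 1) s := by
  have key : ∀ e : ℝ, 0 < e * s.im →
     riemannZeta s = 1 + 1/(s-1) + ∑' n : ℕ, zr (n + 1) s := by
    intro e he
    have hne : ∀ z : ℂ, 0 < e * z.im → z ≠ 1 := by rintro z hz rfl; simp at hz
    set U : Set ℂ := {z | 0 < z.re} ∩ {z | 0 < e * z.im} with hU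
    have hUo : IsOpen U := by
      apply IsOpen.inter
      · exact isOpen_lt continuous_const Complex.continuous_re
      · exact isOpen_lt continuous_const (continuous_const.mul Complex.continuous_im)
    have hUc : IsPreconnected U := by
      apply Convex.isPreconnected
      intro a ha b hb p q hp hq hpq
      simp only [hU, Set.mem_inter_iff, Set.mem_ofPred_eq] at ha hb ⊢
      have ha2 := ha.2
      have hb2 := hb.2
      constructor
      · simp
        rcases hp.eq_or_lt with h | h
        · have : q = 1 := by linarith
          subst this; rw [← h]; simp; exact hb.1
        · nlinarith [mul_pos h ha.1, mul_nonneg hq hb.1.le]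
      · simp
        rcases hp.eq_or_lt with h | h
        · have : q = 1 := by linarith
          subst this; rw [← h]; simp; exact hb2
        · nlinarith [mul_pos h ha2, mul_nonneg hq hb2.le]
    have h1 : AnalyticOnNhd ℂ riemannZeta U := by
      apply DifferentiableOn.analyticOnNhd _ hUo
      intro z hz
      exact (differentiableAt_riemannZeta (hne z hz.2)).differentiableWithinAt
    have h2 : AnalyticOnNhd ℂ (fun s => 1 + 1/(s-1) + ∑' n : ℕ, zr (n + 1) s) U := by
      apply DifferentiableOn.analyticOnNhd _ hUo
      intro z hz
      exact (zeta_rhs_diff hz.1 (hne z hz.2)).differentiableWithinAt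
    have hz0 : (⟨2, s.im⟩ : ℂ) ∈ U := ⟨by simp, he⟩
    refine h1.eqOn_of_preconnected_of_eventuallyEq h2 hUc hz0 ?_ ⟨hs, he⟩
    have : ∀ᶠ z : ℂ in nhds (⟨2, s.im⟩ : ℂ), 1 < z.re :=
      (isOpen_lt continuous_const Complex.continuous_re).mem_nhds (by simp)
    filter_upwards [this] with z hz
    exact zeta_rep_one_lt hz
  apply key s.im
  exact mul_self_pos.mpr hs1

lemma zeta_rep' {s : ℂ} (hs : 0 < s.re) (hs1 : s.im ≠ 0) (N : ℕ) :
    riemannZeta s = ∑ n ∈ range (N+1), ((n+1:ℕ):ℂ)^(-s) + ((N+1:ℕ):ℂ)^(1-s)/(s-1)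
      + ∑' n : ℕ, zr (n + (N+1)) s := by
  have hne : s ≠ 1 := by rintro rfl; simp at hs1
  have h1s : (1 - s) ≠ 0 := sub_ne_zero.mpr (Ne.symm hne)
  have hs1' : (s - 1) ≠ 0 := sub_ne_zero.mpr (hne)
  induction N with
  | zero => rw [zeta_rep hs hs1]; simp
  | succ N ih =>
    rw [ih, (zr_summable hs hne (N+1) (by omega)).tsum_eq_zero_add, Finset.sum_range_succ _ (N+1)]
    have e : ∀ b : ℕ, b + 1 + (N+1) = b + (N+1+1) := by intro b; ring
    simp only [e, zero_add]
    have e2 : zr (N+1) s = ((N+1+1:ℕ):ℂ)^(-s) + (((N+1+1:ℕ):ℂ)^(1-s) - ((N+1:ℕ):ℂ)^(1-s))/(s-1) := by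
      unfold zr
      rw [← neg_sub s 1, div_neg]; ring
    rw [e2]; ring

end

section

lemma sum_rpow_le {δ : ℝ} (h0 : 0 < δ) (h1 : δ ≤ 1) (N : ℕ) :
    ∑ n ∈ range N, ((n+1:ℕ):ℝ)^(δ-1) ≤ (N:ℝ)^δ/δ := by
  induction N with
  | zero => simp; positivity
  | succ N ih =>
    rw [Finset.sum_range_succ]
    have hp : (0:ℝ) < ((N+1:ℕ):ℝ) := by positivity
    have h := rpow_one_add_le_one_add_mul_self (s := -1/((N+1:ℕ):ℝ)) (p := δ)
      (by rw [le_div_iff₀ hp]; push_cast; linarith [Nat.cast_nonneg (α := ℝ) N]) h0.le h1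
    have e : (1 + -1/((N+1:ℕ):ℝ)) = (N:ℝ)/((N+1:ℕ):ℝ) := by field_simp; push_cast; ring
    rw [e, Real.div_rpow (by positivity) hp.le] at h
    rw [Real.rpow_sub_one hp.ne']
    have hq : 0 < ((N+1:ℕ):ℝ)^δ := Real.rpow_pos_of_pos hp _
    rw [div_le_iff₀ hq] at h
    have : ((N+1:ℕ):ℝ)^δ/((N+1:ℕ):ℝ) ≤ (((N+1:ℕ):ℝ)^δ - (N:ℝ)^δ)/δ := by
      rw [le_div_iff₀ h0]
      calc _ = ((N+1:ℕ):ℝ)^δ - (1 + δ * (-1/((N+1:ℕ):ℝ))) * ((N+1:ℕ):ℝ)^δ := by ring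
        _ ≤ _ := by linarith
    calc _ ≤ (N:ℝ)^δ/δ + (((N+1:ℕ):ℝ)^δ - (N:ℝ)^δ)/δ := by linarith
      _ = _ := by ring

lemma tail_term {q : ℝ} (h0 : 0 < q) (h1 : q ≤ 1) (n : ℕ) (hn : 1 ≤ n) :
    (n:ℝ)^(-q-1) ≤ (2/q) * ((n:ℝ)^(-q) - ((n+1:ℕ):ℝ)^(-q)) := by
  have hn0 : (0:ℝ) < n := by exact_mod_cast hn
  have hn1 : (1:ℝ) ≤ n := by exact_mod_cast hn
  have hp : (0:ℝ) < ((n+1:ℕ):ℝ) := by positivity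
  have h := rpow_one_add_le_one_add_mul_self (s := -1/((n+1:ℕ):ℝ)) (p := q)
      (by rw [le_div_iff₀ hp]; push_cast; linarith) h0.le h1
  have e : (1 + -1/((n+1:ℕ):ℝ)) = (n:ℝ)/((n+1:ℕ):ℝ) := by field_simp; push_cast; ring
  rw [e, Real.div_rpow (by positivity) hp.le] at h
  rw [Real.rpow_sub_one hn0.ne', Real.rpow_neg hn0.le, Real.rpow_neg hp.le]
  have hA : 0 < (n:ℝ)^q := Real.rpow_pos_of_pos hn0 _
  have hB : 0 < ((n+1:ℕ):ℝ)^q := Real.rpow_pos_of_pos hp _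
  set A := (n:ℝ)^q
  set B := ((n+1:ℕ):ℝ)^q
  have h2 : A⁻¹ - B⁻¹ = A⁻¹ * (1 - A/B) := by field_simp
  have h3 : q/(2*n) ≤ 1 - A/B := by
    have : q/(2*n) ≤ q/((n+1:ℕ):ℝ) := by
      apply div_le_div_of_nonneg_left h0.le hp; push_cast; linarith
    have h4 : q * (-1/((n+1:ℕ):ℝ)) = - (q/((n+1:ℕ):ℝ)) := by ring
    linarith
  rw [h2]
  calc A⁻¹/n = (2/q) * (A⁻¹ * (q/(2*n))) := by field_simp
    _ ≤ _ := by gcongr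

lemma tail_tsum {q : ℝ} (h0 : 0 < q) (h1 : q ≤ 1) (N : ℕ) :
    ∑' n : ℕ, ((n+(N+1):ℕ):ℝ)^(-q-1) ≤ (2/q) * ((N+1:ℕ):ℝ)^(-q) := by
  apply Real.tsum_le_of_sum_range_le (fun n => by positivity)
  intro M
  have : ∑ n ∈ range M, ((n+(N+1):ℕ):ℝ)^(-q-1) ≤ (2/q) * (((N+1:ℕ):ℝ)^(-q) - ((M+(N+1):ℕ):ℝ)^(-q)) := by
    induction M with
    | zero => simp
    | succ M ih =>
      rw [Finset.sum_range_succ]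
      have := tail_term h0 h1 (M+(N+1)) (by omega)
      have e : M+1+(N+1) = M+(N+1)+1 := by ring
      rw [e]
      nlinarith
  refine this.trans ?_
  have : 0 ≤ ((M+(N+1):ℕ):ℝ)^(-q) := by positivity
  gcongr
  linarith

lemma zeta_bound {δ : ℝ} (h0 : 0 < δ) (h1 : δ ≤ 1/4) :
    ∃ C : ℝ, 0 < C ∧ ∀ s : ℂ, 1 ≤ |s.im| → 1 - δ ≤ s.re → s.re ≤ 5 →
      ‖riemannZeta s‖ ≤ C * |s.im|^δ := by
  refine ⟨2 * (1/δ + 1 + 6 * (2/(1-δ))), by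
    have : 0 < 1-δ := by linarith
    positivity, ?_⟩
  intro s ht hσ hσ5
  have hq : 0 < 1 - δ := by linarith
  have him : s.im ≠ 0 := by intro h; rw [h] at ht; norm_num at ht
  have hne : s ≠ 1 := by rintro rfl; simp at him
  have hre : 0 < s.re := by linarith
  set t := |s.im| with htdef
  set N := ⌊t⌋₊ with hN
  have hN1 : ((N+1:ℕ):ℝ) ≤ 2*t := by
    have := Nat.floor_le (show 0 ≤ t by positivity); push_cast; linarith
  have hN2 : t ≤ ((N+1:ℕ):ℝ) := by
    have := Nat.lt_floor_add_one t; push_cast; linarith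
  have hNp : (0:ℝ) < ((N+1:ℕ):ℝ) := by positivity
  have hN1' : (1:ℝ) ≤ ((N+1:ℕ):ℝ) := by linarith
  set D := ((N+1:ℕ):ℝ)^δ with hD
  have hDp : 0 < D := Real.rpow_pos_of_pos hNp _
  have hD2 : D ≤ 2 * t^δ := by
    calc D ≤ (2*t)^δ := Real.rpow_le_rpow hNp.le hN1 h0.le
      _ = 2^δ * t^δ := Real.mul_rpow (by norm_num) (by positivity)
      _ ≤ 2^(1:ℝ) * t^δ := by
        gcongr; norm_num; linarith
      _ = _ := by simp
  have b1 : ‖∑ n ∈ range (N+1), ((n+1:ℕ):ℂ)^(-s)‖ ≤ D/δ := by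
    refine (norm_sum_le _ _).trans ?_
    refine (Finset.sum_le_sum (fun n _ => ?_)).trans (sum_rpow_le h0 (by linarith) (N+1))
    rw [Complex.norm_natCast_cpow_of_pos (by omega)]
    apply Real.rpow_le_rpow_of_exponent_le
    · push_cast; linarith [Nat.cast_nonneg (α := ℝ) n]
    · simp; linarith
  have htn : t ≤ ‖s - 1‖ := by
    have := Complex.abs_im_le_norm (s-1); simpa using this
  have b2 : ‖((N+1:ℕ):ℂ)^(1-s)/(s-1)‖ ≤ D := by
    rw [norm_div, Complex.norm_natCast_cpow_of_pos (by omega)]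
    rw [div_le_iff₀ (by linarith)]
    have : ((N+1:ℕ):ℝ)^(1-s).re ≤ D := by
      apply Real.rpow_le_rpow_of_exponent_le hN1'
      simp; linarith
    nlinarith
  have b3 : ‖∑' n : ℕ, zr (n + (N+1)) s‖ ≤ 6 * (2/(1-δ)) * D := by
    have hS : Summable (fun n : ℕ => ((n+(N+1):ℕ):ℝ)^(-(1-δ)-1)) := by
      have h : Summable (fun n : ℕ => (n:ℝ)^(-(1-δ)-1)) :=
        (Real.summable_nat_rpow.mpr (by linarith))
      exact (summable_nat_add_iff (N+1)).mpr h
    have h := tsum_of_norm_bounded (f := fun n : ℕ => zr (n + (N+1)) s) (hS.mul_left ‖s‖).hasSum (by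
      intro n
      refine (zr_norm (by omega) hre.le hne).trans ?_
      gcongr
      push_cast; linarith [Nat.cast_nonneg (α := ℝ) n, Nat.cast_nonneg (α := ℝ) N])
    rw [tsum_mul_left] at h
    refine h.trans ?_
    have hs6 : ‖s‖ ≤ 6 * t := by
      have := Complex.norm_le_abs_re_add_abs_im s
      rw [abs_of_pos hre] at this
      linarith
    have h5 : t * ((N+1:ℕ):ℝ)^(-(1-δ)) ≤ D := by
      rw [neg_sub, Real.rpow_sub_one hNp.ne', ← hD, mul_div_assoc', div_le_iff₀ hNp]
      nlinarith
    calc _ ≤ 6*t * ((2/(1-δ)) * ((N+1:ℕ):ℝ)^(-(1-δ))) := by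
          gcongr
          exact tail_tsum hq (by linarith) N
      _ = 6 * (2/(1-δ)) * (t * ((N+1:ℕ):ℝ)^(-(1-δ))) := by ring
      _ ≤ _ := by gcongr
  rw [zeta_rep' hre him N]
  have hC : 0 ≤ (1/δ + 1 + 6 * (2/(1-δ))) := by positivity
  calc _ ≤ D/δ + D + 6 * (2/(1-δ)) * D := norm_add₃_le.trans (by linarith)
    _ = (1/δ + 1 + 6 * (2/(1-δ))) * D := by ring
    _ ≤ (1/δ + 1 + 6 * (2/(1-δ))) * (2 * t^δ) := by gcongr
    _ = _ := by ring

lemma zeta_deriv_bound {δ : ℝ} (h0 : 0 < δ) (h1 : δ ≤ 1/4) :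
    ∃ C : ℝ, 0 < C ∧ ∀ s : ℂ, 2 ≤ |s.im| → 1 - δ/2 ≤ s.re → s.re ≤ 4 →
      ‖deriv riemannZeta s‖ ≤ C * |s.im|^δ := by
  obtain ⟨C, hC, h⟩ := zeta_bound h0 h1
  refine ⟨4*C/δ, by positivity, ?_⟩
  intro s ht hσ hσ5
  have hne : ∀ w : ℂ, ‖w - s‖ ≤ δ/2 → 1 ≤ |w.im| ∧ |w.im| ≤ 2*|s.im| ∧ |w.re - s.re| ≤ δ/2 := by
    intro w hw
    have e1 := (Complex.abs_im_le_norm (w - s)).trans hw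
    have e2 := (Complex.abs_re_le_norm (w - s)).trans hw
    simp only [Complex.sub_im, Complex.sub_re] at e1 e2
    refine ⟨?_, ?_, e2⟩
    · have := abs_sub_abs_le_abs_sub s.im w.im
      rw [abs_sub_comm] at this; linarith
    · have := abs_sub_abs_le_abs_sub w.im s.im
      linarith
  have hb : ∀ w ∈ Metric.sphere s (δ/2), ‖riemannZeta w‖ ≤ C * (2 * |s.im|^δ) := by
    intro w hw
    rw [mem_sphere_iff_norm] at hw
    obtain ⟨a1, a2, a3⟩ := hne w hw.le
    rw [abs_le] at a3
    refine (h w a1 (by linarith) (by linarith)).trans ?_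
    gcongr
    calc |w.im|^δ ≤ (2*|s.im|)^δ := Real.rpow_le_rpow (by positivity) a2 h0.le
      _ = 2^δ * |s.im|^δ := Real.mul_rpow (by norm_num) (by positivity)
      _ ≤ 2^(1:ℝ) * |s.im|^δ := by
        gcongr; norm_num; linarith
      _ = _ := by simp
  have hd : DiffContOnCl ℂ riemannZeta (Metric.ball s (δ/2)) := by
    apply DifferentiableOn.diffContOnCl
    rw [closure_ball _ (by positivity)]
    intro w hw
    rw [mem_closedBall_iff_norm] at hw
    apply DifferentiableAt.differentiableWithinAt
    apply differentiableAt_riemannZeta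
    rintro rfl
    have := (hne 1 hw).1
    norm_num at this
  have := Complex.norm_deriv_le_of_forall_mem_sphere_norm_le (by positivity) hd hb
  refine this.trans (le_of_eq ?_)
  field_simp
  ring

end

section

lemma zeta_real_bound : ∃ D : ℝ, 0 < D ∧ ∀ x : ℝ, 0 < x → x ≤ 1 → ‖riemannZeta (1 + x)‖ ≤ D / x := by
  have hK : IsCompact ((fun x : ℝ => (1 + x : ℂ)) '' Set.Icc (0:ℝ) 1) :=
    isCompact_Icc.image (by fun_prop)
  obtain ⟨D, hD⟩ := hK.exists_bound_of_continuousOn differentiable_riemannZeta₁.continuous.continuousOn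
  refine ⟨max D 1, by positivity, ?_⟩
  intro x hx hx1
  have hne : (1 + x : ℂ) ≠ 1 := by
    simpa using hx.ne'
  rw [riemannZeta_eq_inv_sub_mul hne, norm_mul]
  have := hD (1+x) ⟨x, ⟨hx.le, hx1⟩, rfl⟩
  have e : ‖(1 + (x:ℂ) - 1)⁻¹‖ = x⁻¹ := by
    simp [abs_of_pos hx]
  rw [e, div_eq_inv_mul]
  gcongr
  exact this.trans (le_max_left _ _)

lemma zeta_341 {x : ℝ} (hx : 0 < x) (y : ℝ) :
    1 ≤ ‖riemannZeta (1+x)‖^3 * ‖riemannZeta (1+x+Complex.I*y)‖^4 * ‖riemannZeta (1+x+2*Complex.I*y)‖ := by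
  have := DirichletCharacter.norm_LFunction_product_ge_one (1 : DirichletCharacter ℂ 1) hx y
  simpa [DirichletCharacter.LFunctionTrivChar, DirichletCharacter.LFunction_modOne_eq] using this

lemma zeta_lower {δ : ℝ} (h0 : 0 < δ) (h1 : δ ≤ 1/4) :
    ∃ a b : ℝ, 0 < a ∧ a ≤ δ/4 ∧ 0 < b ∧ ∀ s : ℂ, 2 ≤ |s.im| → 1 - a/(|s.im|^δ)^5 ≤ s.re → s.re ≤ 2 →
      b/(|s.im|^δ)^4 ≤ ‖riemannZeta s‖ := by
  obtain ⟨C, hC, hz⟩ := zeta_bound h0 h1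
  obtain ⟨M, hM, hzd⟩ := zeta_deriv_bound h0 h1
  obtain ⟨D, hD, hzr⟩ := zeta_real_bound
  set c := 1/(2*C*D^3) with hc
  have hcp : 0 < c := by positivity
  set a := min (δ/4) (c/(256*M^4)) with ha
  have hap : 0 < a := by positivity
  have haδ : a ≤ δ/4 := min_le_left _ _
  have hac : 256*M^4*a ≤ c := by
    have : a ≤ c/(256*M^4) := min_le_right _ _
    rw [le_div_iff₀ (by positivity)] at this; linarith
  refine ⟨a, 2*a*M, hap, haδ, by positivity, ?_⟩
  intro s ht hσ hσ2
  set T := |s.im|^δ with hT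
  have hT1 : 1 ≤ T := Real.one_le_rpow (by linarith) h0.le
  have hTp : 0 < T := by linarith
  set x0 := a/T^5 with hx0
  have hx0p : 0 < x0 := by positivity
  have hx0a : x0 ≤ a := div_le_self hap.le (one_le_pow₀ hT1)
  have key : ∀ x : ℝ, x0 ≤ x → x ≤ 1 → 4*a*M/T^4 ≤ ‖riemannZeta (1+x+Complex.I*s.im)‖ := by
    intro x hx hx1
    have hxp : 0 < x := by linarith
    set A := ‖riemannZeta (1+x+Complex.I*s.im)‖ with hA
    have e1 := zeta_341 hxp s.im
    have e2 := hzr x hxp hx1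
    have e3 : ‖riemannZeta (1+x+2*Complex.I*s.im)‖ ≤ C * (2*T) := by
      have him : (1+x+2*Complex.I*s.im : ℂ).im = 2*s.im := by simp
      have hre : (1+x+2*Complex.I*s.im : ℂ).re = 1 + x := by simp
      refine (hz _ (by rw [him, abs_mul]; norm_num; linarith) (by rw [hre]; linarith) (by rw [hre]; linarith)).trans ?_
      rw [him, abs_mul]
      gcongr
      rw [Real.mul_rpow (by positivity) (by positivity)]
      gcongr
      calc |(2:ℝ)|^δ ≤ |(2:ℝ)|^(1:ℝ) := by
            apply Real.rpow_le_rpow_of_exponent_le; norm_num; linarith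
        _ = 2 := by simp
    have e4 : 1 ≤ (D/x)^3 * A^4 * (C*(2*T)) := by
      refine e1.trans ?_
      gcongr
    have e5 : c * x^3/T ≤ A^4 := by
      rw [hc]
      rw [div_pow] at e4
      rw [div_mul_eq_mul_div, div_div, div_le_iff₀ (by positivity)]
      have : D^3/x^3*A^4*(C*(2*T)) * x^3 = A^4*(2*C*D^3*T) := by field_simp
      have h6 : 1 * x^3 ≤ D^3/x^3*A^4*(C*(2*T)) * x^3 := by gcongr
      linarith
    have e6 : (4*a*M/T^4)^4 ≤ A^4 := by
      refine le_trans ?_ e5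
      calc (4*a*M/T^4)^4 = (256*M^4*a) * a^3 / T^16 := by field_simp; norm_num
        _ ≤ c * a^3/T^16 := by gcongr
        _ = c * x0^3/T := by rw [hx0]; field_simp
        _ ≤ _ := by gcongr
    exact le_of_pow_le_pow_left₀ (by norm_num) (norm_nonneg _) e6
  by_cases hcase : 1 + x0 ≤ s.re
  · have := key (s.re - 1) (by linarith) (by linarith)
    have e : (1 + ((s.re - 1 : ℝ):ℂ) + Complex.I*s.im) = s := by
      apply Complex.ext <;> simp
    rw [e] at this
    refine le_trans ?_ this
    gcongr
    norm_num
  · have k0 := key x0 le_rfl (by linarith)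
    set s0 : ℂ := 1 + x0 + Complex.I*s.im with hs0
    have s0re : s0.re = 1 + x0 := by simp [hs0]
    have s0im : s0.im = s.im := by simp [hs0]
    have hconv : Convex ℝ {w : ℂ | w.im = s.im ∧ 1 - δ/2 ≤ w.re ∧ w.re ≤ 4} := by
      intro u hu v hv p q hp hq hpq
      simp only [Set.mem_ofPred_eq] at hu hv ⊢
      obtain ⟨u1,u2,u3⟩ := hu
      obtain ⟨v1,v2,v3⟩ := hv
      simp [u1, v1]
      have hp' : p = 1 - q := by linarith
      subst hp'
      refine ⟨by ring, by nlinarith, by nlinarith⟩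
    have hmv := hconv.norm_image_sub_le_of_norm_deriv_le (f := riemannZeta) (C := M*T) (x := s0) (y := s)
      (by
        rintro w ⟨w1, w2, w3⟩
        apply differentiableAt_riemannZeta
        rintro rfl
        simp at w1
        rw [← w1] at ht; norm_num at ht)
      (by
        rintro w ⟨w1, w2, w3⟩
        have := hzd w (by rw [w1]; exact ht) w2 w3
        rwa [w1] at this)
      ⟨s0im, by rw [s0re]; linarith, by rw [s0re]; linarith⟩
      ⟨rfl, by linarith, by linarith⟩
    have hss : ‖s - s0‖ ≤ 2*x0 := by
      have e : s - s0 = ((s.re - (1+x0) : ℝ) : ℂ) := by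
        apply Complex.ext <;> simp [hs0]
      rw [e, Complex.norm_real, Real.norm_eq_abs, abs_le]
      constructor <;> linarith
    have h3 : ‖riemannZeta s0‖ - ‖riemannZeta s‖ ≤ M*T*(2*x0) := by
      refine (norm_sub_norm_le _ _).trans ?_
      rw [norm_sub_rev]
      refine hmv.trans ?_
      gcongr
    have h4 : M*T*(2*x0) = 2*a*M/T^4 := by rw [hx0]; field_simp
    have h5 : 4*a*M/T^4 = 2*a*M/T^4 + 2*a*M/T^4 := by ring
    linarith

noncomputable def lam (n : ℕ) : ℝ := (ArithmeticFunction.liouville n : ℝ)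

lemma lam_mul (m n : ℕ) : lam (m*n) = lam m * lam n := by
  simp [lam, ArithmeticFunction.liouville_apply_mul]
lemma lam_one : lam 1 = 1 := by simp [lam, ArithmeticFunction.liouville_apply_one]
lemma lam_zero : lam 0 = 0 := by simp [lam]
lemma lam_abs {n : ℕ} (h : n ≠ 0) : |lam n| = 1 := by
  simp [lam, ArithmeticFunction.liouville_apply h]
lemma lam_abs_le (n : ℕ) : |lam n| ≤ 1 := by
  rcases eq_or_ne n 0 with rfl | h
  · simp [lam_zero]
  · rw [lam_abs h]
lemma lam_prime {p : ℕ} (hp : p.Prime) : lam p = -1 := by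
  simp [lam, ArithmeticFunction.liouville_apply hp.ne_zero, ArithmeticFunction.cardFactors_apply_prime hp]

noncomputable def lamHom (s : ℂ) (hs : s ≠ 0) : ℕ →*₀ ℂ where
  toFun n := (lam n : ℂ) * (n:ℂ)^(-s)
  map_zero' := by simp [lam_zero]
  map_one' := by simp [lam_one]
  map_mul' m n := by
    rw [lam_mul, Nat.cast_mul, Complex.natCast_mul_natCast_cpow]
    push_cast; ring

lemma lam_LSeries_term (s : ℂ) (n : ℕ) :
    LSeries.term (fun n => (lam n : ℂ)) s n = (lam n : ℂ) * (n:ℂ)^(-s) := by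
  rcases eq_or_ne n 0 with rfl | h
  · simp [lam_zero]
  · rw [LSeries.term_of_ne_zero h, Complex.cpow_neg, div_eq_mul_inv]

lemma lam_LSeries_summable {s : ℂ} (hs : 1 < s.re) : LSeriesSummable (fun n => (lam n : ℂ)) s := by
  apply LSeriesSummable_of_bounded_of_one_lt_re (m := 1) _ hs
  intro n _
  simpa using lam_abs_le n

lemma lam_LSeries {s : ℂ} (hs : 1 < s.re) :
    LSeries (fun n => (lam n : ℂ)) s * riemannZeta s = riemannZeta (2*s) := by
  have hs0 : s ≠ 0 := by rintro rfl; norm_num at hs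
  have h1 := riemannZeta_eulerProduct_hasProd hs
  have h2 := riemannZeta_eulerProduct_hasProd (s := 2*s) (by simp; linarith)
  have hsum := lam_LSeries_summable hs
  have h3 := EulerProduct.eulerProduct_completely_multiplicative_hasProd (f := lamHom s hs0) (by
    have := hsum.norm
    refine this.congr (fun n => ?_)
    rw [lam_LSeries_term]; rfl)
  have e3 : ∑' n, lamHom s hs0 n = LSeries (fun n => (lam n : ℂ)) s := by
    unfold LSeries
    exact tsum_congr (fun n => (lam_LSeries_term s n).symm)
  rw [e3] at h3
  have h4 := h3.mul h1
  refine h4.unique ?_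
  convert h2 using 2 with p
  have : lamHom s hs0 p = - (p:ℂ)^(-s) := by
    change (lam p : ℂ) * (p:ℂ)^(-s) = _
    rw [lam_prime p.2]; simp
  rw [this, ← mul_inv]
  congr 1
  have : ((p:ℕ):ℂ)^(-(2*s)) = ((p:ℕ):ℂ)^(-s) * ((p:ℕ):ℂ)^(-s) := by
    rw [← Complex.cpow_add _ _ (by exact_mod_cast p.2.ne_zero)]; congr 1; ring
  rw [this]; ring

end

section

noncomputable def Gl (s : ℂ) : ℂ := riemannZeta (2*s) * (s-1) / riemannZeta₁ s

lemma zeta1_eq {s : ℂ} (h : s ≠ 1) : riemannZeta₁ s = (s-1) * riemannZeta s := by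
  rw [riemannZeta_eq_inv_sub_mul h, mul_inv_cancel_left₀ (sub_ne_zero.mpr h)]

lemma zeta1_ne {s : ℂ} (h : 1 ≤ s.re) : riemannZeta₁ s ≠ 0 := by
  rcases eq_or_ne s 1 with rfl | h1
  · simp [riemannZeta₁_one]
  · rw [zeta1_eq h1]
    exact mul_ne_zero (sub_ne_zero.mpr h1) (riemannZeta_ne_zero_of_one_le_re h)

lemma Gl_eq {s : ℂ} (h : s ≠ 1) : Gl s = riemannZeta (2*s) / riemannZeta s := by
  unfold Gl
  rw [zeta1_eq h, mul_comm (s-1), mul_div_mul_right _ _ (sub_ne_zero.mpr h)]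

lemma Gl_diff {s : ℂ} (h : 2*s ≠ 1) (h1 : riemannZeta₁ s ≠ 0) : DifferentiableAt ℂ Gl s := by
  unfold Gl
  apply DifferentiableAt.div _ differentiable_riemannZeta₁.differentiableAt h1
  apply DifferentiableAt.mul _ (differentiableAt_id.sub_const 1)
  exact (differentiableAt_riemannZeta h).comp s (differentiableAt_id.const_mul 2)

lemma Gl_LSeries {s : ℂ} (hs : 1 < s.re) : LSeries (fun n => (lam n : ℂ)) s = Gl s := by
  have h : s ≠ 1 := by rintro rfl; simp at hs
  rw [Gl_eq h, eq_div_iff (riemannZeta_ne_zero_of_one_le_re hs.le), lam_LSeries hs]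

lemma Gl_iter {s : ℂ} (hs : 1 < s.re) (k : ℕ) :
    iteratedDeriv k (LSeries (fun n => (lam n : ℂ))) s = iteratedDeriv k Gl s := by
  have : LSeries (fun n => (lam n : ℂ)) =ᶠ[nhds s] Gl := by
    have : ∀ᶠ z : ℂ in nhds s, 1 < z.re :=
      (isOpen_lt continuous_const Complex.continuous_re).mem_nhds hs
    filter_upwards [this] with z hz
    exact Gl_LSeries hz
  exact this.iteratedDeriv_eq k

lemma Gl_small (k : ℕ) : ∃ C : ℝ, 0 < C ∧ ∀ s : ℂ, 1 ≤ s.re → s.re ≤ 3/2 → |s.im| ≤ 4 →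
    ‖iteratedDeriv k Gl s‖ ≤ C := by
  set U : Set ℂ := {s | 2*s ≠ 1} ∩ {s | riemannZeta₁ s ≠ 0} with hU
  have hUo : IsOpen U := by
    apply IsOpen.inter
    · exact isOpen_ne_fun (by fun_prop) continuous_const
    · exact isOpen_ne_fun differentiable_riemannZeta₁.continuous continuous_const
  have han : AnalyticOnNhd ℂ Gl U := by
    apply DifferentiableOn.analyticOnNhd _ hUo
    intro z hz
    exact (Gl_diff hz.1 hz.2).differentiableWithinAt
  have hK : IsCompact (Set.Icc (1:ℝ) (3/2) ×ℂ Set.Icc (-4:ℝ) 4) := isCompact_Icc.reProdIm isCompact_Icc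
  have hc : ContinuousOn (iteratedDeriv k Gl) (Set.Icc (1:ℝ) (3/2) ×ℂ Set.Icc (-4:ℝ) 4) := by
    have := (han.iterated_deriv k).continuousOn
    rw [iteratedDeriv_eq_iterate]
    apply this.mono
    intro z hz
    rw [Complex.mem_reProdIm] at hz
    refine ⟨?_, zeta1_ne hz.1.1⟩
    intro h
    have := congrArg Complex.re h
    simp at this
    linarith [hz.1.1]
  obtain ⟨C, hC⟩ := hK.exists_bound_of_continuousOn hc
  refine ⟨max C 1, by positivity, ?_⟩
  intro s h1 h2 h3
  refine (hC s ?_).trans (le_max_left _ _)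
  rw [Complex.mem_reProdIm]
  exact ⟨⟨h1, h2⟩, abs_le.mp h3⟩

lemma rpow_two_le {δ t u : ℝ} (h0 : 0 < δ) (h1 : δ ≤ 1) (ht : 0 ≤ t) (hu : 0 ≤ u) (h : u ≤ 2*t) :
    u^δ ≤ 2 * t^δ := by
  calc u^δ ≤ (2*t)^δ := Real.rpow_le_rpow hu h h0.le
    _ = 2^δ * t^δ := Real.mul_rpow (by norm_num) ht
    _ ≤ 2^(1:ℝ) * t^δ := by
      gcongr; norm_num
    _ = _ := by simp

lemma Gl_large (k : ℕ) : ∃ C : ℝ, 0 < C ∧ ∀ s : ℂ, 1 ≤ s.re → s.re ≤ 3/2 → 4 ≤ |s.im| →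
    ‖iteratedDeriv k Gl s‖ ≤ C * |s.im|^(1/2:ℝ) := by
  set δ : ℝ := 1/(10*(k+1)) with hδ
  have h0 : 0 < δ := by positivity
  have h1 : δ ≤ 1/4 := by
    rw [hδ]
    apply one_div_le_one_div_of_le (by norm_num)
    linarith [Nat.cast_nonneg (α := ℝ) k]
  obtain ⟨C, hC, hz⟩ := zeta_bound h0 h1
  obtain ⟨a, b, ha, haδ, hb, hl⟩ := zeta_lower h0 h1
  refine ⟨k.factorial * (64*C/b) * (64/a)^k, by positivity, ?_⟩
  intro s hs1 hs2 ht
  set T := |s.im|^δ with hT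
  have hT1 : 1 ≤ T := Real.one_le_rpow (by linarith) h0.le
  have hTp : 0 < T := by linarith
  set r := a/(64*T^5) with hr
  have hrp : 0 < r := by positivity
  have hra : r ≤ a := div_le_self ha.le (by nlinarith [one_le_pow₀ hT1 (n := 5)])
  have hw : ∀ w : ℂ, ‖w - s‖ ≤ r → w ≠ 1 ∧ 2*w ≠ 1 ∧ riemannZeta w ≠ 0 ∧ ‖Gl w‖ ≤ 64*C/b*T^5 := by
    intro w hw
    have e1 := (Complex.abs_im_le_norm (w - s)).trans hw
    have e2 := (Complex.abs_re_le_norm (w - s)).trans hw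
    simp only [Complex.sub_im, Complex.sub_re] at e1 e2
    have w1 : 3 ≤ |w.im| := by
      have := abs_sub_abs_le_abs_sub s.im w.im
      rw [abs_sub_comm] at this; linarith
    have w2 : |w.im| ≤ 2*|s.im| := by
      have := abs_sub_abs_le_abs_sub w.im s.im
      linarith
    have hTw := rpow_two_le h0 (by linarith) (abs_nonneg s.im) (abs_nonneg w.im) w2
    rw [← hT] at hTw
    have hTw2 := rpow_two_le (u := |(2*w).im|) h0 (by linarith) (abs_nonneg w.im) (abs_nonneg _) (by simp [abs_mul])
    set Tw := |w.im|^δ with hTwd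
    have hTwp : 0 < Tw := Real.rpow_pos_of_pos (by linarith) _
    have hTw5 : r ≤ a/Tw^5 := by
      rw [hr]
      apply div_le_div_of_nonneg_left ha.le (by positivity)
      calc Tw^5 ≤ (2*T)^5 := by gcongr
        _ ≤ 64*T^5 := by nlinarith [pow_pos hTp 5]
    rw [abs_le] at e2
    have hlw := hl w (by linarith) (by linarith) (by linarith)
    have hlw' : b/(16*T^4) ≤ ‖riemannZeta w‖ := by
      refine le_trans ?_ hlw
      apply div_le_div_of_nonneg_left hb.le (by positivity)
      calc Tw^4 ≤ (2*T)^4 := by gcongr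
        _ = _ := by ring
    have hne : w ≠ 1 := by rintro rfl; norm_num at w1
    have hne2 : 2*w ≠ 1 := by
      intro h
      have := congrArg Complex.im h
      simp at this
      rw [this] at w1; norm_num at w1
    have hz0 : 0 < ‖riemannZeta w‖ := lt_of_lt_of_le (by positivity) hlw'
    refine ⟨hne, hne2, norm_pos_iff.mp hz0, ?_⟩
    rw [Gl_eq hne, norm_div]
    have h2w := hz (2*w) (by simp [abs_mul]; linarith) (by simp; linarith) (by simp; linarith)
    have h2w' : ‖riemannZeta (2*w)‖ ≤ C*(4*T) := by
      refine h2w.trans ?_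
      gcongr
      linarith
    calc _ ≤ (C*(4*T))/(b/(16*T^4)) := by gcongr
      _ = _ := by field_simp; norm_num
  have hd : DiffContOnCl ℂ Gl (Metric.ball s r) := by
    apply DifferentiableOn.diffContOnCl
    rw [closure_ball _ hrp.ne']
    intro w hw'
    rw [mem_closedBall_iff_norm] at hw'
    obtain ⟨q1, q2, q3, q4⟩ := hw w hw'
    apply DifferentiableAt.differentiableWithinAt
    apply Gl_diff q2
    rw [zeta1_eq q1]
    exact mul_ne_zero (sub_ne_zero.mpr q1) q3
  have := Complex.norm_iteratedDeriv_le_of_forall_mem_sphere_norm_le k hrp hd (C := 64*C/b*T^5) (by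
    intro w hw'
    rw [mem_sphere_iff_norm] at hw'
    exact (hw w hw'.le).2.2.2)
  refine this.trans (le_of_eq ?_)
  have hTT : |s.im|^(1/2:ℝ) = T^5 * (T^5)^k := by
    rw [← pow_mul, ← pow_add, hT, ← Real.rpow_natCast, ← Real.rpow_mul (by positivity)]
    congr 1
    rw [hδ]; push_cast; field_simp; ring
  rw [hTT, hr, div_pow, div_pow, mul_pow]
  field_simp

lemma G_bound (k : ℕ) : ∃ C : ℝ, 0 < C ∧ ∀ s : ℂ, 1 < s.re → s.re ≤ 3/2 →
    ‖LSeries (LSeries.logMul^[k] (fun n => (lam n : ℂ))) s‖ ≤ C * (1+|s.im|)^(1/2:ℝ) := by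
  obtain ⟨C1, hC1, h1⟩ := Gl_small k
  obtain ⟨C2, hC2, h2⟩ := Gl_large k
  refine ⟨C1 + C2, by positivity, ?_⟩
  intro s hs1 hs2
  have habs : LSeries.abscissaOfAbsConv (fun n => (lam n : ℂ)) < s.re := by
    refine lt_of_le_of_lt (LSeries.abscissaOfAbsConv_le_of_forall_lt_LSeriesSummable (x := 1) ?_) (by exact_mod_cast hs1)
    intro y hy
    exact lam_LSeries_summable (by simpa using hy)
  have e := LSeries_iteratedDeriv k habs
  have en : ‖LSeries (LSeries.logMul^[k] (fun n => (lam n : ℂ))) s‖ = ‖iteratedDeriv k Gl s‖ := by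
    rw [← Gl_iter hs1, e]; simp
  rw [en]
  have hp : 1 ≤ (1+|s.im|)^(1/2:ℝ) := Real.one_le_rpow (by linarith [abs_nonneg s.im]) (by norm_num)
  rcases le_total |s.im| 4 with h | h
  · refine (h1 s hs1.le hs2 h).trans ?_
    nlinarith
  · refine (h2 s hs1.le hs2 h).trans ?_
    have : |s.im|^(1/2:ℝ) ≤ (1+|s.im|)^(1/2:ℝ) := by gcongr; linarith
    nlinarith

end

section

open MeasureTheory

noncomputable def mw (t : ℝ) : ℂ :=
  (Set.Ioc (0:ℝ) 1).indicator (fun _ => (1:ℂ)) t - (Set.Ioc (0:ℝ) 1).indicator (fun t : ℝ => (t:ℂ)^(1:ℂ)) t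

lemma mw_of_mem {t : ℝ} (h : 0 < t) (h1 : t ≤ 1) : mw t = ((1 - t : ℝ) : ℂ) := by
  unfold mw
  have hm : t ∈ Set.Ioc (0:ℝ) 1 := ⟨h, h1⟩
  rw [Set.indicator_of_mem hm, Set.indicator_of_mem hm]; simp

lemma mw_of_one_le {t : ℝ} (h1 : 1 ≤ t) : mw t = 0 := by
  rcases h1.eq_or_lt with h | h
  · subst h; rw [mw_of_mem one_pos le_rfl]; simp
  · unfold mw
    rw [Set.indicator_of_notMem (fun hh => not_le.mpr h hh.2), Set.indicator_of_notMem (fun hh => not_le.mpr h hh.2)]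
    simp

lemma mw_zero : mw 0 = 0 := by simp [mw]

lemma mw_eq {t : ℝ} (h : 0 < t) : mw t = ((max (1-t) 0 : ℝ) : ℂ) := by
  rcases le_total t 1 with h1 | h1
  · rw [mw_of_mem h h1, max_eq_left (by linarith)]
  · rw [mw_of_one_le h1, max_eq_right (by linarith)]; simp

lemma mw_cont {t : ℝ} (h : 0 < t) : ContinuousAt mw t := by
  have : ContinuousAt (fun t : ℝ => ((max (1-t) 0 : ℝ) : ℂ)) t := by
    apply Continuous.continuousAt; fun_prop
  refine this.congr ?_
  filter_upwards [lt_mem_nhds h] with u hu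
  exact (mw_eq hu).symm

lemma mw_mellin {s : ℂ} (hs : 0 < s.re) : HasMellin mw s (1/(s*(s+1))) := by
  have h1 := hasMellin_one_Ioc hs
  have h2 := hasMellin_cpow_Ioc 1 (s := s) (by simp; linarith)
  have h3 := hasMellin_sub h1.1 h2.1
  rw [h1.2, h2.2] at h3
  have e : 1/s - 1/(s+1) = 1/(s*(s+1)) := by
    have a1 : s ≠ 0 := by rintro rfl; simp at hs
    have a2 : s + 1 ≠ 0 := by
      intro h; have := congrArg Complex.re h; simp at this; linarith
    field_simp; ring
  rw [e] at h3
  exact h3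

lemma ker_bound {σ : ℝ} (hσ : 1 ≤ σ) (y : ℝ) :
    ‖1/(((σ:ℂ) + y*Complex.I)*((σ:ℂ) + y*Complex.I+1))‖ ≤ 2*(1+|y|)^(-2:ℝ) := by
  have b1 : 1 + y^2 ≤ ‖(σ:ℂ) + y*Complex.I‖^2 := by
    rw [← Complex.normSq_eq_norm_sq, Complex.normSq_apply]; simp; nlinarith
  have b2 : 1 + y^2 ≤ ‖(σ:ℂ) + y*Complex.I+1‖^2 := by
    rw [← Complex.normSq_eq_norm_sq, Complex.normSq_apply]; simp; nlinarith
  have b3 : (1+|y|)^2 ≤ 2*(1+y^2) := by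
    rw [← sq_abs y]; nlinarith [sq_nonneg (1-|y|)]
  rw [norm_div, norm_one, norm_mul, Real.rpow_neg (by positivity), ← one_div, mul_one_div]
  have e : (1+|y|)^(2:ℝ) = (1+|y|)^2 := by norm_cast
  try rw [e]
  have h0 : 0 < 1 + |y| := by positivity
  have h4 : 1 + y^2 ≤ ‖(σ:ℂ) + y*Complex.I‖*‖(σ:ℂ) + y*Complex.I+1‖ := by
    apply abs_le_of_sq_le_sq' _ (by positivity) |>.2
    rw [mul_pow]
    have : (0:ℝ) ≤ 1+y^2 := by positivity
    nlinarith
  rw [div_le_div_iff₀ (lt_of_lt_of_le (by positivity) h4) (by positivity)]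
  nlinarith

lemma ker_cont {σ : ℝ} (hσ : 1 ≤ σ) :
    Continuous (fun y : ℝ => 1/(((σ:ℂ) + y*Complex.I)*((σ:ℂ) + y*Complex.I+1))) := by
  apply Continuous.div continuous_const (by fun_prop)
  intro y
  apply mul_ne_zero
  · intro h; have := congrArg Complex.re h; simp at this; linarith
  · intro h; have := congrArg Complex.re h; simp at this; linarith

lemma ker_int {σ : ℝ} (hσ : 1 ≤ σ) :
    Integrable (fun y : ℝ => 1/(((σ:ℂ) + y*Complex.I)*((σ:ℂ) + y*Complex.I+1))) := by
  have h : Integrable (fun y : ℝ => 2*(1+|y|)^(-2:ℝ)) :=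
    (integrable_one_add_norm (E := ℝ) (μ := volume) (by simp)).const_mul 2
  refine h.mono' (ker_cont hσ).aestronglyMeasurable (Eventually.of_forall (fun y => ker_bound hσ y))

lemma perron (f : ℕ → ℂ) {σ : ℝ} (hσ : 1 ≤ σ) (hf : LSeriesSummable f σ) {C : ℝ} (hC : 0 ≤ C)
    (hb : ∀ y : ℝ, ‖LSeries f ((σ:ℂ) + y*Complex.I)‖ ≤ C*(1+|y|)^(1/2:ℝ)) {x : ℝ} (hx : 0 < x) :
    ‖∑' n : ℕ, f n * mw (n/x)‖ ≤ C * x^σ * (1/Real.pi * ∫ y : ℝ, (1+|y|)^(-(3/2):ℝ)) := by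
  set k : ℝ → ℂ := fun y : ℝ => 1/(((σ:ℂ) + y*Complex.I)*((σ:ℂ) + y*Complex.I+1)) with hk
  set F : ℕ → ℝ → ℂ := fun n y => LSeries.term f ((σ:ℂ) + y*Complex.I) n * ((x:ℂ)^((σ:ℂ) + y*Complex.I) * k y) with hF
  have hnx : ∀ y : ℝ, ‖(x:ℂ)^((σ:ℂ) + y*Complex.I)‖ = x^σ := by
    intro y; rw [Complex.norm_cpow_eq_rpow_re_of_pos hx]; simp
  have hnt : ∀ (n : ℕ) (y : ℝ), ‖LSeries.term f ((σ:ℂ) + y*Complex.I) n‖ = ‖LSeries.term f σ n‖ := by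
    intro n y; rw [LSeries.norm_term_eq, LSeries.norm_term_eq]; simp
  have hxc : Continuous (fun y : ℝ => (x:ℂ)^((σ:ℂ) + y*Complex.I)) := by
    apply Continuous.const_cpow (by fun_prop) (Or.inl (by exact_mod_cast hx.ne'))
  have htc : ∀ n : ℕ, Continuous (fun y : ℝ => LSeries.term f ((σ:ℂ) + y*Complex.I) n) := by
    intro n
    rcases eq_or_ne n 0 with rfl | hn
    · simp [continuous_const]
    · have h0 : (n:ℂ) ≠ 0 := by exact_mod_cast hn
      simp only [LSeries.term_of_ne_zero hn]
      apply Continuous.div continuous_const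
      · exact Continuous.const_cpow (by fun_prop) (Or.inl h0)
      · intro y; simp [Complex.cpow_eq_zero_iff, h0]
  have hFn : ∀ n y, ‖F n y‖ = ‖LSeries.term f σ n‖ * x^σ * ‖k y‖ := by
    intro n y; rw [hF]; simp only [norm_mul, hnx, hnt]; ring
  have hkint : Integrable k := ker_int hσ
  have hFi : ∀ n, Integrable (F n) := by
    intro n
    refine (hkint.norm.const_mul (‖LSeries.term f σ n‖ * x^σ)).mono' ?_ (Eventually.of_forall (fun y => (hFn n y).le))
    exact ((htc n).mul (hxc.mul (ker_cont hσ))).aestronglyMeasurable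
  have hsum : Summable (fun n => ∫ y, ‖F n y‖) := by
    simp_rw [hFn, integral_const_mul]
    exact ((hf.norm.mul_right _).mul_right _)
  have hS := hasSum_integral_of_summable_integral_norm hFi hsum
  have hterm : ∀ n : ℕ, f n * mw (n/x) = (1/(2*Real.pi) : ℝ) • ∫ y, F n y := by
    intro n
    rcases eq_or_ne n 0 with rfl | hn
    · simp [mw_zero, hF]
    · have hn0 : (0:ℝ) < n := by positivity
      have hnx0 : 0 < (n:ℝ)/x := by positivity
      have hm : ∀ y : ℝ, mellin mw ((σ:ℂ) + y*Complex.I) = k y := by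
        intro y; exact (mw_mellin (by simp; linarith)).2
      have := mellinInv_mellin_eq σ mw hnx0 (mw_mellin (by simp; linarith)).1 (by
        unfold Complex.VerticalIntegrable
        simp_rw [hm]; exact hkint) (mw_cont hnx0)
      rw [← this]
      unfold mellinInv
      simp_rw [hm]
      rw [mul_smul_comm, ← integral_const_mul]
      congr 1
      apply integral_congr_ae
      apply Eventually.of_forall
      intro y
      simp only [hF, LSeries.term_of_ne_zero hn, smul_eq_mul]
      have h0 : (n:ℂ) ≠ 0 := by exact_mod_cast hn
      have e : (((n:ℝ)/x : ℝ):ℂ)^(-((σ:ℂ) + y*Complex.I)) = (x:ℂ)^((σ:ℂ) + y*Complex.I) / (n:ℂ)^((σ:ℂ) + y*Complex.I) := by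
        rw [Complex.cpow_neg]
        have : (n:ℂ)^((σ:ℂ) + y*Complex.I) = (((n:ℝ)/x : ℝ):ℂ)^((σ:ℂ) + y*Complex.I) * (x:ℂ)^((σ:ℂ) + y*Complex.I) := by
          rw [← Complex.mul_cpow_ofReal_nonneg hnx0.le hx.le, ← Complex.ofReal_mul, div_mul_cancel₀ _ hx.ne']
          simp
        rw [this]
        have q : (x:ℂ)^((σ:ℂ) + y*Complex.I) ≠ 0 := by
          simp [Complex.cpow_eq_zero_iff, hx.ne']
        field_simp
      rw [e]; ring
  simp_rw [hterm]
  rw [tsum_const_smul'', hS.tsum_eq, norm_smul]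
  have hint : Integrable (fun y : ℝ => (1+|y|)^(-(3/2):ℝ)) :=
    (integrable_one_add_norm (E := ℝ) (μ := volume) (by simp; norm_num))
  have hbd : ‖∫ y, ∑' n, F n y‖ ≤ ∫ y : ℝ, (C*x^σ*2) * (1+|y|)^(-(3/2):ℝ) := by
    apply norm_integral_le_of_norm_le (hint.const_mul _)
    apply Eventually.of_forall
    intro y
    have e : ∑' n, F n y = LSeries f ((σ:ℂ) + y*Complex.I) * ((x:ℂ)^((σ:ℂ) + y*Complex.I) * k y) := by
      simp only [hF]; rw [tsum_mul_right]; rfl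
    rw [e, norm_mul, norm_mul, hnx]
    have hk2 : ‖k y‖ ≤ 2*(1+|y|)^(-2:ℝ) := ker_bound hσ y
    have e3 : (1+|y|)^(-(3/2):ℝ) = (1+|y|)^(1/2:ℝ) * (1+|y|)^(-2:ℝ) := by
      rw [← Real.rpow_add (by positivity)]; norm_num
    calc _ ≤ (C*(1+|y|)^(1/2:ℝ)) * (x^σ * (2*(1+|y|)^(-2:ℝ))) := by
          gcongr
          exact hb y
      _ = _ := by rw [e3]; ring
  rw [integral_const_mul] at hbd
  have hpi := Real.pi_pos
  calc _ ≤ ‖(1/(2*Real.pi) : ℝ)‖ * ((C*x^σ*2) * ∫ y : ℝ, (1+|y|)^(-(3/2):ℝ)) := by gcongr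
    _ = _ := by rw [Real.norm_eq_abs, abs_of_pos (by positivity)]; field_simp

lemma logMul_iter (k n : ℕ) : LSeries.logMul^[k] (fun n => (lam n : ℂ)) n = ((Real.log n^k * lam n : ℝ) : ℂ) := by
  induction k with
  | zero => simp
  | succ k ih =>
    rw [Function.iterate_succ_apply']
    unfold LSeries.logMul
    rw [ih, pow_succ, ← Complex.natCast_log]
    push_cast; ring

lemma smooth_bound (k : ℕ) : ∃ C : ℝ, 0 < C ∧ ∀ N : ℕ, 1 ≤ N →
    |∑ n ∈ Icc 1 N, Real.log n^k * lam n * (N - n : ℝ)| ≤ C * (N:ℝ)^2 := by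
  obtain ⟨C, hC, hG⟩ := G_bound k
  set I := (1/Real.pi * ∫ y : ℝ, (1+|y|)^(-(3/2):ℝ)) with hI
  have hI0 : 0 ≤ I := by
    have : 0 ≤ ∫ y : ℝ, (1+|y|)^(-(3/2):ℝ) := integral_nonneg (fun y => by positivity)
    have := Real.pi_pos
    positivity
  refine ⟨C*I+1, by positivity, ?_⟩
  intro N hN
  have hN0 : (0:ℝ) < N := by exact_mod_cast hN
  have habs : LSeries.abscissaOfAbsConv (LSeries.logMul^[k] (fun n => (lam n : ℂ))) ≤ 1 := by
    rw [LSeries.absicssaOfAbsConv_logPowMul]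
    apply LSeries.abscissaOfAbsConv_le_of_forall_lt_LSeriesSummable (x := 1)
    intro y hy
    exact lam_LSeries_summable (by simpa using hy)
  have hbd : ∀ σ : ℝ, 1 < σ → σ ≤ 3/2 →
     |∑ n ∈ Icc 1 N, Real.log n^k * lam n * (1 - n/N : ℝ)| ≤ C * (N:ℝ)^σ * I := by
    intro σ h1 h2
    have hp := perron (LSeries.logMul^[k] (fun n => (lam n : ℂ))) h1.le
      (LSeriesSummable_of_abscissaOfAbsConv_lt_re (lt_of_le_of_lt habs (by simpa using (EReal.coe_lt_coe_iff.mpr h1)))) hC.le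
      (by
        intro y
        have := hG ((σ:ℂ) + y*Complex.I) (by simpa using h1) (by simpa using h2)
        simpa using this) hN0
    have e : ∑' n : ℕ, (LSeries.logMul^[k] (fun n => (lam n : ℂ))) n * mw (n/N) =
       ((∑ n ∈ Icc 1 N, Real.log n^k * lam n * (1 - n/N : ℝ) : ℝ) : ℂ) := by
      rw [tsum_eq_sum (s := Icc 1 N)]
      · rw [Complex.ofReal_sum]
        apply Finset.sum_congr rfl
        intro n hn
        rw [Finset.mem_Icc] at hn
        have hn0 : (0:ℝ) < n := by exact_mod_cast hn.1
        rw [logMul_iter, mw_of_mem (by positivity) (by rw [div_le_one hN0]; exact_mod_cast hn.2), ← Complex.ofReal_mul]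
      · intro n hn
        rcases eq_or_ne n 0 with rfl | hn0
        · simp [mw_zero]
        · rw [mw_of_one_le, mul_zero]
          rw [one_le_div hN0]
          have : N < n := by
            by_contra h
            apply hn; rw [Finset.mem_Icc]; omega
          exact_mod_cast this.le
    rw [e, Complex.norm_real, Real.norm_eq_abs] at hp
    exact hp
  have hlim : |∑ n ∈ Icc 1 N, Real.log n^k * lam n * (1 - n/N : ℝ)| ≤ C * (N:ℝ)^(1:ℝ) * I := by
    have ht : Tendsto (fun σ : ℝ => C * (N:ℝ)^σ * I) (nhdsWithin 1 (Set.Ioi 1)) (nhds (C * (N:ℝ)^(1:ℝ) * I)) := by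
      apply Tendsto.mono_left _ nhdsWithin_le_nhds
      apply Continuous.tendsto
      have : Continuous (fun σ : ℝ => (N:ℝ)^σ) := Real.continuous_const_rpow hN0.ne'
      fun_prop
    apply ge_of_tendsto ht
    have : Set.Ioc (1:ℝ) (3/2) ∈ nhdsWithin (1:ℝ) (Set.Ioi 1) := Ioc_mem_nhdsGT (by norm_num)
    filter_upwards [this] with σ hσ
    exact hbd σ hσ.1 hσ.2
  have e : ∑ n ∈ Icc 1 N, Real.log n^k * lam n * (N - n : ℝ) = N * ∑ n ∈ Icc 1 N, Real.log n^k * lam n * (1 - n/N : ℝ) := by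
    rw [Finset.mul_sum]
    apply Finset.sum_congr rfl
    intro n _
    field_simp
  rw [e, abs_mul, abs_of_pos hN0]
  rw [Real.rpow_one] at hlim
  nlinarith [mul_le_mul_of_nonneg_left hlim hN0.le, sq_nonneg (N:ℝ)]

end

section

lemma abel_ineq (g w : ℕ → ℝ) (M : ℝ) (N0 N : ℕ) (hN : N0 + 1 ≤ N)
    (hA : ∀ n, N0 ≤ n → n ≤ N → |∑ m ∈ Icc 1 n, g m| ≤ M)
    (hw : ∀ n, N0 + 1 ≤ n → w (n+1) ≤ w n) (hw0 : ∀ n, N0 + 1 ≤ n → 0 ≤ w n) :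
    |∑ n ∈ Ioc N0 N, g n * w n| ≤ 2 * M * w (N0+1) := by
  have key : ∀ n, N0 + 1 ≤ n → n ≤ N →
     |∑ m ∈ Ioc N0 n, g m * w m - (∑ m ∈ Icc 1 n, g m) * w n + (∑ m ∈ Icc 1 N0, g m) * w (N0+1)|
      ≤ M * (w (N0+1) - w n) := by
    intro n hn
    induction n, hn using Nat.le_induction with
    | base =>
      intro h
      rw [Finset.sum_Icc_succ_top (by omega)]
      simp
      try ring_nf
    | succ n hn ih =>
      intro h
      have ih' := ih (by omega)
      rw [Finset.sum_Ioc_succ_top (by omega), Finset.sum_Icc_succ_top (by omega)]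
      have hAn := hA n (by omega) (by omega)
      have hwn := hw n hn
      have e : (∑ m ∈ Ioc N0 n, g m * w m + g (n+1) * w (n+1)) - (∑ m ∈ Icc 1 n, g m + g (n+1)) * w (n+1)
          + (∑ m ∈ Icc 1 N0, g m) * w (N0+1) =
          (∑ m ∈ Ioc N0 n, g m * w m - (∑ m ∈ Icc 1 n, g m) * w n + (∑ m ∈ Icc 1 N0, g m) * w (N0+1))
           + (∑ m ∈ Icc 1 n, g m) * (w n - w (n+1)) := by ring
      rw [e]
      refine (abs_add_le _ _).trans ?_
      have : |(∑ m ∈ Icc 1 n, g m) * (w n - w (n+1))| ≤ M * (w n - w (n+1)) := by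
        rw [abs_mul, abs_of_nonneg (sub_nonneg.mpr hwn)]
        exact mul_le_mul_of_nonneg_right hAn (sub_nonneg.mpr hwn)
      linarith
  have h1 := key N hN le_rfl
  have h2 := hA N (by omega) le_rfl
  have h3 := hA N0 le_rfl (by omega)
  have h4 := hw0 N hN
  have h5 := hw0 (N0+1) le_rfl
  set S := ∑ n ∈ Ioc N0 N, g n * w n
  set a := ∑ m ∈ Icc 1 N, g m
  set b := ∑ m ∈ Icc 1 N0, g m
  rw [abs_le] at *
  have h6 := mul_le_mul_of_nonneg_right h2.1 h4
  have h7 := mul_le_mul_of_nonneg_right h2.2 h4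
  have h8 := mul_le_mul_of_nonneg_right h3.1 h5
  have h9 := mul_le_mul_of_nonneg_right h3.2 h5
  constructor <;> nlinarith

noncomputable def el (x : ℝ) : ℝ := 1 + Real.log x

lemma el_one_le {x : ℝ} (h : 1 ≤ x) : 1 ≤ el x := by unfold el; linarith [Real.log_nonneg h]
lemma el_mono {x y : ℝ} (h0 : 0 < x) (h : x ≤ y) : el x ≤ el y := by
  unfold el; linarith [Real.log_le_log h0 h]

lemma el_pow_le {x : ℝ} (h : 1 ≤ x) (m : ℕ) : el x^m ≤ (m.factorial * Real.exp 1) * x := by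
  have h1 := Real.pow_div_factorial_le_exp (el x) (by linarith [el_one_le h]) m
  rw [div_le_iff₀ (by positivity)] at h1
  unfold el at *
  rw [Real.exp_add, Real.exp_log (by linarith)] at h1
  linarith

lemma el_pow_le_rpow {ε : ℝ} (hε : 0 < ε) (m : ℕ) :
    ∃ C : ℝ, 0 < C ∧ ∀ x : ℝ, 1 ≤ x → el x^m ≤ C * x^ε := by
  refine ⟨(1/ε)^m * (m.factorial * Real.exp ε), by positivity, ?_⟩
  intro x h
  have h1 := Real.pow_div_factorial_le_exp (ε * el x) (by have := el_one_le h; positivity) m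
  rw [div_le_iff₀ (by positivity)] at h1
  have e : Real.exp (ε * el x) = Real.exp ε * x^ε := by
    unfold el
    rw [mul_add, Real.exp_add, mul_one, Real.rpow_def_of_pos (by linarith), mul_comm ε (Real.log x)]
  rw [e, mul_pow] at h1
  calc el x^m = (1/ε)^m * (ε^m * el x^m) := by rw [← mul_assoc, ← mul_pow]; simp [hε.ne']
    _ ≤ (1/ε)^m * (Real.exp ε * x^ε * m.factorial) := by gcongr
    _ = _ := by ring

lemma log_pow_le_el {n N : ℕ} (h1 : 1 ≤ n) (h : n ≤ N) (k : ℕ) : Real.log n^k ≤ el N^k := by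
  have hn : (1:ℝ) ≤ n := by exact_mod_cast h1
  have : Real.log n ≤ Real.log N := Real.log_le_log (by linarith) (by exact_mod_cast h)
  have h0 := Real.log_nonneg hn
  unfold el
  exact pow_le_pow_left₀ h0 (by linarith) k

lemma lamlog_abs {n N : ℕ} (h1 : 1 ≤ n) (h : n ≤ N) (k : ℕ) : |Real.log n^k * lam n| ≤ el N^k := by
  have hn : (1:ℝ) ≤ n := by exact_mod_cast h1
  rw [abs_mul, lam_abs (by omega), mul_one, abs_of_nonneg (pow_nonneg (Real.log_nonneg hn) k)]
  exact log_pow_le_el h1 h k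

lemma step_bound (m : ℕ) : ∃ C : ℝ, 0 < C ∧ ∀ N : ℕ, 1 ≤ N →
    |∑ n ∈ Icc 1 N, Real.log n^(2*m) * lam n| ≤ C * N * el N^m := by
  obtain ⟨C, hC, hV⟩ := smooth_bound (2*m)
  set D := (m.factorial * Real.exp 1) with hD
  have hDp : 0 < D := by positivity
  refine ⟨5*C + 4^m*(1+D), by positivity, ?_⟩
  intro N hN
  have hN1 : (1:ℝ) ≤ N := by exact_mod_cast hN
  have hl1 := el_one_le hN1
  have hlm : 1 ≤ el N^m := one_le_pow₀ hl1
  set f : ℕ → ℝ := fun n => Real.log n^(2*m) * lam n with hf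
  set h := ⌈(N:ℝ)/el N^m⌉₊ with hh
  have hpos : (0:ℝ) < N/el N^m := by positivity
  have hh1 : (N:ℝ)/el N^m ≤ h := Nat.le_ceil _
  have hh2 : (h:ℝ) ≤ N/el N^m + 1 := (Nat.ceil_lt_add_one hpos.le).le
  have hhN : h ≤ N := by
    apply Nat.ceil_le.mpr
    exact div_le_self (by positivity) hlm
  have hhp : (0:ℝ) < h := lt_of_lt_of_le hpos hh1
  have hV1 := hV N hN
  have hV2 := hV (N+h) (by omega)
  have e : ∑ n ∈ Icc 1 (N+h), f n * ((N+h:ℕ) - n : ℝ) =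
     ∑ n ∈ Icc 1 N, f n * (N - n : ℝ) + h * ∑ n ∈ Icc 1 N, f n + ∑ n ∈ Ioc N (N+h), f n * ((N+h:ℕ) - n : ℝ) := by
    have hsplit : Icc 1 (N+h) = Icc 1 N ∪ Ioc N (N+h) := by
      ext n; simp only [Finset.mem_Icc, Finset.mem_union, Finset.mem_Ioc]; omega
    have hdis : Disjoint (Icc 1 N) (Ioc N (N+h)) := by
      rw [Finset.disjoint_left]; intro n; simp only [Finset.mem_Icc, Finset.mem_Ioc]; omega
    rw [hsplit, Finset.sum_union hdis, Finset.mul_sum, ← Finset.sum_add_distrib]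
    congr 1
    apply Finset.sum_congr rfl
    intro n _; push_cast; ring
  have hR : |∑ n ∈ Ioc N (N+h), f n * ((N+h:ℕ) - n : ℝ)| ≤ h * (el (N+h:ℕ)^(2*m) * h) := by
    refine (Finset.abs_sum_le_sum_abs _ _).trans ?_
    have : ∀ n ∈ Ioc N (N+h), |f n * ((N+h:ℕ) - n : ℝ)| ≤ el (N+h:ℕ)^(2*m) * h := by
      intro n hn
      rw [Finset.mem_Ioc] at hn
      rw [abs_mul]
      have hfn : |f n| ≤ el (N+h:ℕ)^(2*m) := lamlog_abs (by omega) hn.2 _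
      refine mul_le_mul hfn ?_ (abs_nonneg _) ((abs_nonneg _).trans hfn)
      · have a1 : (n:ℝ) ≤ ((N+h:ℕ):ℝ) := by exact_mod_cast hn.2
        have a2 : (N:ℝ) ≤ n := by exact_mod_cast hn.1.le
        rw [abs_of_nonneg (by linarith)]; push_cast; linarith
    refine (Finset.sum_le_card_nsmul _ _ _ this).trans ?_
    simp
  have hel : el (N+h:ℕ) ≤ 2 * el N := by
    have : el (N+h:ℕ) ≤ el (2*N) := el_mono (by positivity) (by
      have : (h:ℝ) ≤ N := by exact_mod_cast hhN
      push_cast; linarith)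
    refine this.trans ?_
    unfold el at *
    rw [Real.log_mul (by norm_num) (by linarith)]
    have := Real.log_two_lt_d9
    linarith
  have hel0 : 0 ≤ el (N+h:ℕ) := by
    have := el_one_le (x := (N+h:ℕ)) (by push_cast; linarith); linarith
  set F := ∑ n ∈ Icc 1 N, f n with hF
  have hNh : ((N+h:ℕ):ℝ) ≤ 2*N := by
    have : (h:ℝ) ≤ N := by exact_mod_cast hhN
    push_cast; linarith
  have hb : h * |F| ≤ 5*C*(N:ℝ)^2 + h * (el (N+h:ℕ)^(2*m) * h) := by
    have : h * |F| = |h * F| := by rw [abs_mul, abs_of_pos hhp]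
    rw [this]
    have e2 : h * F = ∑ n ∈ Icc 1 (N+h), f n * ((N+h:ℕ) - n : ℝ) - ∑ n ∈ Icc 1 N, f n * (N - n : ℝ)
      - ∑ n ∈ Ioc N (N+h), f n * ((N+h:ℕ) - n : ℝ) := by rw [e]; ring
    rw [e2]
    refine (abs_sub _ _).trans ?_
    have q := abs_sub (∑ n ∈ Icc 1 (N+h), f n * ((N+h:ℕ) - n : ℝ)) (∑ n ∈ Icc 1 N, f n * (N - n : ℝ))
    have q2 : C*((N+h:ℕ):ℝ)^2 ≤ C*(2*N)^2 := by gcongr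
    nlinarith
  have hb2 : |F| ≤ 5*C*(N:ℝ)^2/h + el (N+h:ℕ)^(2*m) * h := by
    rw [← mul_le_mul_iff_right₀ hhp]
    refine hb.trans (le_of_eq ?_)
    field_simp
  refine hb2.trans ?_
  have t1 : 5*C*(N:ℝ)^2/h ≤ 5*C*N*el N^m := by
    rw [div_le_iff₀ hhp]
    have : (N:ℝ) ≤ el N^m * h := by
      rw [div_le_iff₀ (by positivity)] at hh1; linarith
    calc 5*C*(N:ℝ)^2 = 5*C*N*N := by ring
      _ ≤ 5*C*N*(el N^m*h) := by gcongr
      _ = _ := by ring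
  have t2 : el (N+h:ℕ)^(2*m) * h ≤ 4^m*(1+D)*(N*el N^m) := by
    have s1 : el (N+h:ℕ)^(2*m) ≤ 4^m * (el N^m*el N^m) := by
      calc el (N+h:ℕ)^(2*m) ≤ (2*el N)^(2*m) := by gcongr
        _ = _ := by rw [mul_pow, pow_mul, two_mul, pow_add]; norm_num
    have s2 : el N^m * h ≤ (1+D)*N := by
      have := el_pow_le hN1 m
      calc el N^m * h ≤ el N^m*(N/el N^m+1) := by gcongr
        _ = N + el N^m := by field_simp
        _ ≤ _ := by rw [← hD] at this; linarith
    calc _ ≤ 4^m * (el N^m*el N^m) * h := by gcongr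
      _ = 4^m * el N^m * (el N^m * h) := by ring
      _ ≤ 4^m * el N^m * ((1+D)*N) := by gcongr
      _ = _ := by ring
  linarith

theorem thmA_nat (i B : ℕ) : ∃ C : ℝ, 0 < C ∧ ∀ N : ℕ, 1 ≤ N →
    |∑ n ∈ Icc 1 N, Real.log n^i * lam n| ≤ C * N / el N^B := by
  set m := i + B with hm
  obtain ⟨C, hC, hF⟩ := step_bound m
  obtain ⟨D, hD, hDb⟩ := el_pow_le_rpow (ε := 1/2) (by norm_num) (i+B)
  refine ⟨D + 2*C*4^(2*m-i) + 3^(i+B), by positivity, ?_⟩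
  intro N hN
  have hN1 : (1:ℝ) ≤ N := by exact_mod_cast hN
  have hl1 := el_one_le hN1
  rw [le_div_iff₀ (by positivity)]
  by_cases hN3 : N < 3
  · have htriv : |∑ n ∈ Icc 1 N, Real.log n^i * lam n| ≤ N * el N^i := by
      refine (Finset.abs_sum_le_sum_abs _ _).trans ?_
      refine (Finset.sum_le_card_nsmul _ _ (el N^i) ?_).trans ?_
      · intro n hn
        rw [Finset.mem_Icc] at hn
        exact lamlog_abs hn.1 hn.2 i
      · simp
    have hel : el N ≤ 3 := by
      unfold el
      have := Real.log_le_sub_one_of_pos (show (0:ℝ) < N by linarith)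
      have : (N:ℝ) ≤ 3 := by exact_mod_cast hN3.le
      linarith
    calc _ ≤ N * el N^i * el N^B := by gcongr
      _ = el N^(i+B) * N := by rw [pow_add]; ring
      _ ≤ 3^(i+B)*N := by gcongr
      _ ≤ _ := by gcongr; have : 0 < 2*C*4^(2*m-i) := by positivity
                  linarith
  · have hN3' : 3 ≤ N := by omega
    have hlog1 : 1 ≤ Real.log N := by
      rw [← Real.log_exp 1]
      apply Real.log_le_log (Real.exp_pos _)
      have : (3:ℝ) ≤ N := by exact_mod_cast hN3'
      linarith [Real.exp_one_lt_d9]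
    set N0 := Nat.sqrt N with hN0
    have hN0N : N0 + 1 ≤ N := by
      have : N0 < N := Nat.sqrt_lt_self (by omega)
      omega
    have hsplit : Icc 1 N = Icc 1 N0 ∪ Ioc N0 N := by
      ext n; simp only [Finset.mem_Icc, Finset.mem_union, Finset.mem_Ioc]; omega
    have hdis : Disjoint (Icc 1 N0) (Ioc N0 N) := by
      rw [Finset.disjoint_left]; intro n; simp only [Finset.mem_Icc, Finset.mem_Ioc]; omega
    have hlogn : ∀ n, N0 + 1 ≤ n → el N/4 ≤ Real.log n := by
      intro n hn
      have : N < n*n := by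
        have := Nat.lt_succ_sqrt N
        calc N < (N0+1)*(N0+1) := this
          _ ≤ n*n := Nat.mul_le_mul hn hn
      have h2 : Real.log N ≤ Real.log ((n:ℝ)*n) := by
        apply Real.log_le_log (by linarith); exact_mod_cast this.le
      have hn0 : (n:ℝ) ≠ 0 := by have : n ≠ 0 := by omega
                                 exact_mod_cast this
      rw [Real.log_mul hn0 hn0] at h2
      unfold el
      linarith
    have h1 : |∑ n ∈ Icc 1 N0, Real.log n^i * lam n| * el N^B ≤ D*N := by
      have htriv : |∑ n ∈ Icc 1 N0, Real.log n^i * lam n| ≤ N0 * el N^i := by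
        refine (Finset.abs_sum_le_sum_abs _ _).trans ?_
        refine (Finset.sum_le_card_nsmul _ _ (el N^i) ?_).trans ?_
        · intro n hn
          rw [Finset.mem_Icc] at hn
          exact lamlog_abs hn.1 (by omega) i
        · simp
      have hs : (N0:ℝ) ≤ (N:ℝ)^(1/2:ℝ) := by
        rw [← Real.sqrt_eq_rpow]; exact Real.nat_sqrt_le_real_sqrt
      calc _ ≤ N0 * el N^i * el N^B := by gcongr
        _ = N0 * el N^(i+B) := by rw [pow_add]; ring
        _ ≤ (N:ℝ)^(1/2:ℝ) * (D * (N:ℝ)^(1/2:ℝ)) := by gcongr; exact hDb N hN1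
        _ = D * ((N:ℝ)^(1/2:ℝ)*(N:ℝ)^(1/2:ℝ)) := by ring
        _ = _ := by rw [← Real.rpow_add (by linarith)]; norm_num
    have h2 : |∑ n ∈ Ioc N0 N, Real.log n^i * lam n| ≤ 2 * (C*N*el N^m) * (4/el N)^(2*m-i) := by
      have hab := abel_ineq (fun n => Real.log n^(2*m) * lam n) (fun n => 1/Real.log n^(2*m-i)) (C*N*el N^m) N0 N hN0N
        (by
          intro n hn hnN
          rcases Nat.eq_zero_or_pos n with rfl | hnp
          · simp; positivity
          · refine (hF n hnp).trans ?_
            have a1 : (1:ℝ) ≤ n := by exact_mod_cast hnp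
            have a2 : (n:ℝ) ≤ N := by exact_mod_cast hnN
            have a3 := el_one_le a1
            have a4 := el_mono (by linarith) a2
            gcongr)
        (by
          intro n hn
          have a1 := hlogn n hn
          have a2 : Real.log n ≤ Real.log (n+1:ℕ) := by
            apply Real.log_le_log
            · have : 0 < n := by omega
              exact_mod_cast this
            · push_cast; linarith
          have a3 : 0 < Real.log n := by linarith
          gcongr)
        (by
          intro n hn
          have a1 := hlogn n hn
          have a3 : 0 < Real.log n := by linarith
          positivity)
      have e : ∑ n ∈ Ioc N0 N, Real.log n^(2*m) * lam n * (1/Real.log n^(2*m-i)) = ∑ n ∈ Ioc N0 N, Real.log n^i * lam n := by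
        apply Finset.sum_congr rfl
        intro n hn
        rw [Finset.mem_Ioc] at hn
        have a1 := hlogn n (by omega)
        have a3 : 0 < Real.log n := by linarith
        have : Real.log n^(2*m) = Real.log n^i * Real.log n^(2*m-i) := by
          rw [← pow_add]; congr 1; omega
        rw [this]; field_simp
      rw [e] at hab
      refine hab.trans ?_
      have a1 := hlogn (N0+1) le_rfl
      have a3 : 0 < Real.log (N0+1:ℕ) := by linarith
      have : 1/Real.log (N0+1:ℕ)^(2*m-i) ≤ (4/el N)^(2*m-i) := by
        rw [← one_div_pow]
        apply pow_le_pow_left₀ (by positivity)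
        rw [div_le_div_iff₀ a3 (by linarith)]; linarith
      gcongr
    have h3 : |∑ n ∈ Ioc N0 N, Real.log n^i * lam n| * el N^B ≤ 2*C*4^(2*m-i)*N := by
      calc _ ≤ 2 * (C*N*el N^m) * (4/el N)^(2*m-i) * el N^B := by gcongr
        _ = _ := by
          rw [div_pow]
          have : el N^(2*m-i) = el N^m*el N^B := by rw [← pow_add]; congr 1; omega
          rw [this]; field_simp
    rw [hsplit, Finset.sum_union hdis]
    have q := abs_add_le (∑ n ∈ Icc 1 N0, Real.log n^i * lam n) (∑ n ∈ Ioc N0 N, Real.log n^i * lam n)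
    have q2 : (0:ℝ) ≤ 3^(i+B)*N := by positivity
    have q3 : 0 ≤ el N^B := by positivity
    nlinarith

theorem thmA (i B : ℕ) : ∃ C : ℝ, 0 < C ∧ ∀ x : ℝ, 1 ≤ x →
    |∑ n ∈ Icc 1 ⌊x⌋₊, Real.log n^i * lam n| ≤ C * x / el x^B := by
  obtain ⟨C, hC, h⟩ := thmA_nat i B
  refine ⟨C*2^B, by positivity, ?_⟩
  intro x hx
  have hN : 1 ≤ ⌊x⌋₊ := Nat.one_le_floor_iff _ |>.mpr hx
  have hN1 : (1:ℝ) ≤ ⌊x⌋₊ := by exact_mod_cast hN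
  have hfl : (⌊x⌋₊:ℝ) ≤ x := Nat.floor_le (by linarith)
  have hel : el x/2 ≤ el ⌊x⌋₊ := by
    rcases le_total (Real.log x) 1 with h1 | h1
    · have := el_one_le hN1
      have : el x ≤ 2 := by unfold el; linarith
      linarith
    · have h2 : x/2 ≤ ⌊x⌋₊ := by have := Nat.lt_floor_add_one x; linarith
      have h3 := el_mono (by linarith) h2
      refine le_trans ?_ h3
      unfold el
      rw [Real.log_div (by linarith) (by norm_num)]
      linarith [Real.log_two_lt_d9]
  have h0 := el_one_le hx
  refine (h _ hN).trans ?_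
  calc C*⌊x⌋₊/el ⌊x⌋₊^B ≤ C*x/(el x/2)^B := by gcongr
    _ = _ := by rw [div_pow]; field_simp

end

section

noncomputable def lg (k : ℕ) : ArithmeticFunction ℝ :=
  ⟨fun n => if n = 0 then 0 else Real.log n ^ k, by simp⟩

lemma lg_apply {k n : ℕ} (h : n ≠ 0) : lg k n = Real.log n ^ k := by
  simp [lg, h]

noncomputable def LA (k : ℕ) : ArithmeticFunction ℝ := (ArithmeticFunction.moebius : ArithmeticFunction ℝ) * lg k

lemma LA_apply (k n : ℕ) : LA k n = Lambdak k n := by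
  unfold LA Lambdak
  rw [ArithmeticFunction.mul_apply, Nat.sum_divisorsAntidiagonal (fun a b => ((ArithmeticFunction.moebius : ArithmeticFunction ℝ) a) * lg k b)]
  refine Finset.sum_congr rfl fun d hd => ?_
  have h := Nat.dvd_of_mem_divisors hd
  have hn := (Nat.mem_divisors.mp hd).2
  have hd0 : d ≠ 0 := by rintro rfl; simp at h; exact hn h
  have : n / d ≠ 0 := by
    obtain ⟨e, rfl⟩ := h
    rw [Nat.mul_div_cancel_left _ (Nat.pos_of_ne_zero hd0)]
    rintro rfl; simp at hn
  rw [lg_apply this, Nat.cast_div h (by exact_mod_cast hd0)]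
  simp

lemma zeta_LA (k : ℕ) : (ArithmeticFunction.zeta : ArithmeticFunction ℝ) * LA k = lg k := by
  unfold LA
  rw [← mul_assoc, ArithmeticFunction.coe_zeta_mul_coe_moebius, one_mul]

noncomputable def Dl (f : ArithmeticFunction ℝ) : ArithmeticFunction ℝ := f.pmul ArithmeticFunction.log

lemma Dl_mul (f g : ArithmeticFunction ℝ) : Dl (f * g) = Dl f * g + f * Dl g := by
  ext n
  simp only [Dl, ArithmeticFunction.pmul_apply, ArithmeticFunction.add_apply, ArithmeticFunction.mul_apply]
  rw [Finset.sum_mul, ← Finset.sum_add_distrib]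
  refine Finset.sum_congr rfl fun x hx => ?_
  obtain ⟨h1, h2⟩ := Nat.mem_divisorsAntidiagonal.mp hx
  have hx1 : (x.1 : ℝ) ≠ 0 := by
    intro h
    have : x.1 = 0 := by exact_mod_cast h
    rw [this] at h1; simp at h1; exact h2 h1.symm
  have hx2 : (x.2 : ℝ) ≠ 0 := by
    intro h
    have : x.2 = 0 := by exact_mod_cast h
    rw [this] at h1; simp at h1; exact h2 h1.symm
  simp only [ArithmeticFunction.log_apply]
  rw [← h1, Nat.cast_mul, Real.log_mul hx1 hx2]
  ring

lemma Dl_lg (k : ℕ) : Dl (lg k) = lg (k+1) := by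
  ext n
  by_cases h : n = 0
  · subst h; simp
  · simp [Dl, lg_apply h, pow_succ]

lemma lg_zero : lg 0 = (ArithmeticFunction.zeta : ArithmeticFunction ℝ) := by
  ext n
  by_cases h : n = 0
  · subst h; simp
  · simp [lg_apply h, h]

lemma Dl_zeta : Dl (ArithmeticFunction.zeta : ArithmeticFunction ℝ) = ArithmeticFunction.log := by
  ext n
  by_cases h : n = 0
  · subst h; simp
  · simp [Dl]

lemma Dl_mu : Dl (ArithmeticFunction.moebius : ArithmeticFunction ℝ) +
    (ArithmeticFunction.vonMangoldt * (ArithmeticFunction.moebius : ArithmeticFunction ℝ)) = 0 := by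
  have h1 : Dl ((ArithmeticFunction.zeta : ArithmeticFunction ℝ) * (ArithmeticFunction.moebius : ArithmeticFunction ℝ)) = 0 := by
    rw [ArithmeticFunction.coe_zeta_mul_coe_moebius]
    ext n
    by_cases h : n = 1
    · subst h; simp [Dl]
    · simp [Dl, h]
  rw [Dl_mul, Dl_zeta, ArithmeticFunction.log_mul_moebius_eq_vonMangoldt] at h1
  have h2 := congrArg (fun f => (ArithmeticFunction.moebius : ArithmeticFunction ℝ) * f) h1
  simp only [mul_add, ← mul_assoc, ArithmeticFunction.coe_moebius_mul_coe_zeta, one_mul, mul_zero] at h2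
  rw [mul_comm (ArithmeticFunction.vonMangoldt)]
  rw [add_comm]
  exact h2

lemma LA_succ (k : ℕ) : LA (k+1) = Dl (LA k) + ArithmeticFunction.vonMangoldt * LA k := by
  unfold LA
  have h := congrArg (fun f => f * lg k) Dl_mu
  simp only [add_mul, zero_mul, mul_assoc] at h
  rw [Dl_mul, Dl_lg, add_right_comm, h, zero_add]

lemma LA_zero : LA 0 = 1 := by
  unfold LA; rw [lg_zero, ArithmeticFunction.coe_moebius_mul_coe_zeta]

lemma LA_one : LA 1 = ArithmeticFunction.vonMangoldt := by
  rw [LA_succ, LA_zero, mul_one]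
  ext n
  by_cases h : n = 1
  · subst h; simp [Dl]
  · simp [Dl, h]

lemma LA_nonneg (k n : ℕ) : 0 ≤ LA k n := by
  induction k generalizing n with
  | zero =>
    rw [LA_zero, ArithmeticFunction.one_apply]
    split_ifs <;> norm_num
  | succ k ih =>
    rw [LA_succ, ArithmeticFunction.add_apply, ArithmeticFunction.mul_apply]
    refine add_nonneg ?_ (Finset.sum_nonneg fun x _ => mul_nonneg ArithmeticFunction.vonMangoldt_nonneg (ih _))
    simp only [Dl, ArithmeticFunction.pmul_apply, ArithmeticFunction.log_apply]
    exact mul_nonneg (ih n) (Real.log_natCast_nonneg n)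

lemma LA_le {k n : ℕ} (h : n ≠ 0) : LA k n ≤ Real.log n ^ k := by
  rw [← lg_apply h, ← zeta_LA, ArithmeticFunction.coe_zeta_mul_apply]
  exact Finset.single_le_sum (f := fun i => LA k i) (fun i _ => LA_nonneg k i) (Nat.mem_divisors_self n h)

noncomputable def SL (k N : ℕ) : ℝ := ∑ n ∈ Icc 1 N, LA k n
noncomputable def ML (k N : ℕ) : ℝ := ∑ n ∈ Icc 1 N, LA k n / n

lemma SL_nonneg (k N : ℕ) : 0 ≤ SL k N := Finset.sum_nonneg fun n _ => LA_nonneg k n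

lemma sum_lg (k N : ℕ) : ∑ n ∈ Icc 1 N, Real.log n ^ k = ∑ n ∈ Icc 1 N, LA k n * ((N / n : ℕ) : ℝ) := by
  have h := ArithmeticFunction.sum_Ioc_mul_zeta_eq_sum (LA k) N
  rw [mul_comm, zeta_LA] at h
  rw [show Icc 1 N = Ioc 0 N from rfl, ← h]
  refine Finset.sum_congr rfl fun n hn => ?_
  rw [lg_apply]; simp at hn; omega

lemma ML_upper (k N : ℕ) : N * ML k N ≤ ∑ n ∈ Icc 1 N, Real.log n ^ k + SL k N := by
  rw [sum_lg, SL, ← Finset.sum_add_distrib, ML, Finset.mul_sum]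
  refine Finset.sum_le_sum fun n hn => ?_
  have h1 : (1:ℝ) ≤ n := by exact_mod_cast (Finset.mem_Icc.mp hn).1
  have := (Nat.lt_floor_add_one ((N:ℝ)/n)).le
  rw [Nat.floor_div_natCast, Nat.floor_natCast] at this
  have := mul_le_mul_of_nonneg_left this (LA_nonneg k n)
  calc (N:ℝ) * (LA k n / n) = LA k n * (N/n) := by ring
    _ ≤ _ := this
    _ = _ := by ring

lemma ML_lower (k N : ℕ) : ∑ n ∈ Icc 1 N, Real.log n ^ k ≤ N * ML k N := by
  rw [sum_lg, ML, Finset.mul_sum]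
  refine Finset.sum_le_sum fun n hn => ?_
  have := mul_le_mul_of_nonneg_left (Nat.cast_div_le (α := ℝ) (m := N) (n := n)) (LA_nonneg k n)
  calc _ ≤ _ := this
    _ = _ := by ring

lemma sum_log_le (k N : ℕ) : ∑ n ∈ Icc 1 N, Real.log n ^ k ≤ N * el N ^ k := by
  calc _ ≤ ∑ n ∈ Icc 1 N, el N ^ k := Finset.sum_le_sum fun n hn =>
        log_pow_le_el (Finset.mem_Icc.mp hn).1 (Finset.mem_Icc.mp hn).2 k
    _ = _ := by simp

lemma SL_succ (k N : ℕ) (hN : 1 ≤ N) : SL (k+1) N ≤ el N * SL k N + (Real.log 4 + 4) * (N * ML k N) := by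
  unfold SL
  rw [LA_succ]
  simp only [ArithmeticFunction.add_apply]
  rw [Finset.sum_add_distrib]
  refine add_le_add ?_ ?_
  · rw [Finset.mul_sum]
    refine Finset.sum_le_sum fun n hn => ?_
    simp only [Dl, ArithmeticFunction.pmul_apply, ArithmeticFunction.log_apply]
    rw [mul_comm]
    have := log_pow_le_el (Finset.mem_Icc.mp hn).1 (Finset.mem_Icc.mp hn).2 1
    simp only [pow_one] at this
    exact mul_le_mul_of_nonneg_right this (LA_nonneg k n)
  · rw [mul_comm, show Icc 1 N = Ioc 0 N from rfl, ArithmeticFunction.sum_Ioc_mul_eq_sum_sum, ML, Finset.mul_sum, Finset.mul_sum]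
    refine Finset.sum_le_sum fun n hn => ?_
    have h := Chebyshev.psi_le_const_mul_self (x := (N:ℝ)/n) (by positivity)
    rw [Chebyshev.psi, Nat.floor_div_natCast, Nat.floor_natCast] at h
    have := mul_le_mul_of_nonneg_left h (LA_nonneg k n)
    calc _ ≤ _ := this
      _ = _ := by ring

lemma SL_bound (k : ℕ) : ∃ C : ℝ, 0 < C ∧ ∀ N : ℕ, 1 ≤ N → SL (k+1) N ≤ C * N * el N ^ k := by
  have h4 : 0 < Real.log 4 := Real.log_pos (by norm_num)
  induction k with
  | zero =>
    refine ⟨Real.log 4 + 4, by positivity, fun N hN => ?_⟩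
    have h := Chebyshev.psi_le_const_mul_self (x := (N:ℝ)) (by positivity)
    rw [Chebyshev.psi, Nat.floor_natCast] at h
    simpa [SL, LA_one, show Icc 1 N = Ioc 0 N from rfl] using h
  | succ k ih =>
    obtain ⟨C, hC, h⟩ := ih
    refine ⟨C + (Real.log 4 + 4) * (1 + C), by positivity, fun N hN => ?_⟩
    have e1 := SL_succ (k+1) N hN
    have e2 := ML_upper (k+1) N
    have e3 := sum_log_le (k+1) N
    have e4 := h N hN
    have l1 : 1 ≤ el N := el_one_le (by exact_mod_cast hN)
    have e5 : el N ^ k ≤ el N ^ (k+1) := pow_le_pow_right₀ l1 (by omega)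
    have e6 : C * N * el N ^ k ≤ C * N * el N ^(k+1) := mul_le_mul_of_nonneg_left e5 (by positivity)
    calc SL (k+1+1) N ≤ el N * SL (k+1) N + (Real.log 4 + 4) * (N * ML (k+1) N) := e1
      _ ≤ el N * (C * N * el N ^ k) + (Real.log 4 + 4) * (N * el N ^(k+1) + C * N * el N^(k+1)) := by
        gcongr
        linarith
      _ = _ := by ring

lemma pow_sub_le {a b : ℝ} (hb : 0 ≤ b) (h : b ≤ a) (k : ℕ) : a^(k+1) - b^(k+1) ≤ (k+1) * a^k * (a-b) := by
  have ha : 0 ≤ a := hb.trans h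
  induction k with
  | zero => simp
  | succ k ih =>
    have e : a^(k+1+1) - b^(k+1+1) = a^(k+1)*(a-b) + b * (a^(k+1)-b^(k+1)) := by ring
    have h0 : b^(k+1) ≤ a^(k+1) := by gcongr
    have : b * (a^(k+1)-b^(k+1)) ≤ a * ((k+1) * a^k * (a-b)) :=
      mul_le_mul h ih (by linarith) ha
    rw [e]; push_cast
    calc _ ≤ a^(k+1)*(a-b) + a * ((k+1) * a^k * (a-b)) := by linarith
      _ = _ := by ring

lemma le_pow_sub {a b : ℝ} (hb : 0 ≤ b) (h : b ≤ a) (k : ℕ) : (k+1) * b^k * (a-b) ≤ a^(k+1) - b^(k+1) := by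
  have ha : 0 ≤ a := hb.trans h
  induction k with
  | zero => simp
  | succ k ih =>
    have e : a^(k+1+1) - b^(k+1+1) = a^(k+1)*(a-b) + b * (a^(k+1)-b^(k+1)) := by ring
    have h0 : b^(k+1) ≤ a^(k+1) := by gcongr
    have h1 : b^(k+1)*(a-b) ≤ a^(k+1)*(a-b) := mul_le_mul_of_nonneg_right h0 (by linarith)
    have h2 := mul_le_mul_of_nonneg_left ih hb
    rw [e]; push_cast
    calc _ = b^(k+1)*(a-b) + b * ((k+1) * b^k * (a-b)) := by ring
      _ ≤ _ := by linarith

lemma sum_log_sub (N : ℕ) (hN : 1 ≤ N) : ∑ m ∈ Icc 1 N, (Real.log N - Real.log m) ≤ N := by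
  have h1 : ∀ M : ℕ, ∑ m ∈ Icc 1 M, Real.log m = Real.log (M.factorial) := by
    intro M
    induction M with
    | zero => simp
    | succ M ih =>
      rw [Finset.sum_Icc_succ_top (by omega), ih, Nat.factorial_succ, Nat.cast_mul, Real.log_mul (by positivity) (by positivity)]
      ring
  rw [Finset.sum_sub_distrib, h1]
  simp only [sum_const, Nat.card_Icc, nsmul_eq_mul, Nat.add_sub_cancel]
  have h := Real.pow_div_factorial_le_exp (x := (N:ℝ)) (by positivity) N
  have h2 := Real.log_le_log (by positivity) h
  rw [Real.log_exp, Real.log_div (by positivity) (by positivity), Real.log_pow] at h2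
  exact h2

lemma mertens (k : ℕ) : ∃ C : ℝ, 0 < C ∧ ∀ N : ℕ, 1 ≤ N →
    |ML (k+1) N - Real.log N ^ (k+1)| ≤ C * el N ^ k := by
  obtain ⟨C, hC, h⟩ := SL_bound k
  refine ⟨C + (k+1), by positivity, fun N hN => ?_⟩
  have hN0 : (0:ℝ) < N := by exact_mod_cast hN
  have l1 : 1 ≤ el N := el_one_le (by exact_mod_cast hN)
  have lN : 0 ≤ Real.log N := Real.log_natCast_nonneg N
  have e1 := ML_upper (k+1) N
  have e2 := ML_lower (k+1) N
  have e3 := h N hN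
  have e4 : ∑ n ∈ Icc 1 N, Real.log n ^ (k+1) ≤ N * Real.log N ^ (k+1) := by
    calc _ ≤ ∑ n ∈ Icc 1 N, Real.log N ^ (k+1) := Finset.sum_le_sum fun n hn => by
          have h1 := (Finset.mem_Icc.mp hn)
          have : (0:ℝ) < n := by exact_mod_cast h1.1
          have : Real.log n ≤ Real.log N := Real.log_le_log this (by exact_mod_cast h1.2)
          have := Real.log_natCast_nonneg n
          gcongr
      _ = _ := by simp
  have e5 : N * Real.log N ^ (k+1) - ∑ n ∈ Icc 1 N, Real.log n ^ (k+1) ≤ (k+1) * el N ^ k * N := by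
    calc _ = ∑ n ∈ Icc 1 N, (Real.log N ^ (k+1) - Real.log n ^ (k+1)) := by
          rw [Finset.sum_sub_distrib]; simp
      _ ≤ ∑ n ∈ Icc 1 N, (k+1) * el N ^k * (Real.log N - Real.log n) := Finset.sum_le_sum fun n hn => by
          have h1 := (Finset.mem_Icc.mp hn)
          have : (0:ℝ) < n := by exact_mod_cast h1.1
          have h2 : Real.log n ≤ Real.log N := Real.log_le_log this (by exact_mod_cast h1.2)
          refine (pow_sub_le (Real.log_natCast_nonneg n) h2 k).trans ?_
          have := log_pow_le_el hN le_rfl k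
          refine mul_le_mul_of_nonneg_right ?_ (by linarith)
          gcongr
      _ = (k+1) * el N ^k * ∑ n ∈ Icc 1 N, (Real.log N - Real.log n) := by rw [Finset.mul_sum]
      _ ≤ _ := by
        have := sum_log_sub N hN
        gcongr
  have u1 : N * (ML (k+1) N - Real.log N ^(k+1)) ≤ N * ((C + (k+1)) * el N ^ k) := by
    have : 0 ≤ (k+1) * el N ^ k * N := by positivity
    nlinarith
  have u2 : N * (-((C + (k+1)) * el N ^ k)) ≤ N * (ML (k+1) N - Real.log N ^(k+1)) := by
    have : 0 ≤ C * el N ^ k * N := by positivity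
    nlinarith
  exact abs_le.mpr ⟨le_of_mul_le_mul_left u2 hN0, le_of_mul_le_mul_left u1 hN0⟩

lemma el_le_two_log {x : ℝ} (h : 3 ≤ x) : el x ≤ 2 * Real.log x := by
  have : 1 ≤ Real.log x := by
    rw [Real.le_log_iff_exp_le (by linarith)]
    linarith [Real.exp_one_lt_d9]
  unfold el; linarith

lemma log_beats (k : ℕ) {ε : ℝ} (hε : 0 < ε) (C D : ℝ) (hC : 0 ≤ C) : ∃ N0 : ℕ, ∀ N : ℕ, N0 ≤ N →
    C * el N ^ k + D < ε * Real.log N ^ (k+1) := by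
  have ht : Tendsto (fun N : ℕ => Real.log N) atTop atTop := Real.tendsto_log_atTop.comp tendsto_natCast_atTop_atTop
  obtain ⟨N1, h1⟩ := eventually_atTop.mp (ht.eventually_gt_atTop ((C * 2^k + |D|)/ε))
  refine ⟨max N1 3, fun N hN => ?_⟩
  have h3 : (3:ℝ) ≤ N := by exact_mod_cast (le_max_right _ _).trans hN
  have h2 := h1 N ((le_max_left _ _).trans hN)
  rw [div_lt_iff₀ hε] at h2
  have l1 : 1 ≤ Real.log N := by
    rw [Real.le_log_iff_exp_le (by linarith)]
    linarith [Real.exp_one_lt_d9]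
  have e0 : 0 ≤ el N := by unfold el; linarith
  have e1 : el N ^ k ≤ 2^k * Real.log N ^ k := by
    rw [← mul_pow]; exact pow_le_pow_left₀ e0 (el_le_two_log h3) k
  have e2 : 1 ≤ Real.log N ^ k := one_le_pow₀ l1
  have e3 : D ≤ |D| * Real.log N ^ k := by nlinarith [le_abs_self D, abs_nonneg D]
  calc C * el N ^ k + D ≤ C * (2^k * Real.log N ^ k) + |D| * Real.log N ^ k := by gcongr
    _ = (C * 2^k + |D|) * Real.log N ^ k := by ring
    _ < (Real.log N * ε) * Real.log N ^ k := by gcongr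
    _ = _ := by ring

lemma ML_step (k N : ℕ) (hN : 1 ≤ N) : ML k (N+1) - SL k (N+1) / ((N+1 : ℕ):ℝ) = ML k N - SL k N / N + SL k N / (N * (N+1)) := by
  unfold ML SL
  rw [Finset.sum_Icc_succ_top (by omega), Finset.sum_Icc_succ_top (by omega)]
  have : (N:ℝ) ≠ 0 := by positivity
  push_cast
  field_simp
  ring

lemma base_low (k : ℕ) {ε : ℝ} (hε : 0 < ε) (hε1 : ε ≤ 1) (N0 : ℕ) : ∃ N : ℕ, N0 ≤ N ∧
    (1 - ε) * (k+1) * N * Real.log N ^ k ≤ SL (k+1) N := by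
  by_contra! hcon
  obtain ⟨C, hC, h⟩ := SL_bound k
  obtain ⟨C', hC', h'⟩ := mertens k
  set K := max N0 1 with hK
  have key : ∀ N, K ≤ N → ML (k+1) N - SL (k+1) N / N - (1-ε) * Real.log N ^(k+1) ≤
      ML (k+1) K - SL (k+1) K / K - (1-ε) * Real.log K ^(k+1) := by
    intro N hN
    induction N, hN using Nat.le_induction with
    | base => exact le_rfl
    | succ N hN ih =>
      refine le_trans ?_ ih
      have hN1 : 1 ≤ N := le_trans (le_max_right _ _) hN
      have hNp : (0:ℝ) < N := by exact_mod_cast hN1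
      rw [ML_step _ _ hN1]
      have hS := (hcon N (le_trans (le_max_left _ _) hN)).le
      have hl : Real.log N ≤ Real.log ((N+1:ℕ):ℝ) := Real.log_le_log hNp (by push_cast; linarith)
      have e1 := le_pow_sub (Real.log_natCast_nonneg N) hl k
      have e2 : 1/((N:ℝ)+1) ≤ Real.log ((N+1:ℕ):ℝ) - Real.log N := by
        have := Real.log_le_sub_one_of_pos (x := (N:ℝ)/(N+1)) (by positivity)
        rw [Real.log_div (by positivity) (by positivity)] at this
        push_cast
        have e : (N:ℝ)/(N+1) - 1 = - (1/((N:ℝ)+1)) := by field_simp; ring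
        linarith
      have e3 : SL (k+1) N / (N*(N+1)) ≤ (1-ε) * ((k+1) * Real.log N ^k * (1/((N:ℝ)+1))) := by
        rw [div_le_iff₀ (by positivity)]
        refine hS.trans (le_of_eq ?_)
        field_simp
      have lk : 0 ≤ Real.log N ^ k := pow_nonneg (Real.log_natCast_nonneg N) k
      have e4 : (k+1) * Real.log N ^k * (1/((N:ℝ)+1)) ≤ (k+1) * Real.log N ^k * (Real.log ((N+1:ℕ):ℝ) - Real.log N) := by gcongr
      have e5 := mul_le_mul_of_nonneg_left (e4.trans e1) (show 0 ≤ 1 - ε by linarith)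
      linarith
  obtain ⟨N1, hN1⟩ := log_beats k hε (C + C') (ML (k+1) K - SL (k+1) K / K - (1-ε) * Real.log K ^(k+1)) (by positivity)
  set N := max N1 K with hNdef
  have hN : 1 ≤ N := le_trans (le_max_right N0 1) (le_max_right _ _)
  have hNp : (0:ℝ) < N := by exact_mod_cast hN
  have a1 := key N (le_max_right _ _)
  have a2 := hN1 N (le_max_left _ _)
  have a3 := (abs_le.mp (h' N hN)).1
  have a4 : SL (k+1) N / N ≤ C * el N ^ k := by
    rw [div_le_iff₀ hNp]; refine (h N hN).trans (le_of_eq ?_); ring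
  nlinarith

lemma base_high (k : ℕ) {ε : ℝ} (hε : 0 < ε) (N0 : ℕ) : ∃ N : ℕ, N0 ≤ N ∧
    SL (k+1) N ≤ (1 + ε) * (k+1) * N * Real.log N ^ k := by
  by_contra! hcon
  obtain ⟨C', hC', h'⟩ := mertens k
  obtain ⟨n1, hn1⟩ := exists_nat_ge ((4 + 3*ε)/ε)
  set K := max N0 (max 2 n1) with hK
  have hdiff : ∀ N : ℕ, 2 ≤ N → Real.log N ^(k+1) - Real.log ((N:ℝ)-1)^(k+1) ≤ (k+1) * Real.log N ^k * (1/((N:ℝ)-1)) := by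
    intro N hN
    have h2 : (2:ℝ) ≤ N := by exact_mod_cast hN
    have hl : Real.log ((N:ℝ)-1) ≤ Real.log N := Real.log_le_log (by linarith) (by linarith)
    refine (pow_sub_le (Real.log_nonneg (by linarith)) hl k).trans ?_
    have : Real.log N - Real.log ((N:ℝ)-1) ≤ 1/((N:ℝ)-1) := by
      have hp : (0:ℝ) < (N:ℝ)-1 := by linarith
      have := Real.log_le_sub_one_of_pos (x := (N:ℝ)/(N-1)) (by positivity)
      rw [Real.log_div (by positivity) (by positivity)] at this
      have e : (N:ℝ)/(N-1) - 1 = (1/((N:ℝ)-1)) := by field_simp; ring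
      linarith
    have := Real.log_natCast_nonneg N
    gcongr
  have key : ∀ N, K ≤ N → ML (k+1) K - SL (k+1) K / K - (1+ε/2) * Real.log ((K:ℝ)-1) ^(k+1) ≤ 
      ML (k+1) N - SL (k+1) N / N - (1+ε/2) * Real.log ((N:ℝ)-1) ^(k+1) := by
    intro N hN
    induction N, hN using Nat.le_induction with
    | base => exact le_rfl
    | succ N hN ih =>
      refine le_trans ih ?_
      have hN2 : 2 ≤ N := le_trans (le_trans (le_max_left _ _) (le_max_right _ _)) hN
      have hNn : n1 ≤ N := le_trans (le_trans (le_max_right _ _) (le_max_right _ _)) hN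
      have hNr : (4 + 3*ε)/ε ≤ N := hn1.trans (by exact_mod_cast hNn)
      rw [div_le_iff₀ hε] at hNr
      have hN2' : (2:ℝ) ≤ N := by exact_mod_cast hN2
      rw [ML_step _ _ (by omega)]
      have hS := (hcon N (le_trans (le_max_left _ _) hN)).le
      have e1 := hdiff N hN2
      have lk : 0 ≤ Real.log N ^ k := pow_nonneg (Real.log_natCast_nonneg N) k
      have e3 : (1+ε/2) * ((k+1) * Real.log N ^k * (1/((N:ℝ)-1))) ≤ SL (k+1) N / (N*(N+1)) := by
        rw [le_div_iff₀ (by positivity)]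
        refine le_trans ?_ hS
        have hp : (0:ℝ) < (N:ℝ)-1 := by linarith
        have : (1+ε/2) * (1/((N:ℝ)-1)) * (N+1) ≤ 1+ε := by
          rw [mul_one_div, div_mul_eq_mul_div, div_le_iff₀ hp]
          nlinarith
        calc _ = ((1+ε/2) * (1/((N:ℝ)-1)) * (N+1)) * ((k+1) * N * Real.log N ^k) := by ring
          _ ≤ (1+ε) * ((k+1) * N * Real.log N ^k) := by gcongr
          _ = _ := by ring
      have e5 := mul_le_mul_of_nonneg_left e1 (show 0 ≤ 1 + ε/2 by linarith)
      push_cast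
      rw [show (N:ℝ)+1-1 = N by ring]
      linarith
  obtain ⟨N1, hN1⟩ := log_beats k (half_pos hε) (C' + (1+ε/2)*(k+1)) (-(ML (k+1) K - SL (k+1) K / K - (1+ε/2) * Real.log ((K:ℝ)-1) ^(k+1))) (by positivity)
  set N := max N1 K with hNdef
  have hN : 2 ≤ N := le_trans (le_trans (le_max_left _ _) (le_max_right N0 _)) (le_max_right _ _)
  have hN2' : (2:ℝ) ≤ N := by exact_mod_cast hN
  have a1 := key N (le_max_right _ _)
  have a2 := hN1 N (le_max_left _ _)
  have a3 := (abs_le.mp (h' N (by omega))).2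
  have a4 : 0 ≤ SL (k+1) N / N := div_nonneg (SL_nonneg _ _) (by positivity)
  have a5 : Real.log N ^(k+1) - Real.log ((N:ℝ)-1)^(k+1) ≤ (k+1) * el N ^k := by
    refine (hdiff N hN).trans ?_
    have := log_pow_le_el (show 1 ≤ N by omega) le_rfl k
    have h1 : 1/((N:ℝ)-1) ≤ 1 := by rw [div_le_one (by linarith)]; linarith
    have h2 : 0 ≤ Real.log N ^ k := pow_nonneg (Real.log_natCast_nonneg N) k
    calc _ ≤ (k+1) * Real.log N ^ k * 1 := by gcongr
      _ ≤ _ := by rw [mul_one]; gcongr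
  have a6 := mul_le_mul_of_nonneg_left a5 (show 0 ≤ 1 + ε/2 by linarith)
  linarith

end

section

noncomputable def tw (f : ArithmeticFunction ℝ) : ArithmeticFunction ℝ :=
  ⟨fun n => lam n * f n, by simp⟩

lemma tw_apply (f : ArithmeticFunction ℝ) (n : ℕ) : tw f n = lam n * f n := rfl

lemma tw_mul (f g : ArithmeticFunction ℝ) : tw (f * g) = tw f * tw g := by
  ext n
  rw [tw_apply, ArithmeticFunction.mul_apply, ArithmeticFunction.mul_apply, Finset.mul_sum]
  refine Finset.sum_congr rfl fun x hx => ?_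
  obtain ⟨h1, h2⟩ := Nat.mem_divisorsAntidiagonal.mp hx
  rw [tw_apply, tw_apply, ← h1, lam_mul]
  ring

lemma el_sum (M : ℕ) (hM : 1 ≤ M) : ∑ e ∈ Icc 1 M, (M/e : ℝ) / el (M/e)^2 ≤ 3 * M := by
  have hM0 : (0:ℝ) < M := by exact_mod_cast hM
  have key : ∀ J, 1 ≤ J → J ≤ M → ∑ e ∈ Ico 1 J, (1/e : ℝ) / el (M/e)^2 ≤ 2 * (1 / el (M/J)) := by
    intro J hJ
    induction J, hJ using Nat.le_induction with
    | base =>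
      intro _
      have := el_one_le (x := (M:ℝ)) (by exact_mod_cast hM)
      simp; linarith
    | succ J hJ ih =>
      intro hJM
      have ih' := ih (by omega)
      rw [Finset.sum_Ico_succ_top hJ]
      have hJ0 : (0:ℝ) < J := by exact_mod_cast hJ
      have hJ1 : (1:ℝ) ≤ J := by exact_mod_cast hJ
      have hJM' : (J:ℝ)+1 ≤ M := by exact_mod_cast hJM
      have a1 : 1 ≤ el (M/J) := el_one_le (by rw [le_div_iff₀ hJ0]; linarith)
      have a2 : 1 ≤ el (M/((J+1:ℕ):ℝ)) := el_one_le (by push_cast; rw [le_div_iff₀ (by positivity)]; linarith)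
      have a3 : 1/((J:ℝ)+1) ≤ el (M/J) - el (M/((J+1:ℕ):ℝ)) := by
        unfold el
        rw [Real.log_div (by positivity) (by positivity), Real.log_div (by positivity) (by positivity)]
        have := Real.log_le_sub_one_of_pos (x := (J:ℝ)/(J+1)) (by positivity)
        rw [Real.log_div (by positivity) (by positivity)] at this
        push_cast
        have e : (J:ℝ)/(J+1) - 1 = - (1/((J:ℝ)+1)) := by field_simp; ring
        linarith
      have a4 : (1/J:ℝ) ≤ 2 * (1/((J:ℝ)+1)) := by
        rw [mul_one_div, div_le_div_iff₀ hJ0 (by positivity)]; linarith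
      generalize el (M/J) = u at *
      generalize el (M/((J+1:ℕ):ℝ)) = v at *
      have hvu : v ≤ u := by
        have : 0 < 1/((J:ℝ)+1) := by positivity
        linarith
      have a5 : (1/J:ℝ)/u^2 ≤ 2 * (1/v - 1/u) := by
        have : 1/v - 1/u = (u-v)/(v*u) := by field_simp
        rw [this, mul_div_assoc']
        have : v * u ≤ u^2 := by nlinarith
        calc (1/J:ℝ)/u^2 ≤ (2*(u-v))/u^2 := by gcongr; linarith
          _ ≤ _ := by
            apply div_le_div_of_nonneg_left (by linarith) (by positivity) this
      linarith
  have h := key M hM le_rfl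
  have e : ∑ e ∈ Icc 1 M, (M/e : ℝ) / el (M/e)^2 = M * (∑ e ∈ Ico 1 M, (1/e : ℝ) / el (M/e)^2) + 1 := by
    rw [← Finset.Ico_insert_right hM, Finset.sum_insert (by simp), Finset.mul_sum, add_comm]
    congr 1
    · refine Finset.sum_congr rfl fun e _ => by ring
    · rw [div_self hM0.ne']; simp [el]
  have h1 : (1:ℝ) ≤ M := by exact_mod_cast hM
  rw [e]
  rw [div_self hM0.ne'] at h
  have e1 : el 1 = 1 := by simp [el]
  rw [e1] at h
  nlinarith

noncomputable def PsL (i M : ℕ) : ℝ := ∑ m ∈ Icc 1 M, lam m * LA i m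

lemma PsL_bound (i : ℕ) : ∃ C : ℝ, 0 < C ∧ ∀ M : ℕ, |PsL i M| ≤ C * M := by
  obtain ⟨C, hC, h⟩ := thmA i 2
  refine ⟨C*3, by positivity, fun M => ?_⟩
  rcases Nat.eq_zero_or_pos M with rfl | hM
  · simp [PsL]
  have e : PsL i M = ∑ e ∈ Icc 1 M, tw (ArithmeticFunction.moebius : ArithmeticFunction ℝ) e * ∑ m ∈ Icc 1 (M/e), tw (lg i) m := by
    have := ArithmeticFunction.sum_Ioc_mul_eq_sum_sum (tw (ArithmeticFunction.moebius : ArithmeticFunction ℝ)) (tw (lg i)) M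
    rw [← tw_mul] at this
    exact this
  rw [e]
  calc _ ≤ ∑ e ∈ Icc 1 M, C * ((M/e:ℝ) / el (M/e)^2) := by
        refine (Finset.abs_sum_le_sum_abs _ _).trans (Finset.sum_le_sum fun e he => ?_)
        have he1 := Finset.mem_Icc.mp he
        have he0 : (0:ℝ) < e := by exact_mod_cast he1.1
        rw [abs_mul]
        have hx := h (M/e) (by rw [le_div_iff₀ he0]; simpa using (by exact_mod_cast he1.2 : (e:ℝ) ≤ M))
        rw [Nat.floor_div_natCast, Nat.floor_natCast] at hx
        have h1 : |tw (ArithmeticFunction.moebius : ArithmeticFunction ℝ) e| ≤ 1 := by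
          rw [tw_apply, abs_mul]
          refine mul_le_one₀ (lam_abs_le e) (abs_nonneg _) ?_
          have := ArithmeticFunction.abs_moebius_le_one (n := e)
          rw [ArithmeticFunction.intCoe_apply]
          exact_mod_cast this
        have h2 : ∑ m ∈ Icc 1 (M/e), tw (lg i) m = ∑ n ∈ Icc 1 (M/e), Real.log n^i * lam n := by
          refine Finset.sum_congr rfl fun n hn => ?_
          rw [tw_apply, lg_apply, mul_comm]
          have := (Finset.mem_Icc.mp hn).1; omega
        rw [h2]
        calc _ ≤ 1 * (C * (M/e:ℝ) / el (M/e)^2) := mul_le_mul h1 hx (abs_nonneg _) zero_le_one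
          _ = _ := by ring
    _ ≤ _ := by
      rw [← Finset.mul_sum, mul_assoc]
      exact mul_le_mul_of_nonneg_left (el_sum M hM) hC.le

lemma PsL_zero {M : ℕ} (hM : 1 ≤ M) : PsL 0 M = 1 := by
  unfold PsL
  rw [Finset.sum_eq_single 1]
  · simp [LA_zero, lam_one]
  · intro b _ hb; simp [LA_zero, hb]
  · intro h; exact absurd (Finset.mem_Icc.mpr ⟨le_rfl, hM⟩) h

lemma PsL_one_le (M : ℕ) : PsL 1 M ≤ Chebyshev.psi M - 2 * Chebyshev.theta M := by
  unfold PsL Chebyshev.psi Chebyshev.theta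
  rw [Nat.floor_natCast, Finset.sum_filter, Finset.mul_sum, ← Finset.sum_sub_distrib, LA_one]
  refine Finset.sum_le_sum fun n _ => ?_
  split_ifs with hp
  · rw [lam_prime hp, ArithmeticFunction.vonMangoldt_apply_prime hp]; linarith
  · have := (abs_le.mp (lam_abs_le n)).2
    have h2 := ArithmeticFunction.vonMangoldt_nonneg (n := n)
    nlinarith

lemma PsL_one_neg : ∃ M0 : ℕ, ∀ M : ℕ, M0 ≤ M → PsL 1 M ≤ - (M:ℝ) / 2 := by
  have hlo := (isLittleO_log_rpow_atTop (r := 1/2) (by norm_num)).bound (c := 1/100) (by norm_num)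
  obtain ⟨x0, hx0⟩ := eventually_atTop.mp hlo
  obtain ⟨n0, hn0⟩ := exists_nat_ge x0
  refine ⟨max n0 100, fun M hM => ?_⟩
  have h100 : (100:ℝ) ≤ M := by exact_mod_cast (le_max_right _ _).trans hM
  have h1 := hx0 M (hn0.trans (by exact_mod_cast (le_max_left _ _).trans hM))
  have hl0 : 0 ≤ Real.log M := Real.log_natCast_nonneg M
  rw [Real.norm_of_nonneg hl0, Real.norm_of_nonneg (by positivity), ← Real.sqrt_eq_rpow] at h1
  have hs := Real.mul_self_sqrt (show (0:ℝ) ≤ M by positivity)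
  have hs0 := Real.sqrt_nonneg (M:ℝ)
  have a1 := Chebyshev.theta_ge' (x := (M:ℝ)) (by linarith)
  have a2 := Chebyshev.psi_sub_theta_le (x := (M:ℝ)) (by linarith)
  have a3 := PsL_one_le M
  have a4 : √(M:ℝ) * Real.log M ≤ M/100 := by nlinarith
  have a5 : Real.log ((M:ℝ)+2) ≤ 2 * Real.log M := by
    have : Real.log ((M:ℝ)+2) ≤ Real.log ((M:ℝ)^2) := Real.log_le_log (by linarith) (by nlinarith)
    rwa [Real.log_pow] at this
  have a6 : Real.log M ≤ M/100 := by
    have : 1 ≤ √(M:ℝ) := by rw [Real.one_le_sqrt]; linarith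
    nlinarith
  have a7 := Real.log_two_gt_d9
  nlinarith

lemma LA_prime_mul {p m : ℕ} (hp : p.Prime) (hm : m ≠ 0) (h : ¬ p ∣ m) (k : ℕ) :
    LA k (p*m) = ∑ i ∈ range k, (k.choose i) * Real.log p ^(k-i) * LA i m := by
  simp only [LA_apply]
  have hdiv : (p*m).divisors = m.divisors ∪ m.divisors.image (p * ·) := by
    ext d
    simp only [Nat.mem_divisors, Finset.mem_union, Finset.mem_image]
    constructor
    · rintro ⟨hd, _⟩
      by_cases hpd : p ∣ d
      · right
        obtain ⟨e, rfl⟩ := hpd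
        exact ⟨e, ⟨Nat.dvd_of_mul_dvd_mul_left hp.pos hd, hm⟩, rfl⟩
      · left
        exact ⟨(Nat.Coprime.dvd_of_dvd_mul_left ((Nat.Prime.coprime_iff_not_dvd hp).mpr hpd).symm hd), hm⟩
    · rintro (⟨hd, _⟩ | ⟨e, ⟨he, _⟩, rfl⟩)
      · exact ⟨hd.mul_left p, mul_ne_zero hp.ne_zero hm⟩
      · exact ⟨Nat.mul_dvd_mul_left p he, mul_ne_zero hp.ne_zero hm⟩
  have hdisj : Disjoint m.divisors (m.divisors.image (p * ·)) := by
    rw [Finset.disjoint_left]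
    intro d hd hd2
    obtain ⟨e, he, rfl⟩ := Finset.mem_image.mp hd2
    exact h ((Dvd.intro e rfl).trans (Nat.dvd_of_mem_divisors hd))
  have hp0 : (p:ℝ) ≠ 0 := by exact_mod_cast hp.ne_zero
  unfold Lambdak
  rw [hdiv, Finset.sum_union hdisj, Finset.sum_image (fun a _ b _ hab => Nat.eq_of_mul_eq_mul_left hp.pos hab),
    ← Finset.sum_add_distrib]
  simp only [Finset.mul_sum]
  rw [Finset.sum_comm]
  refine Finset.sum_congr rfl fun d hd => ?_
  have hd1 := Nat.dvd_of_mem_divisors hd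
  have hd0 : d ≠ 0 := by rintro rfl; simp at hd1; exact hm hd1
  have hd0' : (d:ℝ) ≠ 0 := by exact_mod_cast hd0
  have hm' : (m:ℝ) ≠ 0 := by exact_mod_cast hm
  have hcop : Nat.Coprime p d := (Nat.Prime.coprime_iff_not_dvd hp).mpr fun hh => h (hh.trans hd1)
  rw [ArithmeticFunction.isMultiplicative_moebius.map_mul_of_coprime hcop, ArithmeticFunction.moebius_apply_prime hp]
  push_cast
  rw [mul_div_mul_left _ _ hp0, mul_div_assoc, Real.log_mul hp0 (div_ne_zero hm' hd0'), add_comm (Real.log p),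
    add_pow, Finset.sum_range_succ]
  simp only [Nat.sub_self, pow_zero, Nat.choose_self, Nat.cast_one, mul_one]
  rw [mul_add, Finset.mul_sum]
  rw [neg_one_mul, neg_mul, add_assoc, add_neg_cancel, add_zero]
  refine Finset.sum_congr rfl fun i _ => by ring

noncomputable def Wp (η : ℝ) (X : ℕ) : Finset ℕ := (Ioc ⌊(X:ℝ)^η⌋₊ ⌊(X:ℝ)^(2*η)⌋₊).filter Nat.Prime

lemma Wp_mem {η : ℝ} {X p : ℕ} (h : p ∈ Wp η X) : p.Prime ∧ (X:ℝ)^η < p ∧ (p:ℝ) ≤ (X:ℝ)^(2*η) := by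
  simp only [Wp, Finset.mem_filter, Finset.mem_Ioc] at h
  refine ⟨h.2, ?_, ?_⟩
  · exact (Nat.floor_lt (by positivity)).mp h.1.1
  · exact (Nat.le_floor_iff (by positivity)).mp h.1.2

lemma nonprime_sum : ∃ D : ℝ, ∀ s : Finset ℕ, ∑ n ∈ s.filter (fun n => ¬ n.Prime), LA 1 n / n ≤ D := by
  have hs := ArithmeticFunction.vonMangoldt.summable_residueClass_non_primes_div (q := 1) 1
  refine ⟨∑' n : ℕ, (if Nat.Prime n then 0 else ArithmeticFunction.vonMangoldt.residueClass (1 : ZMod 1) n) / (n:ℝ), fun s => ?_⟩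
  · rw [Finset.sum_filter]
    refine le_trans (le_of_eq ?_) (hs.sum_le_tsum s ?_)
    · refine Finset.sum_congr rfl fun n _ => ?_
      have : ArithmeticFunction.vonMangoldt.residueClass (1 : ZMod 1) n = LA 1 n := by
        rw [LA_one]
        have hm : n ∈ {n : ℕ | (n : ZMod 1) = 1} := by
          show (n : ZMod 1) = 1
          exact Subsingleton.elim _ _
        exact Set.indicator_of_mem hm _
      rw [this]
      split_ifs <;> simp
    · intro n _
      have := ArithmeticFunction.vonMangoldt.residueClass_nonneg (1 : ZMod 1) n
      split_ifs <;> positivity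

lemma Wp_sum_lower {η : ℝ} (hη : 0 < η) : ∃ X0 : ℕ, ∀ X : ℕ, X0 ≤ X →
    η / 2 * Real.log X ≤ ∑ p ∈ Wp η X, Real.log p / p := by
  obtain ⟨D, hD⟩ := nonprime_sum
  obtain ⟨C, hC, hM⟩ := mertens 0
  have ht : Tendsto (fun N : ℕ => Real.log N) atTop atTop := Real.tendsto_log_atTop.comp tendsto_natCast_atTop_atTop
  obtain ⟨N1, h1⟩ := eventually_atTop.mp (ht.eventually_ge_atTop ((2*C+D+1)/(η/2)))
  refine ⟨max N1 1, fun X hX => ?_⟩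
  have hX1 : (1:ℝ) ≤ X := by exact_mod_cast (le_max_right _ _).trans hX
  have hl := h1 X ((le_max_left _ _).trans hX)
  rw [div_le_iff₀ (by positivity)] at hl
  set n1 := ⌊(X:ℝ)^η⌋₊ with hn1
  set n2 := ⌊(X:ℝ)^(2*η)⌋₊ with hn2
  have x1 : 1 ≤ (X:ℝ)^η := Real.one_le_rpow hX1 hη.le
  have x2 : 1 ≤ (X:ℝ)^(2*η) := Real.one_le_rpow hX1 (by linarith)
  have p1 : 1 ≤ n1 := Nat.le_floor (by simpa using x1)
  have p2 : 1 ≤ n2 := Nat.le_floor (by simpa using x2)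
  have hle : n1 ≤ n2 := Nat.floor_le_floor (Real.rpow_le_rpow_of_exponent_le hX1 (by linarith))
  have e1 : ∑ n ∈ Ioc n1 n2, LA 1 n / n = ML 1 n2 - ML 1 n1 := by
    unfold ML
    have := Finset.sum_Ioc_consecutive (fun n : ℕ => LA 1 n / (n:ℝ)) (Nat.zero_le n1) hle
    rw [show Icc 1 n2 = Ioc 0 n2 from rfl, show Icc 1 n1 = Ioc 0 n1 from rfl]
    linarith
  have e2 := Finset.sum_filter_add_sum_filter_not (Ioc n1 n2) Nat.Prime (fun n : ℕ => LA 1 n / (n:ℝ))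
  have e3 : ∑ p ∈ Wp η X, Real.log p / p = ∑ n ∈ (Ioc n1 n2).filter Nat.Prime, LA 1 n / n := by
    refine Finset.sum_congr rfl fun p hp => ?_
    rw [LA_one, ArithmeticFunction.vonMangoldt_apply_prime (Wp_mem hp).1]
  have b1 := (abs_le.mp (hM n1 p1)).2
  have b2 := (abs_le.mp (hM n2 p2)).1
  have b3 := hD (Ioc n1 n2)
  simp only [zero_add, pow_one, pow_zero, mul_one] at b1 b2
  have c1 : Real.log n1 ≤ η * Real.log X := by
    rw [← Real.log_rpow (by linarith)]
    exact Real.log_le_log (by exact_mod_cast p1) (Nat.floor_le (by linarith))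
  have c2 : 2 * η * Real.log X - 1 ≤ Real.log n2 := by
    rw [← Real.log_rpow (by linarith)]
    have := (Nat.lt_floor_add_one ((X:ℝ)^(2*η))).le
    rw [← hn2] at this
    have hn2' : (1:ℝ) ≤ n2 := by exact_mod_cast p2
    have h3 : Real.log ((X:ℝ)^(2*η)) ≤ Real.log (2 * n2) := Real.log_le_log (by linarith) (by linarith)
    rw [Real.log_mul (by norm_num) (by positivity)] at h3
    have := Real.log_two_lt_d9
    linarith
  linarith

lemma Wp_sum_upper {η : ℝ} (hη : 0 < η) (hη1 : η ≤ 1/2) : ∃ C : ℝ, 0 < C ∧ ∀ X : ℕ, 1 ≤ X →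
    ∑ p ∈ Wp η X, Real.log p / p ≤ C * el X := by
  obtain ⟨C, hC, hM⟩ := mertens 0
  refine ⟨1 + C, by positivity, fun X hX => ?_⟩
  have hX1 : (1:ℝ) ≤ X := by exact_mod_cast hX
  have hb := (abs_le.mp (hM X hX)).2
  simp only [zero_add, pow_one, pow_zero, mul_one] at hb
  have : ∑ p ∈ Wp η X, Real.log p / p ≤ ML 1 X := by
    unfold ML
    calc _ = ∑ p ∈ Wp η X, LA 1 p / p := Finset.sum_congr rfl fun p hp => by
            rw [LA_one, ArithmeticFunction.vonMangoldt_apply_prime (Wp_mem hp).1]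
      _ ≤ _ := Finset.sum_le_sum_of_subset_of_nonneg (fun p hp => by
          obtain ⟨a, b, c⟩ := Wp_mem hp
          rw [Finset.mem_Icc]
          refine ⟨a.one_lt.le, ?_⟩
          have : (X:ℝ)^(2*η) ≤ (X:ℝ)^(1:ℝ) := Real.rpow_le_rpow_of_exponent_le hX1 (by linarith)
          rw [Real.rpow_one] at this
          exact_mod_cast c.trans this) (fun n _ _ => div_nonneg (LA_nonneg _ _) (by positivity))
  have l0 := el_one_le hX1
  have : Real.log X ≤ el X := by unfold el; linarith
  nlinarith

end

section

lemma sum_multiples (f : ℕ → ℝ) (N d : ℕ) (hd : 1 ≤ d) :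
    ∑ n ∈ (Icc 1 N).filter (fun n => d ∣ n), f n = ∑ m ∈ Icc 1 (N/d), f (d*m) := by
  symm
  refine Finset.sum_bij (fun m _ => d * m) ?_ ?_ ?_ ?_
  · intro m hm
    have hm' := Finset.mem_Icc.mp hm
    rw [Finset.mem_filter, Finset.mem_Icc]
    refine ⟨⟨Nat.mul_pos hd hm'.1, ?_⟩, Dvd.intro _ rfl⟩
    exact (Nat.mul_le_mul_left d hm'.2).trans (Nat.mul_div_le N d)
  · intro a _ b _ h
    exact Nat.eq_of_mul_eq_mul_left hd h
  · intro n hn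
    rw [Finset.mem_filter, Finset.mem_Icc] at hn
    obtain ⟨⟨h1, h2⟩, e, rfl⟩ := hn
    refine ⟨e, ?_, rfl⟩
    rw [Finset.mem_Icc]
    refine ⟨Nat.pos_of_ne_zero (by rintro rfl; simp at h1), ?_⟩
    rw [Nat.le_div_iff_mul_le hd, mul_comm]; exact h2
  · intro m _; rfl

noncomputable def cW (η : ℝ) (X n : ℕ) : ℝ := (∑ p ∈ (Wp η X).filter (fun p => p ∣ n), Real.log p) / Real.log X

noncomputable def bX (η : ℝ) (X n : ℕ) : ℝ := -(lam n * (1 - cW η X n))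

lemma cW_nonneg (η : ℝ) (X n : ℕ) : 0 ≤ cW η X n :=
  div_nonneg (Finset.sum_nonneg fun p _ => Real.log_natCast_nonneg p) (Real.log_natCast_nonneg X)

lemma cW_le_one (η : ℝ) (X n : ℕ) (hn : 1 ≤ n) (h : n ≤ X) : cW η X n ≤ 1 := by
  refine div_le_one_of_le₀ ?_ (Real.log_natCast_nonneg X)
  have h1 : ∑ p ∈ (Wp η X).filter (fun p => p ∣ n), Real.log p ≤ Real.log n := by
    have e : Real.log n = ∑ d ∈ n.divisors, ArithmeticFunction.vonMangoldt d := by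
      rw [ArithmeticFunction.vonMangoldt_sum]
    rw [e]
    calc _ = ∑ p ∈ (Wp η X).filter (fun p => p ∣ n), ArithmeticFunction.vonMangoldt p :=
          Finset.sum_congr rfl fun p hp => by
            rw [ArithmeticFunction.vonMangoldt_apply_prime (Wp_mem (Finset.mem_filter.mp hp).1).1]
      _ ≤ _ := Finset.sum_le_sum_of_subset_of_nonneg (fun p hp => by
            rw [Nat.mem_divisors]; exact ⟨(Finset.mem_filter.mp hp).2, by omega⟩)
            (fun _ _ _ => ArithmeticFunction.vonMangoldt_nonneg)
  refine h1.trans (Real.log_le_log (by exact_mod_cast hn) (by exact_mod_cast h))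

lemma bX_abs (η : ℝ) (X n : ℕ) (hn : 1 ≤ n) (h : n ≤ X) : |bX η X n| ≤ 1 := by
  unfold bX
  rw [abs_neg, abs_mul]
  refine mul_le_one₀ (lam_abs_le n) (abs_nonneg _) ?_
  rw [abs_le]
  constructor <;> linarith [cW_nonneg η X n, cW_le_one η X n hn h]

/-- per-prime quantity -/
noncomputable def Br (k p X : ℕ) : ℝ := - ∑ m ∈ Icc 1 (X/p), lam m * LA k (p*m)

lemma bX_sum (η : ℝ) (X k : ℕ) : ∑ n ∈ Icc 1 X, bX η X n * LA k n =
    - PsL k X + (∑ p ∈ Wp η X, Real.log p * Br k p X) / Real.log X := by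
  have e1 : ∀ n, bX η X n * LA k n = - (lam n * LA k n) +
      (∑ p ∈ Wp η X, if p ∣ n then Real.log p * (lam n * LA k n) else 0) / Real.log X := by
    intro n
    rw [← Finset.sum_filter, ← Finset.sum_mul]
    unfold bX cW; ring
  simp only [e1]
  rw [Finset.sum_add_distrib, Finset.sum_neg_distrib, ← Finset.sum_div, Finset.sum_comm]
  congr 2
  refine Finset.sum_congr rfl fun p hp => ?_
  have hpp := (Wp_mem hp).1
  rw [← Finset.sum_filter, sum_multiples _ _ _ hpp.one_lt.le, Br, mul_neg, ← Finset.mul_sum, ← mul_neg, ← Finset.sum_neg_distrib]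
  congr 1
  refine Finset.sum_congr rfl fun m _ => ?_
  rw [lam_mul, lam_prime hpp]; ring

lemma Br_approx {k p X : ℕ} (hp : p.Prime) (hpX : p ≤ X) :
    |Br k p X + ∑ i ∈ range k, (k.choose i) * Real.log p ^(k-i) * PsL i (X/p)| ≤ ((X/p : ℕ):ℝ) / p * Real.log X ^ k := by
  set M := X/p with hM
  set Q : ℕ → ℝ := fun m => ∑ i ∈ range k, (k.choose i) * Real.log p ^(k-i) * LA i m with hQ
  have hlp : 0 ≤ Real.log p := Real.log_natCast_nonneg p
  have e1 : Br k p X + ∑ i ∈ range k, (k.choose i) * Real.log p ^(k-i) * PsL i M =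
      ∑ m ∈ Icc 1 M, lam m * (Q m - LA k (p*m)) := by
    unfold Br PsL
    simp only [mul_sub, Finset.sum_sub_distrib, hQ, Finset.mul_sum]
    rw [Finset.sum_comm, ← hM, neg_add_eq_sub]
    congr 1
    refine Finset.sum_congr rfl fun m _ => Finset.sum_congr rfl fun i _ => by ring
  rw [e1]
  have e2 : ∀ m ∈ Icc 1 M, |lam m * (Q m - LA k (p*m))| ≤ if p ∣ m then Real.log X ^ k else 0 := by
    intro m hm
    have hm' := Finset.mem_Icc.mp hm
    have hmp : (0:ℝ) < m := by exact_mod_cast hm'.1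
    have hpp : (0:ℝ) < p := by exact_mod_cast hp.pos
    split_ifs with hd
    · rw [abs_mul]
      have hle : p * m ≤ X := (Nat.mul_le_mul_left p hm'.2).trans (Nat.mul_div_le X p)
      have hl : Real.log ((p*m : ℕ):ℝ) ^ k ≤ Real.log X ^ k := by
        refine pow_le_pow_left₀ (Real.log_natCast_nonneg _) (Real.log_le_log ?_ (by exact_mod_cast hle)) k
        push_cast; positivity
      have h1 : LA k (p*m) ≤ Real.log X ^ k := (LA_le (mul_ne_zero hp.ne_zero (by omega))).trans hl
      have h2 : 0 ≤ Q m := Finset.sum_nonneg fun i _ => mul_nonneg (by positivity) (LA_nonneg _ _)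
      have hlm : 0 ≤ Real.log m := Real.log_natCast_nonneg m
      have h3 : Q m ≤ Real.log X ^ k := by
        refine le_trans ?_ hl
        push_cast
        rw [Real.log_mul hpp.ne' hmp.ne', add_comm, add_pow, Finset.sum_range_succ]
        have : 0 ≤ Real.log m ^ k * Real.log p ^(k-k) * (k.choose k) := by positivity
        have : Q m ≤ ∑ i ∈ range k, Real.log m ^ i * Real.log p ^ (k-i) * (k.choose i) := by
          refine Finset.sum_le_sum fun i _ => ?_
          have := LA_le (k := i) (show m ≠ 0 by omega)
          calc _ ≤ (k.choose i) * Real.log p ^(k-i) * Real.log m ^ i := by gcongr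
            _ = _ := by ring
        linarith
      have h4 := LA_nonneg k (p*m)
      have : |Q m - LA k (p*m)| ≤ Real.log X ^ k := by rw [abs_le]; constructor <;> linarith
      calc _ ≤ 1 * Real.log X ^ k := mul_le_mul (lam_abs_le m) this (abs_nonneg _) zero_le_one
        _ = _ := one_mul _
    · rw [LA_prime_mul hp (by omega) hd]; simp [hQ]
  refine (Finset.abs_sum_le_sum_abs _ _).trans ((Finset.sum_le_sum e2).trans ?_)
  rw [← Finset.sum_filter, sum_multiples _ _ _ hp.one_lt.le]
  simp only [sum_const, Nat.card_Icc, nsmul_eq_mul, Nat.add_sub_cancel]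
  have := Nat.cast_div_le (α := ℝ) (m := M) (n := p)
  have := Real.log_natCast_nonneg X
  gcongr

/-- facts for large X -/
lemma Wp_facts {η : ℝ} (hη : 0 < η) (hη1 : η ≤ 1/16) (A : ℝ) : ∃ X0 : ℕ, ∀ X : ℕ, X0 ≤ X →
    3 ≤ X ∧ 1 ≤ Real.log X ∧ A ≤ Real.log X ∧ ∀ p ∈ Wp η X, p.Prime ∧ p ≤ X ∧ η * Real.log X ≤ Real.log p ∧
      Real.log p ≤ Real.log X ∧ Real.log X ^ 2 ≤ p ∧ Real.log X ^2 ≤ ((X/p:ℕ):ℝ) ∧ (X:ℝ)/p/2 ≤ ((X/p:ℕ):ℝ) := by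
  have ht : Tendsto (fun N : ℕ => Real.log N) atTop atTop := Real.tendsto_log_atTop.comp tendsto_natCast_atTop_atTop
  have hlo := (isLittleO_log_rpow_atTop (r := η/2) (by positivity)).bound (c := 1) (by norm_num)
  have hlo2 := (tendsto_natCast_atTop_atTop (R := ℝ)).eventually hlo
  obtain ⟨X0, h0⟩ := eventually_atTop.mp ((ht.eventually_ge_atTop (max A 1)).and (hlo2.and (eventually_ge_atTop 4)))
  refine ⟨X0, fun X hX => ?_⟩
  obtain ⟨h1, h2, h3⟩ := h0 X hX
  have h4 : (4:ℝ) ≤ X := by exact_mod_cast h3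
  have hl1 : 1 ≤ Real.log X := (le_max_right _ _).trans h1
  have hl : Real.log X ^ 2 ≤ (X:ℝ)^η := by
    rw [Real.norm_of_nonneg (by linarith), Real.norm_of_nonneg (by positivity), one_mul] at h2
    calc _ ≤ ((X:ℝ)^(η/2))^2 := pow_le_pow_left₀ (by linarith) h2 2
      _ = _ := by rw [← Real.rpow_natCast, ← Real.rpow_mul (by positivity)]; norm_num
  refine ⟨by omega, hl1, (le_max_left _ _).trans h1, fun p hp => ?_⟩
  obtain ⟨a, b, c⟩ := Wp_mem hp
  have hp0 : (0:ℝ) < p := by exact_mod_cast a.pos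
  have hX0 : (0:ℝ) < X := by linarith
  have hpX : (p:ℝ) ≤ X := by
    refine c.trans ?_
    conv_rhs => rw [← Real.rpow_one (X:ℝ)]
    exact Real.rpow_le_rpow_of_exponent_le (by linarith) (by linarith)
  have hbig : 2 * Real.log X^2 ≤ X/p := by
    rw [le_div_iff₀ hp0]
    have e2 : (2:ℝ) ≤ (X:ℝ)^(1/2:ℝ) := by
      rw [← Real.sqrt_eq_rpow]
      exact Real.le_sqrt_of_sq_le (by linarith)
    calc 2 * Real.log X ^2 * p ≤ (X:ℝ)^(1/2:ℝ) * (X:ℝ)^η * (X:ℝ)^(2*η) := by gcongr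
      _ = (X:ℝ)^(1/2 + η + 2*η) := by rw [Real.rpow_add hX0, Real.rpow_add hX0]
      _ ≤ (X:ℝ)^(1:ℝ) := Real.rpow_le_rpow_of_exponent_le (by linarith) (by linarith)
      _ = X := Real.rpow_one _
  have hM : (X:ℝ)/p/2 ≤ ((X/p:ℕ):ℝ) := by
    have := (Nat.lt_floor_add_one ((X:ℝ)/p)).le
    rw [Nat.floor_div_natCast, Nat.floor_natCast] at this
    have : 1 ≤ Real.log X^2 := one_le_pow₀ hl1
    linarith
  refine ⟨a, by exact_mod_cast hpX, ?_, Real.log_le_log hp0 hpX, hl.trans b.le, by linarith, hM⟩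
  rw [← Real.log_rpow hX0]
  exact Real.log_le_log (by positivity) b.le

lemma Br_lower {η : ℝ} (hη : 0 < η) (hη1 : η ≤ 1/16) (K : ℕ) : ∃ X0 : ℕ, ∀ X : ℕ, X0 ≤ X → ∀ p ∈ Wp η X,
    (X:ℝ)/p * (η^(K+1) / 8) * Real.log X^(K+1) ≤ Br (K+2) p X := by
  obtain ⟨M0, hM0⟩ := PsL_one_neg
  choose C hC hPs using PsL_bound
  set D := ∑ j ∈ range K, ((K+2).choose (j+2)) * C (j+2) with hD
  have hD0 : 0 ≤ D := Finset.sum_nonneg fun j _ => mul_nonneg (by positivity) (hC _).le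
  obtain ⟨X0, h0⟩ := Wp_facts hη hη1 (max M0 (4*(D+2)/η^(K+1)))
  refine ⟨X0, fun X hX p hp => ?_⟩
  obtain ⟨hX3, hL1, hLA, h1⟩ := h0 X hX
  obtain ⟨hpp, hpX, hp1, hp2, hp3, hp4, hp5⟩ := h1 p hp
  set L := Real.log X with hL
  set M := X/p with hM
  have hLM := (le_max_left _ _).trans hLA
  have hLD := (le_max_right _ _).trans hLA
  have hLL : L ≤ L^2 := by nlinarith
  have hMM : M0 ≤ M := by
    have : (M0:ℝ) ≤ M := by linarith
    exact_mod_cast this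
  have hM1 : 1 ≤ M := by
    have : (1:ℝ) ≤ M := by linarith
    exact_mod_cast this
  have hp0 : (0:ℝ) < p := by exact_mod_cast hpp.pos
  have hlp : 0 ≤ Real.log p := Real.log_natCast_nonneg p
  have hb := (abs_le.mp (Br_approx (k := K+2) hpp hpX)).1
  rw [← hM, Finset.sum_range_succ', Finset.sum_range_succ'] at hb
  simp only [zero_add, Nat.choose_zero_right, Nat.choose_one_right, PsL_zero hM1, Nat.cast_one, one_mul, mul_one, Nat.sub_zero] at hb
  rw [show K + 2 - 1 = K + 1 by omega] at hb
  have hLK : 0 ≤ L^K := by positivity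
  have t0 : Real.log p ^(K+2) ≤ L^K * M := by
    calc _ ≤ L^(K+2) := pow_le_pow_left₀ hlp hp2 _
      _ = L^K * L^2 := by ring
      _ ≤ _ := by gcongr
  have t1 : ((K+2:ℕ):ℝ) * Real.log p^(K+1) * PsL 1 M ≤ -((η*L)^(K+1) * (M/2)) := by
    have a1 : (η*L)^(K+1) ≤ ((K+2:ℕ):ℝ) * Real.log p^(K+1) := by
      have : (η*L)^(K+1) ≤ Real.log p^(K+1) := pow_le_pow_left₀ (by positivity) hp1 _
      have h2 : (1:ℝ) ≤ ((K+2:ℕ):ℝ) := by push_cast; linarith [(Nat.cast_nonneg K : (0:ℝ) ≤ K)]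
      have h3 : 0 ≤ Real.log p ^(K+1) := by positivity
      nlinarith
    have a2 : (M:ℝ)/2 ≤ - PsL 1 M := by have := hM0 M hMM; linarith
    have := mul_le_mul a1 a2 (by positivity) (by positivity)
    linarith
  have t2 : ∑ j ∈ range K, ((K+2).choose (j+1+1)) * Real.log p^(K+2-(j+1+1)) * PsL (j+1+1) M ≤ D * L^K * M := by
    rw [hD, Finset.sum_mul, Finset.sum_mul]
    refine Finset.sum_le_sum fun j hj => ?_
    have q1 : PsL (j+1+1) M ≤ C (j+2) * M := (le_abs_self _).trans (hPs _ _)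
    have q2 : Real.log p^(K+2-(j+1+1)) ≤ L^K := by
      calc _ ≤ L^(K+2-(j+1+1)) := pow_le_pow_left₀ hlp hp2 _
        _ ≤ L^K := pow_le_pow_right₀ hL1 (by omega)
    have hcc := (hC (j+2)).le
    calc _ ≤ ((K+2).choose (j+1+1)) * Real.log p^(K+2-(j+1+1)) * (C (j+2) * M) := by gcongr
      _ ≤ ((K+2).choose (j+1+1)) * L^K * (C (j+2) * M) := by gcongr
      _ = _ := by ring
  have t3 : (M:ℝ)/p * L^(K+2) ≤ L^K * M := by
    rw [div_mul_eq_mul_div, div_le_iff₀ hp0]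
    calc (M:ℝ) * L^(K+2) = L^K * M * L^2 := by ring
      _ ≤ _ := by gcongr
  have t4 : D + 2 ≤ η^(K+1) * L / 4 := by
    rw [div_le_iff₀ (by positivity)] at hLD
    linarith
  have t5 : (D+2) * (L^K * M) ≤ η^(K+1) * L / 4 * (L^K * M) := by gcongr
  have t6 : (X:ℝ)/p/2 * ((η^(K+1) / 4) * L^(K+1)) ≤ M * ((η^(K+1) / 4) * L^(K+1)) := by gcongr
  rw [mul_pow] at t1
  have e1 : η^(K+1) * L / 4 * (L^K * M) = M * ((η^(K+1) / 4) * L^(K+1)) := by ring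
  have e2 : η^(K+1) * L^(K+1) * (M/2) = 2 * (M * ((η^(K+1) / 4) * L^(K+1))) := by ring
  have e3 : (X:ℝ)/p * (η^(K+1) / 8) * L^(K+1) = (X:ℝ)/p/2 * ((η^(K+1) / 4) * L^(K+1)) := by ring
  rw [e3]
  rw [e1] at t5
  rw [e2] at t1
  nlinarith

lemma Br_lower1 {η : ℝ} (hη : 0 < η) (hη1 : η ≤ 1/16) : ∃ X0 : ℕ, ∀ X : ℕ, X0 ≤ X → ∀ p ∈ Wp η X,
    - (2 * X / Real.log X) * (1 / p) ≤ Br 1 p X := by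
  obtain ⟨X0, h0⟩ := Wp_facts hη hη1 0
  refine ⟨X0, fun X hX p hp => ?_⟩
  obtain ⟨hX3, hL1, _, h1⟩ := h0 X hX
  obtain ⟨hpp, hpX, hp1, hp2, hp3, hp4, hp5⟩ := h1 p hp
  set L := Real.log X with hL
  set M := X/p with hM
  have hM1 : 1 ≤ M := by
    have : (1:ℝ) ≤ M := by nlinarith
    exact_mod_cast this
  have hp0 : (0:ℝ) < p := by exact_mod_cast hpp.pos
  have hb := (abs_le.mp (Br_approx (k := 1) hpp hpX)).1
  rw [← hM] at hb
  simp only [Finset.sum_range_one, Nat.choose_zero_right, PsL_zero hM1, Nat.cast_one, one_mul, mul_one, Nat.sub_zero, pow_one] at hb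
  have hMX : (M:ℝ) ≤ X/p := Nat.cast_div_le
  have t1 : L ≤ M / L := by rw [le_div_iff₀ (by linarith)]; nlinarith
  have t2 : (M:ℝ)/p*L ≤ M/L := by
    rw [le_div_iff₀ (by linarith), mul_assoc, div_mul_eq_mul_div, div_le_iff₀ hp0]
    have : L * L ≤ p := by nlinarith
    gcongr
  have t3 : (M:ℝ)/L ≤ (X/p)/L := by gcongr
  have e : - (2 * X / L) * (1 / p) = - (2 * ((X/p)/L)) := by ring
  rw [e]
  linarith

lemma corr {η : ℝ} (hη : 0 < η) (hη1 : η ≤ 1/16) (k : ℕ) : ∃ c : ℝ, 0 < c ∧ ∃ X0 : ℕ, ∀ X : ℕ, X0 ≤ X →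
    c * X * Real.log X ^ k ≤ ∑ n ∈ Icc 1 X, bX η X n * LA (k+1) n := by
  rcases k with _ | K
  · obtain ⟨C, hC, hu⟩ := Wp_sum_upper hη (by linarith)
    obtain ⟨M0, hM0⟩ := PsL_one_neg
    obtain ⟨X1, hX1⟩ := Br_lower1 hη hη1
    obtain ⟨X2, hX2⟩ := Wp_facts hη hη1 (16*C)
    refine ⟨1/4, by norm_num, max M0 (max X1 X2), fun X hX => ?_⟩
    have g1 : M0 ≤ X := (le_max_left _ _).trans hX
    have g2 : X1 ≤ X := ((le_max_left _ _).trans (le_max_right _ _)).trans hX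
    have g3 : X2 ≤ X := ((le_max_right _ _).trans (le_max_right _ _)).trans hX
    obtain ⟨hX3, hL1, hLA, _⟩ := hX2 X g3
    rw [bX_sum]
    have a1 := hM0 X g1
    have hX3' : (3:ℝ) ≤ X := by exact_mod_cast hX3
    have hL0 : 0 < Real.log X := by linarith
    have a2 : - (2 * X / Real.log X) * (C * (2 * Real.log X)) ≤ ∑ p ∈ Wp η X, Real.log p * Br 1 p X := by
      calc - (2 * X / Real.log X) * (C * (2 * Real.log X)) ≤ - (2 * X / Real.log X) * ∑ p ∈ Wp η X, Real.log p / p := by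
            refine mul_le_mul_of_nonpos_left ?_ ?_
            · refine (hu X (by omega)).trans ?_
              have := el_le_two_log hX3'
              gcongr
            · rw [neg_nonpos]; positivity
        _ = ∑ p ∈ Wp η X, Real.log p * (- (2 * X / Real.log X) * (1 / p)) := by
            rw [Finset.mul_sum]; refine Finset.sum_congr rfl fun p _ => by ring
        _ ≤ _ := Finset.sum_le_sum fun p hp => mul_le_mul_of_nonneg_left (hX1 X g2 p hp) (Real.log_natCast_nonneg p)
    have e : - (2 * X / Real.log X) * (C * (2 * Real.log X)) = -(4 * X * C) := by field_simp; ring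
    rw [e] at a2
    have a3 : -(X/4:ℝ) ≤ (∑ p ∈ Wp η X, Real.log p * Br (0+1) p X) / Real.log X := by
      rw [le_div_iff₀ hL0]
      refine le_trans ?_ a2
      nlinarith
    simp only [pow_zero, zero_add] at *
    linarith
  · obtain ⟨X0, hl⟩ := Wp_sum_lower hη
    obtain ⟨C, hC, hPs⟩ := PsL_bound (K+2)
    obtain ⟨X1, hX1⟩ := Br_lower hη hη1 K
    obtain ⟨X2, hX2⟩ := Wp_facts hη hη1 (C / (η^(K+2)/32))
    refine ⟨η^(K+2)/32, by positivity, max X0 (max X1 X2), fun X hX => ?_⟩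
    have g1 : X0 ≤ X := (le_max_left _ _).trans hX
    have g2 : X1 ≤ X := ((le_max_left _ _).trans (le_max_right _ _)).trans hX
    have g3 : X2 ≤ X := ((le_max_right _ _).trans (le_max_right _ _)).trans hX
    obtain ⟨hX3, hL1, hLA, _⟩ := hX2 X g3
    have hX3' : (3:ℝ) ≤ X := by exact_mod_cast hX3
    have hL0 : 0 < Real.log X := by linarith
    rw [bX_sum]
    have a1 := (abs_le.mp (hPs X)).2
    have a2 : (X * (η^(K+1) / 8) * Real.log X^(K+1)) * (η/2 * Real.log X) ≤ ∑ p ∈ Wp η X, Real.log p * Br (K+1+1) p X := by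
      calc _ ≤ (X * (η^(K+1) / 8) * Real.log X^(K+1)) * ∑ p ∈ Wp η X, Real.log p / p := by
            have := hl X g1
            gcongr
        _ = ∑ p ∈ Wp η X, Real.log p * ((X:ℝ)/p * (η^(K+1) / 8) * Real.log X^(K+1)) := by
            rw [Finset.mul_sum]; refine Finset.sum_congr rfl fun p _ => by ring
        _ ≤ _ := Finset.sum_le_sum fun p hp => mul_le_mul_of_nonneg_left (hX1 X g2 p hp) (Real.log_natCast_nonneg p)
    have a3 : 2 * (η^(K+2)/32 * X * Real.log X^(K+1)) ≤ (∑ p ∈ Wp η X, Real.log p * Br (K+1+1) p X) / Real.log X := by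
      rw [le_div_iff₀ hL0]
      refine le_trans (le_of_eq ?_) a2
      ring
    have a4 : C * X ≤ η^(K+2)/32 * X * Real.log X^(K+1) := by
      rw [div_le_iff₀ (by positivity)] at hLA
      have : Real.log X ≤ Real.log X^(K+1) := by
        calc Real.log X = Real.log X^1 := (pow_one _).symm
          _ ≤ _ := pow_le_pow_right₀ hL1 (by omega)
      calc C * X ≤ (Real.log X * (η^(K+2)/32)) * X := by gcongr
        _ ≤ (Real.log X^(K+1) * (η^(K+2)/32)) * X := by gcongr
        _ = _ := by ring
    rw [show K+1+1 = K+2 from rfl] at *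
    linarith

end

section

lemma SL_sqrt (k : ℕ) {c : ℝ} (hc : 0 < c) : ∃ X0 : ℕ, ∀ X : ℕ, X0 ≤ X →
    SL (k+1) (Nat.sqrt X) ≤ c * X * Real.log X ^ k := by
  obtain ⟨C, hC, h⟩ := SL_bound k
  obtain ⟨m, hm⟩ := exists_nat_ge (C * 2^k / c)
  refine ⟨max (m*m) 3, fun X hX => ?_⟩
  have hX3 : 3 ≤ X := (le_max_right _ _).trans hX
  have hXm : m*m ≤ X := (le_max_left _ _).trans hX
  have hX3' : (3:ℝ) ≤ X := by exact_mod_cast hX3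
  have hms : m ≤ Nat.sqrt X := Nat.le_sqrt.mpr hXm
  have h1 : 1 ≤ Nat.sqrt X := Nat.le_sqrt.mpr (by omega)
  have h1' : (1:ℝ) ≤ Nat.sqrt X := by exact_mod_cast h1
  have hr : ((Nat.sqrt X : ℕ):ℝ) ≤ X := by exact_mod_cast Nat.sqrt_le_self X
  have hss : ((Nat.sqrt X : ℕ):ℝ) * (Nat.sqrt X : ℕ) ≤ X := by exact_mod_cast Nat.sqrt_le X
  have hel : el (Nat.sqrt X) ≤ 2 * Real.log X := (el_mono (by linarith) hr).trans (el_le_two_log hX3')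
  have hel0 := el_one_le h1'
  have hl0 := Real.log_natCast_nonneg X
  have hcm : C * 2^k ≤ c * Nat.sqrt X := by
    rw [div_le_iff₀ hc] at hm
    have : (m:ℝ) ≤ Nat.sqrt X := by exact_mod_cast hms
    nlinarith
  calc _ ≤ C * (Nat.sqrt X) * el (Nat.sqrt X)^k := h _ h1
    _ ≤ C * (Nat.sqrt X) * (2 * Real.log X)^k := by gcongr
    _ = (C * 2^k) * Nat.sqrt X * Real.log X^k := by rw [mul_pow]; ring
    _ ≤ (c * Nat.sqrt X) * Nat.sqrt X * Real.log X^k := by gcongr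
    _ = c * (Nat.sqrt X * Nat.sqrt X) * Real.log X^k := by ring
    _ ≤ _ := by gcongr

noncomputable def BS (η : ℝ) (k X : ℕ) : ℝ := ∑ n ∈ Icc 1 X, bX η X n * LA (k+1) n

lemma exists_plus {η : ℝ} (hη : 0 < η) (hη1 : η ≤ 1/16) (k : ℕ) : ∃ δ : ℝ, 0 < δ ∧ 
   (∀ N0 : ℕ, ∃ X : ℕ, N0 ≤ X ∧ (1+δ) * ((k+1) * X * Real.log X ^ k) ≤ SL (k+1) X + BS η k X - 2 * SL (k+1) (Nat.sqrt X)) ∧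
   (∀ N0 : ℕ, ∃ X : ℕ, N0 ≤ X ∧ SL (k+1) X - BS η k X + 2 * SL (k+1) (Nat.sqrt X) ≤ (1-δ) * ((k+1) * X * Real.log X ^ k)) := by
  obtain ⟨c, hc, X0, h0⟩ := corr hη hη1 k
  obtain ⟨X1, h1⟩ := SL_sqrt k (show 0 < c/8 by positivity)
  have hk : (0:ℝ) < k+1 := by positivity
  set ε := min 1 (c/(4*(k+1))) with hε
  have hε0 : 0 < ε := lt_min one_pos (by positivity)
  have hεk : ε * (k+1) ≤ c/4 := by
    have : ε ≤ c/(4*(k+1)) := min_le_right _ _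
    rw [le_div_iff₀ (by positivity)] at this
    linarith
  refine ⟨c/(4*(k+1)), by positivity, fun N0 => ?_, fun N0 => ?_⟩
  · obtain ⟨X, hX, h⟩ := base_low k hε0 (min_le_left _ _) (max N0 (max X0 X1))
    refine ⟨X, (le_max_left _ _).trans hX, ?_⟩
    have a1 := h0 X (((le_max_left _ _).trans (le_max_right _ _)).trans hX)
    have a2 := h1 X (((le_max_right _ _).trans (le_max_right _ _)).trans hX)
    have hl0 := Real.log_natCast_nonneg X
    have e : (1 + c/(4*(k+1))) * ((k+1) * X * Real.log X ^ k) = (k+1) * (X * Real.log X^k) + c/4 * (X * Real.log X^k) := by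
      field_simp
    rw [e]
    have hT : 0 ≤ X * Real.log X^k := by positivity
    have := mul_le_mul_of_nonneg_right hεk hT
    unfold BS
    nlinarith
  · obtain ⟨X, hX, h⟩ := base_high k hε0 (max N0 (max X0 X1))
    refine ⟨X, (le_max_left _ _).trans hX, ?_⟩
    have a1 := h0 X (((le_max_left _ _).trans (le_max_right _ _)).trans hX)
    have a2 := h1 X (((le_max_right _ _).trans (le_max_right _ _)).trans hX)
    have hl0 := Real.log_natCast_nonneg X
    have e : (1 - c/(4*(k+1))) * ((k+1) * X * Real.log X ^ k) = (k+1) * (X * Real.log X^k) - c/4 * (X * Real.log X^k) := by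
      field_simp
    rw [e]
    have hT : 0 ≤ X * Real.log X^k := by positivity
    have := mul_le_mul_of_nonneg_right hεk hT
    unfold BS
    nlinarith

lemma seq_exists (good : ℕ → ℕ → Prop) (h : ∀ q N0, ∃ X, N0 ≤ X ∧ good q X) :
    ∃ Xs : ℕ → ℕ, (∀ j, 16 ≤ Xs j) ∧ (∀ i j, i < j → Xs i ^ 5 ≤ Xs j) ∧ ∀ q J, ∃ j, J ≤ j ∧ (Nat.unpair j).1 = q ∧ good q (Xs j) := by
  choose f hf hg using h
  let Xs : ℕ → ℕ := fun j => Nat.rec (f (Nat.unpair 0).1 16) (fun j prev => f (Nat.unpair (j+1)).1 (prev^5)) j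
  have hs : ∀ j, Xs (j+1) = f (Nat.unpair (j+1)).1 (Xs j^5) := fun j => rfl
  have hz : Xs 0 = f (Nat.unpair 0).1 16 := rfl
  have h5 : ∀ j, Xs j ^5 ≤ Xs (j+1) := fun j => by rw [hs]; exact hf _ _
  have h16 : ∀ j, 16 ≤ Xs j := by
    intro j
    induction j with
    | zero => rw [hz]; exact hf _ _
    | succ j ih => exact ih.trans ((Nat.le_self_pow (by norm_num) _).trans (h5 j))
  have hgood : ∀ j, good (Nat.unpair j).1 (Xs j) := by
    intro j
    cases j with
    | zero => rw [hz]; exact hg _ _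
    | succ j => rw [hs]; exact hg _ _
  refine ⟨Xs, h16, ?_, fun q J => ⟨Nat.pair q J, Nat.right_le_pair q J, by simp, ?_⟩⟩
  · intro i j hij
    induction j, hij using Nat.le_induction with
    | base => exact h5 i
    | succ j _ ih => exact ih.trans ((Nat.le_self_pow (by norm_num) _).trans (h5 j))
  · have := hgood (Nat.pair q J)
    simpa using this

open Classical in
noncomputable def aseq (η : ℝ) (Xs : ℕ → ℕ) (s : ℕ → ℝ) (n : ℕ) : ℝ :=
  if h : ∃ j, n ≤ Xs j ∧ Xs j < n^2 then 1 + s h.choose * bX η (Xs h.choose) n else 1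

section
variable {η : ℝ} {Xs : ℕ → ℕ} {s : ℕ → ℝ}

lemma Xs_unique (h16 : ∀ j, 16 ≤ Xs j) (h5 : ∀ i j, i < j → Xs i ^ 5 ≤ Xs j) {n i j : ℕ}
    (hi : n ≤ Xs i ∧ Xs i < n^2) (hj : n ≤ Xs j ∧ Xs j < n^2) : i = j := by
  have key : ∀ i j, n ≤ Xs i ∧ Xs i < n^2 → n ≤ Xs j ∧ Xs j < n^2 → ¬ i < j := by
    intro i j hi hj hij
    have h1 := h5 i j hij
    have h2 : n^2 ≤ Xs i ^2 := Nat.pow_le_pow_left hi.1 2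
    have h3 : Xs i^2 ≤ Xs i^5 := Nat.pow_le_pow_right (by have := h16 i; omega) (by norm_num)
    omega
  rcases lt_trichotomy i j with h | h | h
  · exact absurd h (key i j hi hj)
  · exact h
  · exact absurd h (key j i hj hi)

lemma aseq_eq (h16 : ∀ j, 16 ≤ Xs j) (h5 : ∀ i j, i < j → Xs i ^ 5 ≤ Xs j) {n j : ℕ}
    (hj : n ≤ Xs j ∧ Xs j < n^2) : aseq η Xs s n = 1 + s j * bX η (Xs j) n := by
  have h : ∃ j, n ≤ Xs j ∧ Xs j < n^2 := ⟨j, hj⟩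
  unfold aseq
  rw [dif_pos h, Xs_unique h16 h5 h.choose_spec hj]

lemma aseq_eq_one {n : ℕ} (h : ¬ ∃ j, n ≤ Xs j ∧ Xs j < n^2) : aseq η Xs s n = 1 := by
  unfold aseq; rw [dif_neg h]

lemma aseq_abs (hs : ∀ j, |s j| ≤ 1) (n : ℕ) : |aseq η Xs s n - 1| ≤ 1 := by
  by_cases h : ∃ j, n ≤ Xs j ∧ Xs j < n^2
  · unfold aseq
    rw [dif_pos h]
    have hc := h.choose_spec
    rw [add_sub_cancel_left, abs_mul]
    have hn : 1 ≤ n := by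
      rcases Nat.eq_zero_or_pos n with h0 | h0
      · exfalso
        have h2 := hc.2
        have h3 : n^2 = 0 := by simp [h0]
        omega
      · exact h0
    exact mul_le_one₀ (hs _) (abs_nonneg _) (bX_abs η _ n hn hc.1)
  · rw [aseq_eq_one h]; simp

lemma aseq_sum (h16 : ∀ j, 16 ≤ Xs j) (h5 : ∀ i j, i < j → Xs i ^ 5 ≤ Xs j) (hs : ∀ j, |s j| ≤ 1) (k j : ℕ) :
    |∑ n ∈ Icc 1 (Xs j), aseq η Xs s n * LA (k+1) n - (SL (k+1) (Xs j) + s j * BS η k (Xs j))| ≤ 2 * SL (k+1) (Nat.sqrt (Xs j)) := by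
  have e : ∑ n ∈ Icc 1 (Xs j), aseq η Xs s n * LA (k+1) n - (SL (k+1) (Xs j) + s j * BS η k (Xs j)) =
      ∑ n ∈ Icc 1 (Xs j), (aseq η Xs s n - (1 + s j * bX η (Xs j) n)) * LA (k+1) n := by
    unfold SL BS
    rw [Finset.mul_sum, ← Finset.sum_add_distrib, ← Finset.sum_sub_distrib]
    refine Finset.sum_congr rfl fun n _ => by ring
  rw [e]
  have hle : Nat.sqrt (Xs j) ≤ Xs j := Nat.sqrt_le_self _
  calc _ ≤ ∑ n ∈ Icc 1 (Xs j), if n ∈ Icc 1 (Nat.sqrt (Xs j)) then 2 * LA (k+1) n else 0 := by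
        refine (Finset.abs_sum_le_sum_abs _ _).trans (Finset.sum_le_sum fun n hn => ?_)
        have hn' := Finset.mem_Icc.mp hn
        rw [abs_mul, abs_of_nonneg (LA_nonneg _ _)]
        split_ifs with hc
        · refine mul_le_mul_of_nonneg_right ?_ (LA_nonneg _ _)
          have a1 := aseq_abs (η := η) (Xs := Xs) hs n
          have a2 : |s j * bX η (Xs j) n| ≤ 1 := by
            rw [abs_mul]; exact mul_le_one₀ (hs j) (abs_nonneg _) (bX_abs η _ n hn'.1 hn'.2)
          rw [abs_le] at a1 a2 ⊢
          constructor <;> linarith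
        · have h2 : Xs j < n^2 := by
            rw [← Nat.sqrt_lt']
            by_contra hcon
            exact hc (Finset.mem_Icc.mpr ⟨hn'.1, by omega⟩)
          rw [aseq_eq h16 h5 ⟨hn'.2, h2⟩]; simp
    _ = _ := by
      rw [← Finset.sum_filter]
      unfold SL
      rw [Finset.mul_sum]
      refine Finset.sum_congr ?_ fun _ _ => rfl
      ext n
      simp only [Finset.mem_filter, Finset.mem_Icc]
      omega
end

end

section

noncomputable def Ls (M : ℕ) : ℝ := ∑ n ∈ Icc 1 M, lam n

lemma Ls_mult (M e : ℕ) (he : 1 ≤ e) : ∑ n ∈ (Icc 1 M).filter (fun n => e ∣ n), lam n = lam e * Ls (M/e) := by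
  rw [sum_multiples _ _ _ he, Ls, Finset.mul_sum]
  exact Finset.sum_congr rfl fun m _ => lam_mul _ _

noncomputable def Fs (η : ℝ) (X d M : ℕ) : ℝ := ∑ n ∈ (Icc 1 M).filter (fun n => d ∣ n), bX η X n

lemma Fs_eq (η : ℝ) (X d M : ℕ) (hd : 1 ≤ d) : Fs η X d M = - (lam d * Ls (M/d)) +
    (∑ p ∈ Wp η X, Real.log p * (lam (Nat.lcm d p) * Ls (M / Nat.lcm d p))) / Real.log X := by
  have e1 : ∀ n, bX η X n = - lam n +
      (∑ p ∈ Wp η X, if p ∣ n then Real.log p * lam n else 0) / Real.log X := by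
    intro n
    rw [← Finset.sum_filter, ← Finset.sum_mul]
    unfold bX cW; ring
  unfold Fs
  simp only [e1]
  rw [Finset.sum_add_distrib, Finset.sum_neg_distrib, ← Finset.sum_div, Finset.sum_comm, Ls_mult _ _ hd]
  congr 2
  refine Finset.sum_congr rfl fun p hp => ?_
  have hpp := (Wp_mem hp).1
  rw [← Ls_mult _ _ (Nat.lcm_pos hd hpp.pos), ← Finset.sum_filter, Finset.filter_filter, Finset.mul_sum]
  refine Finset.sum_congr ?_ fun _ _ => rfl
  ext n
  simp only [Finset.mem_filter, Nat.lcm_dvd_iff]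

lemma Ls_bound (B : ℕ) {κ : ℝ} (hκ : 0 < κ) (hκ1 : κ ≤ 1/4) : ∃ C : ℝ, 0 < C ∧ ∀ y : ℝ, 2 ≤ y → ∀ M e : ℕ, ∀ α : ℝ, 1 ≤ e →
    (M:ℝ) ≤ y → y^(α+κ) ≤ 2 * M → (e:ℝ) ≤ y^α → |Ls (M/e)| ≤ C * y / el y ^ B * (1 / e) := by
  obtain ⟨C, hC, h⟩ := thmA 0 B
  refine ⟨C / κ^B, by positivity, fun y hy M e α he hM hM2 hey => ?_⟩
  have hy0 : 0 < y := by linarith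
  have he0 : (0:ℝ) < e := by exact_mod_cast he
  have hel := el_one_le (x := y) (by linarith)
  have hM0 : (0:ℝ) < M := by
    have : 0 < y^(α+κ) := Real.rpow_pos_of_pos hy0 _
    linarith
  by_cases h1 : (1:ℝ) ≤ M/e
  · have h2 := h (M/e) h1
    rw [Nat.floor_div_natCast, Nat.floor_natCast] at h2
    simp only [pow_zero, one_mul] at h2
    have hk : κ * el y ≤ el (M/e) := by
      unfold el
      rw [Real.log_div hM0.ne' he0.ne']
      have a1 : Real.log e ≤ α * Real.log y := by
        rw [← Real.log_rpow hy0]; exact Real.log_le_log he0 hey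
      have a2 : (α+κ) * Real.log y ≤ Real.log 2 + Real.log M := by
        rw [← Real.log_rpow hy0, ← Real.log_mul (by norm_num) hM0.ne']
        exact Real.log_le_log (Real.rpow_pos_of_pos hy0 _) hM2
      have := Real.log_two_lt_d9
      linarith
    calc |Ls (M/e)| ≤ C * (M/e) / el (M/e)^B := h2
      _ ≤ C * (y/e) / (κ * el y)^B := by gcongr
      _ = _ := by rw [mul_pow]; field_simp
  · have : M/e = 0 := by
      rw [Nat.div_eq_zero_iff]
      right
      rw [not_le, div_lt_one he0] at h1
      exact_mod_cast h1
    rw [this]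
    have : |Ls 0| = 0 := by simp [Ls]
    rw [this]; positivity

lemma Fs_bound {ν : ℝ} (hν0 : 0 < ν) (hν1 : ν < 1) (B : ℕ) : ∃ C : ℝ, 0 < C ∧ ∀ y : ℝ, 2 ≤ y → ∀ X M d : ℕ, 3 ≤ X →
    (d:ℝ) ≤ y^ν → d ≤ X → (X:ℝ) ≤ y^2 → 1 ≤ d → (M:ℝ) ≤ y → y^((1+ν)/2) ≤ 2 * M →
    |Fs ((1-ν)/16) X d M| ≤ C * y / el y ^ B * (1 / d) := by
  set η := (1-ν)/16 with hη
  have hη0 : 0 < η := by rw [hη]; linarith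
  obtain ⟨C, hC, h⟩ := Ls_bound B (κ := (1-ν)/4) (by linarith) (by linarith)
  obtain ⟨C2, hC2, hu⟩ := Wp_sum_upper hη0 (by rw [hη]; linarith)
  refine ⟨C * (2 + 2 * C2), by positivity, fun y hy X M d hX3 hdy hdX hXy hd hM hM2 => ?_⟩
  have hy0 : 0 < y := by linarith
  have hd0 : (0:ℝ) < d := by exact_mod_cast hd
  have hX3' : (3:ℝ) ≤ X := by exact_mod_cast hX3
  have hel := el_one_le (x := y) (by linarith)
  have hL0 : 0 < Real.log X := Real.log_pos (by linarith)
  set α := ν + 4*η with hα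
  have hακ : α + (1-ν)/4 = (1+ν)/2 := by rw [hα, hη]; ring
  rw [← hακ] at hM2
  have hdα : (d:ℝ) ≤ y^α := hdy.trans (Real.rpow_le_rpow_of_exponent_le (by linarith) (by linarith))
  set Y := C * y / el y ^ B with hY
  have hY0 : 0 ≤ Y := by positivity
  have t1 := h y hy M d α hd hM hM2 hdα
  rw [← hY] at t1
  have t2 : ∀ p ∈ Wp η X, |Real.log p * (lam (Nat.lcm d p) * Ls (M / Nat.lcm d p))| ≤
      Real.log p * (Y * (1 / d * (1/p + if p ∣ d then 1 else 0))) := by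
    intro p hp
    obtain ⟨hpp, _, hp2⟩ := Wp_mem hp
    have hp0 : (0:ℝ) < p := by exact_mod_cast hpp.pos
    have hl0 : 0 < Nat.lcm d p := Nat.lcm_pos hd hpp.pos
    have hle : ((Nat.lcm d p : ℕ):ℝ) ≤ y^α := by
      have : Nat.lcm d p ≤ d * p := Nat.le_of_dvd (Nat.mul_pos hd hpp.pos) (Nat.lcm_dvd_mul d p)
      have : ((Nat.lcm d p : ℕ):ℝ) ≤ d * p := by exact_mod_cast this
      have hp3 : (p:ℝ) ≤ y^(4*η) := by
        refine hp2.trans ?_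
        calc (X:ℝ)^(2*η) ≤ (y^2)^(2*η) := Real.rpow_le_rpow (by positivity) hXy (by linarith)
          _ = y^(4*η) := by rw [← Real.rpow_natCast, ← Real.rpow_mul hy0.le]; congr 1; push_cast; ring
      calc _ ≤ (d:ℝ) * p := this
        _ ≤ y^ν * y^(4*η) := by gcongr
        _ = y^α := by rw [hα, Real.rpow_add hy0]
    have t := h y hy M _ α hl0 hM hM2 hle
    rw [← hY] at t
    have hlp := Real.log_natCast_nonneg p
    rw [abs_mul, abs_of_nonneg hlp, abs_mul]
    refine mul_le_mul_of_nonneg_left ?_ hlp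
    have t3 : |lam (Nat.lcm d p)| * |Ls (M / Nat.lcm d p)| ≤ Y * (1 / (Nat.lcm d p : ℕ)) := by
      calc _ ≤ 1 * (Y * (1 / (Nat.lcm d p : ℕ))) := mul_le_mul (lam_abs_le _) t (abs_nonneg _) zero_le_one
        _ = _ := one_mul _
    refine t3.trans (mul_le_mul_of_nonneg_left ?_ hY0)
    split_ifs with hpd
    · rw [Nat.lcm_eq_left hpd]
      have : 0 ≤ 1/(d:ℝ) * (1/p) := by positivity
      linarith
    · rw [Nat.Coprime.lcm_eq_mul ((Nat.Prime.coprime_iff_not_dvd hpp).mpr hpd).symm]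
      push_cast
      rw [add_zero, one_div_mul_one_div]
  rw [Fs_eq _ _ _ _ hd]
  have t4 : |∑ p ∈ Wp η X, Real.log p * (lam (Nat.lcm d p) * Ls (M / Nat.lcm d p))| ≤ Y * (1/d) * (2 * C2 * Real.log X + Real.log X) := by
    refine (Finset.abs_sum_le_sum_abs _ _).trans ((Finset.sum_le_sum t2).trans ?_)
    have e : ∑ p ∈ Wp η X, Real.log p * (Y * (1 / d * (1/p + if p ∣ d then 1 else 0))) =
        Y * (1/d) * (∑ p ∈ Wp η X, Real.log p / p + ∑ p ∈ (Wp η X).filter (fun p => p ∣ d), Real.log p) := by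
      rw [Finset.sum_filter, ← Finset.sum_add_distrib, Finset.mul_sum]
      refine Finset.sum_congr rfl fun p _ => ?_
      split_ifs <;> ring
    rw [e]
    refine mul_le_mul_of_nonneg_left (add_le_add ?_ ?_) (by positivity)
    · refine (hu X (by omega)).trans ?_
      have := el_le_two_log hX3'
      nlinarith
    · have := cW_le_one η X d hd hdX
      unfold cW at this
      rwa [div_le_one hL0] at this
  have t5 : |(∑ p ∈ Wp η X, Real.log p * (lam (Nat.lcm d p) * Ls (M / Nat.lcm d p))) / Real.log X| ≤ Y * (1/d) * (2 * C2 + 1) := by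
    rw [abs_div, abs_of_pos hL0, div_le_iff₀ hL0]
    refine t4.trans (le_of_eq ?_); ring
  have t6 : |-(lam d * Ls (M/d))| ≤ Y * (1/d) := by
    rw [abs_neg, abs_mul]
    calc _ ≤ 1 * (Y * (1/d)) := mul_le_mul (lam_abs_le _) t1 (abs_nonneg _) zero_le_one
      _ = _ := one_mul _
  refine (abs_add_le _ _).trans ((add_le_add t6 t5).trans (le_of_eq ?_))
  rw [hY]; ring

end

section

lemma sum_inv_le (D : ℕ) (hD : 1 ≤ D) : ∑ d ∈ Icc 1 D, (1:ℝ)/d ≤ el D := by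
  have h := harmonic_le_one_add_log D
  rw [harmonic_eq_sum_Icc] at h
  push_cast at h
  simpa [el, one_div] using h

lemma Rd_bound {ν : ℝ} (hν0 : 0 < ν) (hν1 : ν < 1) (B : ℕ) : ∃ C : ℝ, 0 < C ∧
    ∀ (Xs : ℕ → ℕ) (s : ℕ → ℝ) (_ : ∀ j, 16 ≤ Xs j) (_ : ∀ i j, i < j → Xs i ^ 5 ≤ Xs j) (_ : ∀ j, |s j| ≤ 1),
    ∀ y : ℝ, 2 ≤ y → ∀ d : ℕ, 1 ≤ d → (d:ℝ) ≤ y^ν →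
    |(∑ n ∈ (Finset.Icc 1 ⌊y⌋₊).filter (fun n => d ∣ n), aseq ((1-ν)/16) Xs s n) - y / d| ≤
      1 + (y^((1+ν)/2) + C * y / el y ^ B) * (1/d) := by
  obtain ⟨C, hC, hF⟩ := Fs_bound hν0 hν1 B
  refine ⟨2*C, by positivity, fun Xs s h16 h5 hs y hy d hd hdy => ?_⟩
  set η := (1-ν)/16 with hη
  set N := ⌊y⌋₊ with hN
  set v := y^((1+ν)/2) with hv
  set Nv := ⌊v⌋₊ with hNv
  have hy0 : 0 < y := by linarith
  have hd0 : (0:ℝ) < d := by exact_mod_cast hd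
  have hel := el_one_le (x := y) (by linarith)
  have hv1 : 1 ≤ v := Real.one_le_rpow (by linarith) (by linarith)
  have hvy : v ≤ y := by
    rw [hv]; conv_rhs => rw [← Real.rpow_one y]
    exact Real.rpow_le_rpow_of_exponent_le (by linarith) (by linarith)
  have hNvN : Nv ≤ N := Nat.floor_le_floor hvy
  have hNv1 : 1 ≤ Nv := Nat.le_floor (by simpa using hv1)
  have hNvv : (Nv:ℝ) ≤ v := Nat.floor_le (by linarith)
  have hNv2 : v ≤ 2 * Nv := by
    have := (Nat.lt_floor_add_one v).le
    have h1 : (1:ℝ) ≤ Nv := by exact_mod_cast hNv1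
    rw [← hNv] at this
    linarith
  have hNy : (N:ℝ) ≤ y := Nat.floor_le hy0.le
  have hdv : (d:ℝ) ≤ v := hdy.trans (Real.rpow_le_rpow_of_exponent_le (by linarith) (by linarith))
  set f : ℕ → ℝ := fun n => aseq η Xs s n - 1 with hf
  have split : ∑ n ∈ (Icc 1 N).filter (fun n => d ∣ n), aseq η Xs s n = ((N/d : ℕ):ℝ) +
      (∑ n ∈ (Icc 1 Nv).filter (fun n => d ∣ n), f n + ∑ n ∈ (Ioc Nv N).filter (fun n => d ∣ n), f n) := by
    have e1 : ∑ n ∈ (Icc 1 N).filter (fun n => d ∣ n), (1:ℝ) = ((N/d : ℕ):ℝ) := by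
      rw [sum_multiples _ _ _ hd]; simp
    have e2 : ∑ n ∈ (Icc 1 N).filter (fun n => d ∣ n), f n = ∑ n ∈ (Icc 1 Nv).filter (fun n => d ∣ n), f n + ∑ n ∈ (Ioc Nv N).filter (fun n => d ∣ n), f n := by
      simp only [Finset.sum_filter]
      exact (Finset.sum_Ioc_consecutive (fun n => if d ∣ n then f n else 0) (Nat.zero_le Nv) hNvN).symm
    rw [← e2, ← e1, ← Finset.sum_add_distrib]
    refine Finset.sum_congr rfl fun n _ => by simp [hf]
  have t0 : |((N/d : ℕ):ℝ) - y/d| ≤ 1 := by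
    have a1 := (Nat.lt_floor_add_one (y/d)).le
    have a2 := Nat.floor_le (show 0 ≤ y/d by positivity)
    rw [Nat.floor_div_natCast, ← hN] at a1 a2
    rw [abs_le]; constructor <;> linarith
  have t1 : |∑ n ∈ (Icc 1 Nv).filter (fun n => d ∣ n), f n| ≤ v * (1/d) := by
    calc _ ≤ ∑ n ∈ (Icc 1 Nv).filter (fun n => d ∣ n), (1:ℝ) :=
          (Finset.abs_sum_le_sum_abs _ _).trans (Finset.sum_le_sum fun n _ => aseq_abs hs n)
      _ = ((Nv/d : ℕ):ℝ) := by rw [sum_multiples _ _ _ hd]; simp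
      _ ≤ (Nv:ℝ)/d := Nat.cast_div_le
      _ ≤ v/d := by gcongr
      _ = _ := by ring
  have hsq : ∀ n ∈ Ioc Nv N, ∀ i, n ≤ Xs i → Xs i < n^2 → v < Xs i ∧ (Xs i:ℝ) < y^2 := by
    intro n hn i h1 h2
    have hn' := Finset.mem_Ioc.mp hn
    have hvn : v < n := Nat.lt_of_floor_lt hn'.1
    have hny : (n:ℝ) ≤ y := le_trans (by exact_mod_cast hn'.2) hNy
    have h1' : (n:ℝ) ≤ Xs i := by exact_mod_cast h1
    have h2' : (Xs i:ℝ) < (n:ℝ)^2 := by exact_mod_cast h2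
    exact ⟨by linarith, h2'.trans_le (pow_le_pow_left₀ (by positivity) hny 2)⟩
  have huniq0 : ∀ i j, (v < Xs i ∧ (Xs i:ℝ) < y^2) → (v < Xs j ∧ (Xs j:ℝ) < y^2) → ¬ i < j := by
    intro i j hi hj hij
    have h1 : ((Xs i:ℝ))^5 ≤ Xs j := by exact_mod_cast h5 i j hij
    have h2 : v^5 ≤ (Xs i:ℝ)^5 := pow_le_pow_left₀ (by linarith) hi.1.le 5
    have h3 : y^2 ≤ v^5 := by
      rw [hv, ← Real.rpow_natCast, ← Real.rpow_natCast, ← Real.rpow_mul hy0.le]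
      refine Real.rpow_le_rpow_of_exponent_le (by linarith) ?_
      push_cast; linarith
    linarith [hj.2]
  have t2 : |∑ n ∈ (Ioc Nv N).filter (fun n => d ∣ n), f n| ≤ 2*C * y / el y ^ B * (1/d) := by
    have hpos : 0 ≤ 2*C * y / el y ^ B * (1/d) := by positivity
    by_cases hex : ∃ j, v < Xs j ∧ (Xs j:ℝ) < y^2
    · obtain ⟨j, hj⟩ := hex
      set X := Xs j with hX
      have hfn : ∀ n ∈ Ioc Nv N, f n = if n ≤ X ∧ X < n^2 then s j * bX η X n else 0 := by
        intro n hn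
        simp only [hf]
        split_ifs with hc
        · rw [aseq_eq h16 h5 hc, add_sub_cancel_left]
        · rw [aseq_eq_one, sub_self]
          rintro ⟨i, hi1, hi2⟩
          have hi := hsq n hn i hi1 hi2
          rcases lt_trichotomy i j with h | h | h
          · exact huniq0 i j hi hj h
          · rw [h] at hi1 hi2; exact hc ⟨hi1, hi2⟩
          · exact huniq0 j i hj hi h
      have e1 : ∑ n ∈ (Ioc Nv N).filter (fun n => d ∣ n), f n =
          s j * ∑ n ∈ (Ioc (max Nv (Nat.sqrt X)) (min N X)).filter (fun n => d ∣ n), bX η X n := by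
        rw [Finset.mul_sum]
        calc _ = ∑ n ∈ (Ioc Nv N).filter (fun n => d ∣ n), if n ≤ X ∧ X < n^2 then s j * bX η X n else 0 :=
              Finset.sum_congr rfl fun n hn => hfn n (Finset.mem_filter.mp hn).1
          _ = _ := by
            rw [← Finset.sum_filter, Finset.filter_filter]
            refine Finset.sum_congr ?_ fun _ _ => rfl
            ext n
            simp only [Finset.mem_filter, Finset.mem_Ioc, ← Nat.sqrt_lt', max_lt_iff, le_min_iff]
            tauto
      rw [e1, abs_mul]
      by_cases hlt : max Nv (Nat.sqrt X) ≤ min N X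
      · set N0 := max Nv (Nat.sqrt X)
        set N1 := min N X
        have e2 : ∑ n ∈ (Ioc N0 N1).filter (fun n => d ∣ n), bX η X n = Fs η X d N1 - Fs η X d N0 := by
          unfold Fs
          simp only [Finset.sum_filter]
          have := Finset.sum_Ioc_consecutive (fun n => if d ∣ n then bX η X n else 0) (Nat.zero_le N0) hlt
          rw [show Icc 1 N1 = Ioc 0 N1 from rfl, show Icc 1 N0 = Ioc 0 N0 from rfl, ← this]
          ring
        have hN1y : (N1:ℝ) ≤ y := le_trans (by exact_mod_cast min_le_left _ _) hNy
        have hN0y : (N0:ℝ) ≤ y := le_trans (by exact_mod_cast hlt) hN1y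
        have hN0v : v ≤ 2 * N0 := by
          have : (Nv:ℝ) ≤ N0 := by exact_mod_cast le_max_left _ _
          linarith
        have hN1v : v ≤ 2 * N1 := by
          have : (N0:ℝ) ≤ N1 := by exact_mod_cast hlt
          linarith
        have hdX : d ≤ X := by
          have : (d:ℝ) ≤ X := by linarith [hj.1]
          exact_mod_cast this
        have hX3 : 3 ≤ X := by have := h16 j; omega
        have b1 := hF y hy X N1 d hX3 hdy hdX hj.2.le hd hN1y hN1v
        have b0 := hF y hy X N0 d hX3 hdy hdX hj.2.le hd hN0y hN0v
        rw [e2]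
        calc _ ≤ 1 * |Fs η X d N1 - Fs η X d N0| := mul_le_mul_of_nonneg_right (hs j) (abs_nonneg _)
          _ ≤ |Fs η X d N1| + |Fs η X d N0| := by rw [one_mul]; exact abs_sub _ _
          _ ≤ _ := add_le_add b1 b0
          _ = _ := by ring
      · rw [Finset.Ioc_eq_empty (by omega)]
        simpa using hpos
    · have : ∑ n ∈ (Ioc Nv N).filter (fun n => d ∣ n), f n = 0 := by
        refine Finset.sum_eq_zero fun n hn => ?_
        simp only [hf]
        rw [aseq_eq_one, sub_self]
        rintro ⟨i, hi1, hi2⟩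
        exact hex ⟨i, hsq n (Finset.mem_filter.mp hn).1 i hi1 hi2⟩
      rw [this, abs_zero]; exact hpos
  rw [split]
  have e : ∀ a b c e : ℝ, a + (b + c) - e = (a - e) + b + c := fun a b c e => by ring
  rw [e]
  refine (abs_add_three _ _ _).trans ?_
  have e3 : 1 + (v + 2*C * y / el y ^ B) * (1/d) = 1 + v * (1/d) + 2*C * y / el y ^ B * (1/d) := by ring
  rw [e3]
  exact add_le_add (add_le_add t0 t1) t2

lemma Rcond_aseq {ν : ℝ} (hν0 : 0 < ν) (hν1 : ν < 1) {Xs : ℕ → ℕ} {s : ℕ → ℝ} (h16 : ∀ j, 16 ≤ Xs j)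
    (h5 : ∀ i j, i < j → Xs i ^ 5 ≤ Xs j) (hs : ∀ j, |s j| ≤ 1) : Rcond ν (aseq ((1-ν)/16) Xs s) := by
  intro B hB
  set b := ⌈B⌉₊ with hb
  obtain ⟨C, hC, h⟩ := Rd_bound hν0 hν1 (b+1)
  obtain ⟨C3, hC3, h3⟩ := el_pow_le_rpow (ε := (1-ν)/2) (by linarith) (b+1)
  refine ⟨2*C3 + C, fun y hy => ?_⟩
  have hy0 : 0 < y := by linarith
  have hel := el_one_le (x := y) (by linarith)
  have hel0 : 0 < el y := by linarith
  set D := ⌊y^ν⌋₊ with hD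
  have hyν1 : 1 ≤ y^ν := Real.one_le_rpow (by linarith) hν0.le
  have hD1 : 1 ≤ D := Nat.le_floor (by simpa using hyν1)
  have hDy : (D:ℝ) ≤ y^ν := Nat.floor_le (by linarith)
  set v := y^((1+ν)/2) with hv
  have hv0 : 0 < v := Real.rpow_pos_of_pos hy0 _
  have hνv : y^ν ≤ v := Real.rpow_le_rpow_of_exponent_le (by linarith) (by linarith)
  have hyν : y^ν ≤ y := by
    conv_rhs => rw [← Real.rpow_one y]
    exact Real.rpow_le_rpow_of_exponent_le (by linarith) hν1.le
  have hinv : ∑ d ∈ Icc 1 D, (1:ℝ)/d ≤ el y := by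
    refine (sum_inv_le D hD1).trans (el_mono (by exact_mod_cast hD1) (hDy.trans hyν))
  have hvC : v * el y ≤ C3 * y / el y ^ b := by
    rw [le_div_iff₀ (by positivity)]
    have := h3 y (by linarith)
    calc v * el y * el y ^ b = v * el y^(b+1) := by ring
      _ ≤ v * (C3 * y^((1-ν)/2)) := by gcongr
      _ = C3 * (v * y^((1-ν)/2)) := by ring
      _ = C3 * y := by
        rw [hv, ← Real.rpow_add hy0, show (1+ν)/2 + (1-ν)/2 = 1 by ring, Real.rpow_one]
  have hfin : 1 / el y ^ b ≤ Real.log y ^ (-B) := by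
    have hl : 0 < Real.log y := Real.log_pos (by linarith)
    rw [Real.rpow_neg hl.le, one_div]
    refine inv_anti₀ (Real.rpow_pos_of_pos hl _) ?_
    calc Real.log y ^ B ≤ el y ^ B := Real.rpow_le_rpow hl.le (by unfold el; linarith) hB.le
      _ ≤ el y ^ (b:ℝ) := Real.rpow_le_rpow_of_exponent_le hel (Nat.le_ceil B)
      _ = _ := Real.rpow_natCast _ _
  calc _ ≤ ∑ d ∈ Icc 1 D, (1 + (v + C * y / el y ^ (b+1)) * (1/d)) := by
        refine Finset.sum_le_sum fun d hd => ?_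
        have hd' := Finset.mem_Icc.mp hd
        exact h Xs s h16 h5 hs y hy d hd'.1 (le_trans (by exact_mod_cast hd'.2) hDy)
    _ = D + (v + C * y / el y ^ (b+1)) * ∑ d ∈ Icc 1 D, (1:ℝ)/d := by
        rw [Finset.sum_add_distrib, ← Finset.mul_sum]; simp
    _ ≤ v * el y + (v + C * y / el y ^ (b+1)) * el y := by
        refine add_le_add ?_ (mul_le_mul_of_nonneg_left hinv (by positivity))
        have : v ≤ v * el y := le_mul_of_one_le_right hv0.le hel
        linarith
    _ = 2 * (v * el y) + C * y / el y ^ b := by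
        have : C * y / el y ^ (b+1) * el y = C * y / el y ^ b := by rw [pow_succ]; field_simp
        rw [add_mul, this]; ring
    _ ≤ 2 * (C3 * y / el y ^ b) + C * y / el y ^ b := by linarith
    _ = (2*C3 + C) * y * (1 / el y ^ b) := by ring
    _ ≤ _ := by gcongr

end

section

lemma ssum_nat (a : ℕ → ℝ) (k X : ℕ) : Ssum a k (X:ℝ) = ∑ n ∈ Icc 1 X, a n * LA k n := by
  unfold Ssum
  rw [Nat.floor_natCast]
  exact Finset.sum_congr rfl fun n _ => by rw [LA_apply]

lemma tquot_bdd (a : ℕ → ℝ) (ha : ∀ n, 0 ≤ a n ∧ a n ≤ 2) (K : ℕ) :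
    ∃ M : ℝ, ∀ x : ℝ, 3 ≤ x → 0 ≤ Tquot a (K+1) x ∧ Tquot a (K+1) x ≤ M := by
  obtain ⟨C, hC, hb⟩ := SL_bound K
  refine ⟨2 * C * 2^K, fun x hx => ?_⟩
  have hlog : 0 < Real.log x := Real.log_pos (by linarith)
  have hf : 1 ≤ ⌊x⌋₊ := Nat.le_floor (by push_cast; linarith)
  have hS0 : 0 ≤ Ssum a (K+1) x := by
    unfold Ssum
    refine Finset.sum_nonneg fun n _ => mul_nonneg (ha n).1 ?_
    rw [← LA_apply]; exact LA_nonneg _ _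
  have hfx : (⌊x⌋₊:ℝ) ≤ x := Nat.floor_le (by linarith)
  have hf1 : (1:ℝ) ≤ (⌊x⌋₊:ℝ) := by exact_mod_cast hf
  have hS : Ssum a (K+1) x ≤ 2 * C * 2^K * (x * Real.log x ^ K) := by
    calc Ssum a (K+1) x ≤ 2 * SL (K+1) ⌊x⌋₊ := by
          unfold Ssum SL
          rw [Finset.mul_sum]
          refine Finset.sum_le_sum fun n _ => ?_
          rw [← LA_apply]
          exact mul_le_mul_of_nonneg_right (ha n).2 (LA_nonneg _ _)
      _ ≤ 2 * (C * ⌊x⌋₊ * el ⌊x⌋₊ ^ K) := by linarith [hb _ hf]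
      _ ≤ 2 * (C * x * (2 * Real.log x) ^ K) := by
          have h1 : el (⌊x⌋₊:ℝ) ≤ 2 * Real.log x :=
            le_trans (by unfold el; gcongr) (el_le_two_log hx)
          have h2 : 0 ≤ el (⌊x⌋₊:ℝ) := by
            unfold el; linarith [Real.log_nonneg hf1]
          gcongr
      _ = _ := by rw [mul_pow]; ring
  unfold Tquot
  simp only [Nat.add_sub_cancel]
  have hK : (1:ℝ) ≤ ((K+1:ℕ):ℝ) := by push_cast; linarith [Nat.cast_nonneg (α := ℝ) K]
  have hp : 0 < x * Real.log x ^ K := by positivity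
  constructor
  · positivity
  · rw [div_le_iff₀ (by positivity)]
    refine hS.trans ?_
    have : x * Real.log x ^ K ≤ ((K+1:ℕ):ℝ) * x * Real.log x ^ K := by
      rw [mul_assoc]; exact le_mul_of_one_le_left hp.le hK
    gcongr

theorem main_thm (ν : ℝ) (hν : ν ∈ Set.Ioo (0 : ℝ) 1) :
    ∃ a : ℕ → ℝ, (∀ n, 0 ≤ a n ∧ a n ≤ 2) ∧ Rcond ν a ∧
      ∀ k : ℕ, 1 ≤ k →
        1 < Filter.limsup (fun x : ℝ => Tquot a k x) atTop ∧
        Filter.liminf (fun x : ℝ => Tquot a k x) atTop < 1 := by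
  obtain ⟨hν0, hν1⟩ := hν
  have hη : 0 < (1-ν)/16 := by linarith
  have hη1 : (1-ν)/16 ≤ 1/16 := by linarith
  set η := (1-ν)/16 with hηd
  choose δ hδ hplus hminus using exists_plus hη hη1
  obtain ⟨Xs, h16, h5, hgood⟩ := seq_exists (fun q X => if q % 2 = 0 then
      (1+δ (q/2))*(((q/2:ℕ)+1)*X*Real.log X^(q/2)) ≤ SL (q/2+1) X + BS η (q/2) X - 2*SL (q/2+1) (Nat.sqrt X)
      else SL (q/2+1) X - BS η (q/2) X + 2*SL (q/2+1) (Nat.sqrt X) ≤ (1-δ (q/2))*(((q/2:ℕ)+1)*X*Real.log X^(q/2)))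
    (by
      intro q N0
      by_cases h : q % 2 = 0
      · simp only [h, if_true]; exact hplus (q/2) N0
      · simp only [h, if_false]; exact hminus (q/2) N0)
  set s : ℕ → ℝ := fun j => if (Nat.unpair j).1 % 2 = 0 then 1 else -1 with hsd
  have hs : ∀ j, |s j| ≤ 1 := by
    intro j
    simp only [hsd]
    split_ifs <;> simp
  have ha : ∀ n, 0 ≤ aseq η Xs s n ∧ aseq η Xs s n ≤ 2 := by
    intro n
    have := abs_le.1 (aseq_abs (η := η) (Xs := Xs) (s := s) hs n)
    constructor <;> linarith [this.1, this.2]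
  have hgrow : ∀ j, j ≤ Xs j := by
    intro j
    induction j with
    | zero => exact Nat.zero_le _
    | succ j ih =>
      have h1 := h5 j (j+1) (Nat.lt_succ_self j)
      have h2 : Xs j ^ 2 ≤ Xs j ^ 5 := Nat.pow_le_pow_right (by linarith [h16 j]) (by norm_num)
      have := h16 j
      nlinarith
  refine ⟨aseq η Xs s, ha, Rcond_aseq hν0 hν1 h16 h5 hs, ?_⟩
  intro k hk
  obtain ⟨K, rfl⟩ : ∃ K, k = K+1 := ⟨k-1, by omega⟩
  obtain ⟨M, hM⟩ := tquot_bdd _ ha K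
  have hpos : ∀ j, 0 < ((K+1:ℕ):ℝ) * (Xs j) * Real.log (Xs j) ^ K := by
    intro j
    have h1 : (16:ℝ) ≤ Xs j := by exact_mod_cast h16 j
    have := Real.log_pos (show (1:ℝ) < Xs j by linarith)
    have : (0:ℝ) < Xs j := by linarith
    positivity
  have hfreq : ∀ (P : ℝ → Prop) (q : ℕ), (∀ j, (Nat.unpair j).1 = q →
      (if q % 2 = 0 then
      (1+δ (q/2))*(((q/2:ℕ)+1)*(Xs j)*Real.log (Xs j)^(q/2)) ≤ SL (q/2+1) (Xs j) + BS η (q/2) (Xs j) - 2*SL (q/2+1) (Nat.sqrt (Xs j))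
      else SL (q/2+1) (Xs j) - BS η (q/2) (Xs j) + 2*SL (q/2+1) (Nat.sqrt (Xs j)) ≤ (1-δ (q/2))*(((q/2:ℕ)+1)*(Xs j)*Real.log (Xs j)^(q/2)))
      → P (Xs j)) → ∃ᶠ x in atTop, P x := by
    intro P q h
    rw [Filter.frequently_atTop]
    intro r
    obtain ⟨j, hj, hq, hg⟩ := hgood q ⌈r⌉₊
    refine ⟨Xs j, ?_, h j hq hg⟩
    calc r ≤ ⌈r⌉₊ := Nat.le_ceil r
      _ ≤ Xs j := by exact_mod_cast hj.trans (hgrow j)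
  constructor
  · have hF : ∃ᶠ x in atTop, 1 + δ K ≤ Tquot (aseq η Xs s) (K+1) x := by
      refine hfreq _ (2*K) ?_
      intro j hj hg
      have e1 : 2*K%2 = 0 := by omega
      have e2 : 2*K/2 = K := by omega
      rw [if_pos e1, e2] at hg
      have hsj : s j = 1 := by simp only [hsd, hj, e1, if_true]
      have hA := abs_le.1 (aseq_sum (η := η) h16 h5 hs K j)
      rw [hsj] at hA
      unfold Tquot
      simp only [Nat.add_sub_cancel]
      rw [le_div_iff₀ (hpos j), ssum_nat]
      push_cast
      linarith [hA.1]
    refine lt_of_lt_of_le (by linarith [hδ K]) (Filter.le_limsup_of_frequently_le hF ?_)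
    exact ⟨M, by
      rw [Filter.eventually_map]
      filter_upwards [eventually_ge_atTop (3:ℝ)] with x hx using (hM x hx).2⟩
  · have hF : ∃ᶠ x in atTop, Tquot (aseq η Xs s) (K+1) x ≤ 1 - δ K := by
      refine hfreq _ (2*K+1) ?_
      intro j hj hg
      have e1 : ¬ (2*K+1)%2 = 0 := by omega
      have e2 : (2*K+1)/2 = K := by omega
      rw [if_neg e1, e2] at hg
      have hsj : s j = -1 := by simp only [hsd, hj, e1, if_false]
      have hA := abs_le.1 (aseq_sum (η := η) h16 h5 hs K j)
      rw [hsj] at hA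
      unfold Tquot
      simp only [Nat.add_sub_cancel]
      rw [div_le_iff₀ (hpos j), ssum_nat]
      push_cast
      linarith [hA.2]
    refine lt_of_le_of_lt (Filter.liminf_le_of_frequently_le hF ?_) (by linarith [hδ K])
    exact ⟨0, by
      rw [Filter.eventually_map]
      filter_upwards [eventually_ge_atTop (3:ℝ)] with x hx using (hM x hx).1⟩

end

/-- Fix `ν ∈ (0,1)`.  There exists `(a_n)` with `0 ≤ a_n ≤ 2` satisfying
`R(ν)` such that for every `k ≥ 1`, `limsup_{x→∞} T_k(x) > 1` and `liminf_{x→∞} T_k(x) < 1`. -/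
theorem bombieri_sieve_stmt3 (ν : ℝ) (hν : ν ∈ Set.Ioo (0 : ℝ) 1) :
    ∃ a : ℕ → ℝ, (∀ n, 0 ≤ a n ∧ a n ≤ 2) ∧ Rcond ν a ∧
      ∀ k : ℕ, 1 ≤ k →
        1 < Filter.limsup (fun x : ℝ => Tquot a k x) atTop ∧
        Filter.liminf (fun x : ℝ => Tquot a k x) atTop < 1 := by
  exact main_thm ν hν
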